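/- arXiv:1901.06137 — 4 statements merged into one kernel-verified Lean document; each statement's English description precedes it below -/
import Mathlib

section
/- Let G=(X,Y;E) be a 2-connected bipartite graph with |X| ≥ |Y|. If each vertex of X has degree at least k and each vertex of Y has degree at least l, then G contains a cycle of length at least 2·min{|Y|, k+l−1, 2k−2}. Moreover, if in addition k = l and |X| = |Y|, then G contains a cycle of length at least 2·min{|Y|, 2k−1}. -/
/-- `l` lists the vertices of a path of `G` from `u` to `v`, in order. -/
structure IsPathList {V : Type*} (G : SimpleGraph V) (u v : V) (l : List V) : Prop where
  chain : l.IsChain G.Adj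
  nodup : l.Nodup
  head : l.head? = some u
  last : l.getLast? = some v

/-- `l` lists the vertices of a path of `G` whose last vertex is adjacent to its first one. -/
def IsCycleList {V : Type*} (G : SimpleGraph V) (l : List V) : Prop :=
  ∃ u v, IsPathList G u v l ∧ G.Adj v u

namespace IsPathList

variable {V : Type*} {G : SimpleGraph V} {u v w x : V} {l m : List V}

theorem singleton (u : V) : IsPathList G u u [u] := ⟨by simp, by simp, by simp, by simp⟩

theorem ne_nil (h : IsPathList G u v l) : l ≠ [] := by
  rintro rfl; simpa using h.head

theorem head_mem (h : IsPathList G u v l) : u ∈ l := List.mem_of_head? h.head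

theorem last_mem (h : IsPathList G u v l) : v ∈ l := List.mem_of_getLast? h.last

theorem length_pos (h : IsPathList G u v l) : 1 ≤ l.length :=
  List.length_pos_of_ne_nil h.ne_nil

theorem reverse (h : IsPathList G u v l) : IsPathList G v u l.reverse := by
  refine ⟨?_, List.nodup_reverse.2 h.nodup, by simp [h.last], by simp [h.head]⟩
  rw [List.isChain_reverse]
  exact h.chain.imp fun _ _ h => h.symm

theorem append (h : IsPathList G u v l) (h' : IsPathList G w x m) (hvw : G.Adj v w)
    (hd : ∀ y ∈ l, y ∉ m) : IsPathList G u x (l ++ m) := by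
  refine ⟨List.isChain_append.2 ⟨h.chain, h'.chain, ?_⟩,
    List.nodup_append.2 ⟨h.nodup, h'.nodup, ?_⟩, ?_, ?_⟩
  · intro a ha b hb
    rw [h.last] at ha
    rw [h'.head] at hb
    simp only [Option.mem_def, Option.some.injEq] at ha hb
    exact ha ▸ hb ▸ hvw
  · rintro a ha b hb rfl
    exact hd a ha hb
  · simp [h.head]
  · simp [h'.last]

theorem cons (h : IsPathList G u v l) (hw : G.Adj w u) (hl : w ∉ l) :
    IsPathList G w v (w :: l) :=
  (singleton w).append h hw (by simpa using hl)

theorem concat (h : IsPathList G u v l) (hw : G.Adj v w) (hl : w ∉ l) :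
    IsPathList G u w (l ++ [w]) :=
  h.append (singleton w) hw (by rintro y hy hyw; simp at hyw; exact hl (hyw ▸ hy))

theorem split (h : IsPathList G u v l) (hx : x ∈ l) :
    ∃ l₁ l₂, l = l₁ ++ x :: l₂ ∧ IsPathList G u x (l₁ ++ [x]) ∧ IsPathList G x v (x :: l₂) := by
  obtain ⟨l₁, l₂, rfl⟩ := List.append_of_mem hx
  have hc := List.isChain_split.1 h.chain
  have hn := h.nodup
  refine ⟨l₁, l₂, rfl, ⟨hc.1, ?_, ?_, by simp⟩, ⟨hc.2, (List.nodup_append.1 hn).2.1, by simp, ?_⟩⟩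
  · have : l₁ ++ x :: l₂ = (l₁ ++ [x]) ++ l₂ := by simp
    rw [this] at hn
    exact (List.nodup_append.1 hn).1
  · have := h.head
    cases l₁ <;> simp_all
  · have := h.last
    simpa [List.getLast?_append] using this

theorem eq_cons (h : IsPathList G u v l) : ∃ l', l = u :: l' := by
  have := h.head
  cases l with
  | nil => simp at this
  | cons a l => simp at this; exact ⟨l, by rw [this]⟩

theorem eq_concat (h : IsPathList G u v l) : ∃ l', l = l' ++ [v] := by
  obtain ⟨l', hl'⟩ := h.reverse.eq_cons
  exact ⟨l'.reverse, by rw [← List.reverse_reverse l, hl']; simp⟩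

theorem of_cons_cons {a b : V} (h : IsPathList G u v (a :: b :: l)) :
    u = a ∧ G.Adj a b ∧ IsPathList G b v (b :: l) := by
  obtain ⟨h1, h2, h3, h4⟩ := h
  refine ⟨by simpa using h3.symm, List.isChain_cons_cons.1 h1 |>.1,
    List.isChain_cons_cons.1 h1 |>.2, (List.nodup_cons.1 h2).2, by simp, ?_⟩
  simpa [List.getLast?_cons_cons] using h4

/-- Two paths, the second starting where the first ends and otherwise disjoint from it, join. -/
theorem join (h : IsPathList G u v l) (h' : IsPathList G v w m)
    (hd : ∀ y ∈ l, y ∈ m → y = v) :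
    ∃ k, IsPathList G u w k ∧ (∀ y, y ∈ k ↔ y ∈ l ∨ y ∈ m) ∧
      k.length + 1 = l.length + m.length := by
  obtain ⟨m', rfl⟩ := h'.eq_cons
  cases m' with
  | nil =>
    have hvw : v = w := by simpa using h'.last
    subst hvw
    refine ⟨l, h, fun y => ?_, by simp⟩
    have := h.last_mem
    aesop
  | cons b m' =>
    obtain ⟨-, hab, hb⟩ := h'.of_cons_cons
    have hn := (List.nodup_cons.1 h'.nodup).1
    refine ⟨l ++ b :: m', h.append hb hab ?_, fun y => ?_, by simp; omega⟩
    · intro y hy hy'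
      exact hn (hd y hy (List.mem_cons_of_mem _ hy') ▸ hy')
    · have := h.last_mem
      simp only [List.mem_append, List.mem_cons]
      constructor
      · rintro (h | h) <;> simp [h]
      · rintro (h | rfl | h)
        · exact Or.inl h
        · exact Or.inl this
        · exact Or.inr h

theorem exists_adj_mem (h : IsPathList G u v l) (hx : x ∈ l) (hy : w ∈ l) (hne : w ≠ x) :
    ∃ y ∈ l, G.Adj x y := by
  obtain ⟨l₁, l₂, rfl, h1, h2⟩ := h.split hx
  cases l₂ with
  | cons b l₂ => exact ⟨b, by simp, h2.of_cons_cons.2.1⟩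
  | nil =>
    have h3 := h1.reverse
    simp only [List.reverse_append, List.reverse_cons, List.reverse_nil, List.nil_append,
      List.singleton_append] at h3
    cases hr : l₁.reverse with
    | nil =>
      simp only [List.reverse_eq_nil_iff] at hr
      subst hr
      simp at hy
      exact absurd hy hne
    | cons b l₃ =>
      rw [hr] at h3
      refine ⟨b, ?_, h3.of_cons_cons.2.1⟩
      have : b ∈ l₁.reverse := by simp [hr]
      simp at this
      simp [this]

/-- Two paths with the same ends that are otherwise disjoint form a cycle. -/
theorem isCycleList_of_two (h : IsPathList G u v l) (h' : IsPathList G u v m) (huv : u ≠ v)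
    (hd : ∀ y ∈ l, y ∈ m → y = u ∨ y = v) :
    ∃ C, IsCycleList G C ∧ (∀ y, y ∈ C ↔ y ∈ l ∨ y ∈ m) ∧
      C.length + 2 = l.length + m.length := by
  obtain ⟨m', rfl⟩ := h'.eq_cons
  cases m' with
  | nil => exact absurd (by simpa using h'.last) huv
  | cons b m' =>
    obtain ⟨-, hub, hb⟩ := h'.of_cons_cons
    obtain ⟨m'', hm''⟩ := hb.eq_concat
    have hvl := h.last_mem
    have hul := h.head_mem
    have hn := h'.nodup
    rw [hm''] at hn hd hb h' ⊢
    cases m'' with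
    | nil =>
      simp at hm''
      obtain ⟨rfl, rfl⟩ := hm''
      refine ⟨l, ⟨u, b, h, hub.symm⟩, fun y => ?_, by simp⟩
      simp only [List.nil_append, List.mem_cons, List.not_mem_nil, or_false]
      constructor
      · exact Or.inl
      · rintro (h | rfl | rfl) <;> assumption
    | cons d m'' =>
      simp only [List.cons_append, List.cons.injEq] at hm''
      obtain ⟨rfl, hm''⟩ := hm''
      have hr := hb.reverse
      simp only [List.cons_append, List.reverse_cons, List.reverse_append, List.reverse_nil,
        List.nil_append] at hr
      have key : ∃ e k, m''.reverse ++ [b] = e :: k := by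
        cases m''.reverse with
        | nil => exact ⟨b, [], rfl⟩
        | cons e k => exact ⟨e, k ++ [b], rfl⟩
      obtain ⟨e, k, hek⟩ := key
      rw [hek] at hr
      obtain ⟨-, hve, hk⟩ := hr.of_cons_cons
      have hmem : ∀ y, y ∈ e :: k ↔ y = b ∨ y ∈ m'' := by
        intro y
        rw [← hek]
        simp [or_comm]
      have hlen : (e :: k).length = m''.length + 1 := by rw [← hek]; simp
      refine ⟨l ++ e :: k, ⟨u, b, h.append hk hve ?_, hub.symm⟩, fun y => ?_, ?_⟩
      · intro y hy hy'
        rw [hmem] at hy'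
        simp only [List.cons_append, List.nodup_cons, List.mem_cons, List.mem_append,
          List.not_mem_nil,
          or_false, not_or, List.nodup_append] at hn
        have := hd y hy (by simp; tauto)
        rcases this with rfl | rfl
        · rcases hy' with rfl | hy'
          · exact hn.1.1 rfl
          · exact hn.1.2.1 hy'
        · rcases hy' with rfl | hy'
          · exact hn.2.1.2 rfl
          · exact hn.2.2.2.2 y hy' y (by simp) rfl
      · simp only [List.mem_append, hmem, List.cons_append, List.mem_cons, List.not_mem_nil,
          or_false]
        constructor
        · tauto
        · rintro (h | rfl | rfl | h | rfl) <;> tauto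
      · rw [List.length_append, hlen]
        simp
        omega

end IsPathList

namespace IsCycleList

variable {V : Type*} {G : SimpleGraph V} {v : V} {C : List V}

/-- A cycle can be opened into a path starting at any of its vertices. -/
theorem exists_path (h : IsCycleList G C) (hv : v ∈ C) :
    ∃ w l, IsPathList G v w l ∧ G.Adj w v ∧ (∀ y, y ∈ l ↔ y ∈ C) ∧ l.length = C.length := by
  obtain ⟨a, b, hab, hadj⟩ := h
  obtain ⟨l₁, l₂, rfl, h1, h2⟩ := hab.split hv
  rcases List.eq_nil_or_concat l₁ with rfl | ⟨l₁, w, rfl⟩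
  · have : a = v := by simpa using hab.head.symm
    subst this
    exact ⟨b, _, h2, hadj, fun y => by simp, by simp⟩
  · have h4 : IsPathList G w a (w :: l₁.reverse) ∧ G.Adj v w := by
      have := h1.reverse
      simp only [List.concat_eq_append, List.append_assoc, List.reverse_append, List.reverse_cons,
        List.reverse_nil, List.nil_append, List.cons_append] at this
      exact ⟨this.of_cons_cons.2.2, this.of_cons_cons.2.1⟩
    have hn := hab.nodup
    refine ⟨w, (v :: l₂) ++ (w :: l₁.reverse).reverse, h2.append h4.1.reverse hadj ?_, h4.2.symm,
      fun y => ?_, ?_⟩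
    · intro y hy hy'
      have := (List.nodup_append.1 hn).2.2 y (by simp at hy' ⊢; tauto) y (by simpa using hy)
      exact this rfl
    · simp; tauto
    · simp; omega

end IsCycleList

/-- The vertices `p 0, …, p n` form a path of `G`, in this order. -/
structure IsIndexedPath {V : Type*} (G : SimpleGraph V) (p : ℕ → V) (n : ℕ) : Prop where
  adj : ∀ i < n, G.Adj (p i) (p (i + 1))
  inj : ∀ i ≤ n, ∀ j ≤ n, p i = p j → i = j

/-- The list `p a, p (a + 1), …, p b`. -/
def pathSegment {V : Type*} (p : ℕ → V) (a b : ℕ) : List V := (List.range' a (b + 1 - a)).map p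

/-- The indices `i ≤ n` for which `p i` is a neighbour of `x`. -/
noncomputable def neighborIndices {V : Type*} (G : SimpleGraph V) (p : ℕ → V) (n : ℕ) (x : V) :
    Finset ℕ :=
  open Classical in (Finset.range (n + 1)).filter fun i => G.Adj x (p i)

section Indexed

variable {V : Type*} {G : SimpleGraph V} {p : ℕ → V} {n : ℕ} {u v x : V} {l : List V}

@[simp] theorem mem_pathSegment {a b : ℕ} :
    x ∈ pathSegment p a b ↔ ∃ i, a ≤ i ∧ i ≤ b ∧ p i = x := by
  simp only [pathSegment, List.mem_map, List.mem_range'_1]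
  exact exists_congr fun i => ⟨fun h => ⟨h.1.1, by omega, h.2⟩, fun h => ⟨⟨h.1, by omega⟩, h.2.2⟩⟩

@[simp] theorem length_pathSegment (a b : ℕ) : (pathSegment p a b).length = b + 1 - a := by
  simp [pathSegment]

@[simp] theorem mem_neighborIndices {i : ℕ} :
    i ∈ neighborIndices G p n x ↔ i ≤ n ∧ G.Adj x (p i) := by
  simp [neighborIndices]

theorem IsIndexedPath.isPathList (h : IsIndexedPath G p n) {a b : ℕ} (hab : a ≤ b) (hb : b ≤ n) :
    IsPathList G (p a) (p b) (pathSegment p a b) := by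
  obtain ⟨k, rfl⟩ := Nat.exists_eq_add_of_le hab
  clear hab
  induction k with
  | zero => simpa [pathSegment] using IsPathList.singleton (G := G) (p a)
  | succ k ih =>
    have h1 : pathSegment p a (a + (k + 1)) = pathSegment p a (a + k) ++ [p (a + (k + 1))] := by
      simp only [pathSegment]
      rw [show a + (k + 1) + 1 - a = (a + k + 1 - a) + 1 by omega, List.range'_concat]
      simp
      congr 1
      omega
    rw [h1]
    refine (ih (by omega)).concat (h.adj _ (by omega)) ?_
    simp only [mem_pathSegment, not_exists, not_and]
    intro i hi hi' he
    have := h.inj _ (by omega) _ hb he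
    omega

theorem IsPathList.exists_indexed (h : IsPathList G u v l) :
    ∃ (p : ℕ → V) (n : ℕ), l.length = n + 1 ∧ IsIndexedPath G p n ∧ p 0 = u ∧ p n = v ∧
      ∀ y, y ∈ l ↔ ∃ i ≤ n, p i = y := by
  have hpos := h.length_pos
  obtain ⟨n, hn⟩ : ∃ n, l.length = n + 1 := ⟨l.length - 1, by omega⟩
  have hget : ∀ i (hi : i < l.length), l.getD i u = l[i] := fun i hi => by
    simp [List.getD, hi]
  refine ⟨fun i => l.getD i u, n, hn, ⟨fun i hi => ?_, fun i hi j hj hij => ?_⟩, ?_, ?_,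
    fun y => ?_⟩
  · simp only [hget i (by omega), hget (i + 1) (by omega)]
    exact h.chain.getElem i (by omega)
  · simp only [hget i (by omega), hget j (by omega)] at hij
    exact (h.nodup.getElem_inj_iff).1 hij
  · have := h.head
    rw [List.head?_eq_getElem?] at this
    simp [List.getD, this]
  · have := h.last
    rw [List.getLast?_eq_getElem?, hn] at this
    simp at this
    simp [List.getD, this]
  · constructor
    · intro hy
      obtain ⟨i, hi, rfl⟩ := List.getElem_of_mem hy
      exact ⟨i, by omega, hget i hi⟩
    · rintro ⟨i, hi, rfl⟩
      simp only [hget i (by omega)]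
      exact List.getElem_mem _

variable {c : V → Bool} (hc : ∀ u v, G.Adj u v → c u ≠ c v)
include hc

theorem IsIndexedPath.color (h : IsIndexedPath G p n) {i : ℕ} (hi : i ≤ n) :
    c (p i) = c (p 0) ↔ i % 2 = 0 := by
  induction i with
  | zero => simp
  | succ i ih =>
    have h1 := ih (by omega)
    have h2 := hc _ _ (h.adj i (by omega))
    revert h1 h2
    cases c (p i) <;> cases c (p (i + 1)) <;> cases c (p 0) <;> simp <;> omega

theorem IsPathList.two_mul_card_le (h : IsPathList G u v l) (S : Finset V)
    (hS : ∀ x ∈ S, x ∈ l ∧ c x ≠ c u) : 2 * S.card ≤ l.length := by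
  classical
  obtain ⟨p, n, hn, hp, rfl, -, hmem⟩ := h.exists_indexed
  have hsub : S ⊆ (Finset.range ((n + 1) / 2)).image fun t => p (2 * t + 1) := by
    intro x hx
    obtain ⟨hxl, hxc⟩ := hS x hx
    obtain ⟨i, hi, rfl⟩ := (hmem x).1 hxl
    rw [Ne, hp.color hc hi] at hxc
    refine Finset.mem_image.2 ⟨i / 2, Finset.mem_range.2 (by omega), ?_⟩
    congr 1
    omega
  have := (Finset.card_le_card hsub).trans Finset.card_image_le
  simp at this
  omega

theorem IsCycleList.two_mul_card_le {C : List V} (h : IsCycleList G C) (S : Finset V) (b : Bool)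
    (hS : ∀ x ∈ S, x ∈ C ∧ c x = b) : 2 * S.card ≤ C.length := by
  obtain ⟨u, v, hC, hadj⟩ := h
  have hne := hc _ _ hadj
  by_cases hb : b = c u
  · have := hC.reverse.two_mul_card_le hc S (fun x hx => ⟨by simpa using (hS x hx).1, by
      rw [(hS x hx).2, hb]; exact hne.symm⟩)
    simpa using this
  · exact hC.two_mul_card_le hc S (fun x hx => ⟨(hS x hx).1, by rwa [(hS x hx).2]⟩)

omit hc in
theorem ncard_neighborSet_le_card [Finite V] (hx : ∀ y, G.Adj x y → ∃ i ≤ n, p i = y) :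
    (G.neighborSet x).ncard ≤ (neighborIndices G p n x).card := by
  classical
  have : G.neighborSet x ⊆ ((neighborIndices G p n x).image p : Finset V) := by
    intro y hy
    obtain ⟨i, hi, rfl⟩ := hx y hy
    simp only [Finset.coe_image, Set.mem_image, Finset.mem_coe, mem_neighborIndices]
    exact ⟨i, ⟨hi, hy⟩, rfl⟩
  have h1 := Set.ncard_le_ncard this (Finset.finite_toSet _)
  rw [Set.ncard_coe_finset] at h1
  exact h1.trans Finset.card_image_le

theorem two_mul_ncard_neighborSet_le [Finite V] (hl : IsPathList G u x l)
    (hx : ∀ y, G.Adj x y → y ∈ l ∨ ∃ i ≤ n, p i = y) :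
    2 * (G.neighborSet x).ncard ≤ 2 * (neighborIndices G p n x).card + l.length := by
  classical
  set S := l.toFinset.filter fun y => G.Adj x y with hS
  have hsub : G.neighborSet x ⊆ ((neighborIndices G p n x).image p ∪ S : Finset V) := by
    intro y hy
    simp only [Finset.coe_union, Finset.coe_image, Set.mem_union, Set.mem_image, Finset.mem_coe,
      mem_neighborIndices]
    rcases hx y hy with h | ⟨i, hi, rfl⟩
    · exact Or.inr (by simp only [hS, Finset.mem_filter, List.mem_toFinset]; exact ⟨h, hy⟩)
    · exact Or.inl ⟨i, ⟨hi, hy⟩, rfl⟩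
  have h1 := Set.ncard_le_ncard hsub (Finset.finite_toSet _)
  rw [Set.ncard_coe_finset] at h1
  have h2 := hl.reverse.two_mul_card_le hc S (fun y hy => by
    simp only [hS, Finset.mem_filter, List.mem_toFinset] at hy
    exact ⟨by simpa using hy.1, (hc _ _ hy.2).symm⟩)
  have h3 := Finset.card_union_le ((neighborIndices G p n x).image p) S
  have h4 := Finset.card_image_le (s := neighborIndices G p n x) (f := p)
  simp only [List.length_reverse] at h2
  omega

end Indexed

theorem card_even_le {F : Finset ℕ} {a b m : ℕ} (hb : b ≤ m + 1)
    (hF : ∀ i ∈ F, i % 2 = 0 ∧ (i ≤ a ∨ b ≤ i ∧ i ≤ m)) :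
    F.card + (b + 1) / 2 ≤ a / 2 + 1 + (m / 2 + 1) := by
  have hsub : F.image (· / 2) ⊆
      Finset.range (a / 2 + 1) ∪ Finset.Ico ((b + 1) / 2) (m / 2 + 1) := by
    intro t ht
    obtain ⟨i, hi, rfl⟩ := Finset.mem_image.1 ht
    have := hF i hi
    simp only [Finset.mem_union, Finset.mem_range, Finset.mem_Ico]
    omega
  have h1 := (Finset.card_le_card hsub).trans (Finset.card_union_le _ _)
  rw [Finset.card_image_of_injOn] at h1
  · simp only [Finset.card_range, Nat.card_Ico] at h1
    omega
  · intro i hi j hj hij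
    have := (hF i hi).1
    have := (hF j hj).1
    simp only at hij
    omega

theorem card_odd_le {F : Finset ℕ} {a b m : ℕ} (hb : b ≤ m + 1)
    (hF : ∀ i ∈ F, i % 2 = 1 ∧ (i ≤ a ∨ b ≤ i ∧ i ≤ m)) :
    F.card + b / 2 ≤ (a + 1) / 2 + (m + 1) / 2 := by
  have hsub : F.image (· / 2) ⊆ Finset.range ((a + 1) / 2) ∪ Finset.Ico (b / 2) ((m + 1) / 2) := by
    intro t ht
    obtain ⟨i, hi, rfl⟩ := Finset.mem_image.1 ht
    have := hF i hi
    simp only [Finset.mem_union, Finset.mem_range, Finset.mem_Ico]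
    omega
  have h1 := (Finset.card_le_card hsub).trans (Finset.card_union_le _ _)
  rw [Finset.card_image_of_injOn] at h1
  · simp only [Finset.card_range, Nat.card_Ico] at h1
    omega
  · intro i hi j hj hij
    have := (hF i hi).1
    have := (hF j hj).1
    simp only at hij
    omega

/-- Among lists without repetition satisfying a property there is a longest one. -/
theorem exists_longest_nodup {V : Type*} [Fintype V] (P : List V → Prop)
    (hnd : ∀ l, P l → l.Nodup) (hne : ∃ l, P l) :
    ∃ l, P l ∧ ∀ l', P l' → l'.length ≤ l.length := by
  classical
  obtain ⟨l₀, h₀⟩ := hne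
  have hex : ∃ k, ∃ l, P l ∧ l.length = k := ⟨_, l₀, h₀, rfl⟩
  have hb : ∀ k, (∃ l, P l ∧ l.length = k) → k ≤ Fintype.card V := by
    rintro k ⟨l, hl, rfl⟩
    exact (hnd l hl).length_le_card
  obtain ⟨l, hl, hlk⟩ := Nat.findGreatest_spec (P := fun k => ∃ l, P l ∧ l.length = k)
    (hb _ ⟨l₀, h₀, rfl⟩) ⟨l₀, h₀, rfl⟩
  exact ⟨l, hl, fun l' hl' => hlk ▸ Nat.le_findGreatest (hb _ ⟨l', hl', rfl⟩) ⟨l', hl', rfl⟩⟩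

section Vine

variable {V : Type*} {G : SimpleGraph V} {p : ℕ → V} {n : ℕ} {u v x : V} {l : List V}

theorem IsPathList.exists_prefix (h : IsPathList G u v l) (hx : x ∈ l) :
    ∃ l', IsPathList G u x l' ∧ (∀ y ∈ l', y ∈ l) ∧ (v ∈ l' → v = x) ∧
      (l'.length = l.length → v = x) := by
  obtain ⟨l₁, l₂, rfl, h1, h2⟩ := h.split hx
  rcases List.eq_nil_or_concat l₂ with rfl | ⟨l₂, w, rfl⟩
  · have : x = v := by simpa using h2.last
    exact ⟨_, h1, by simp, fun _ => this.symm, fun _ => this.symm⟩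
  · have : w = v := by
      have := h2.last
      rw [List.concat_eq_append, ← List.cons_append, List.getLast?_append] at this
      simpa using this
    subst this
    have hn := h.nodup
    refine ⟨_, h1, by simp; tauto, fun hw => ?_, by simp⟩
    simp only [List.mem_append, List.mem_singleton] at hw
    rcases hw with hw | hw
    · exact absurd rfl ((List.nodup_append.1 hn).2.2 w hw w (by simp))
    · exact hw

/-- A path from `S` to `T` contains one that meets `S` and `T` only at its ends. -/
theorem IsPathList.exists_trim {S T : V → Prop} (h : IsPathList G u v l) (hS : S u) (hT : T v) :
    ∃ s t l', IsPathList G s t l' ∧ S s ∧ T t ∧ (∀ y ∈ l', y ∈ l) ∧ (∀ y ∈ l', S y → y = s) ∧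
      ∀ y ∈ l', T y → y = t := by
  induction hk : l.length using Nat.strong_induction_on generalizing u v l with
  | _ k ih =>
    subst hk
    by_cases h1 : ∃ y ∈ l, T y ∧ y ≠ v
    · obtain ⟨y, hy, hTy, hne⟩ := h1
      obtain ⟨l', hl', hsub, -, hlen⟩ := h.exists_prefix hy
      have hle : l'.length ≤ l.length := (List.subperm_of_subset hl'.nodup hsub).length_le
      obtain ⟨s, t, l'', h2, h3, h4, h5, h6, h7⟩ := ih l'.length
        (lt_of_le_of_ne hle fun h => hne (hlen h).symm) hl' hS hTy rfl
      exact ⟨s, t, l'', h2, h3, h4, fun z hz => hsub z (h5 z hz), h6, h7⟩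
    by_cases h2 : ∃ y ∈ l, S y ∧ y ≠ u
    · obtain ⟨y, hy, hSy, hne⟩ := h2
      obtain ⟨l', hl', hsub, -, hlen⟩ := h.reverse.exists_prefix (List.mem_reverse.2 hy)
      simp only [List.mem_reverse, List.length_reverse] at hsub hlen
      have hle : l'.length ≤ l.length := (List.subperm_of_subset hl'.nodup hsub).length_le
      obtain ⟨s, t, l'', h2, h3, h4, h5, h6, h7⟩ := ih l'.length
        (lt_of_le_of_ne hle fun h => hne (hlen h).symm) hl'.reverse hSy hT (by simp)
      exact ⟨s, t, l'', h2, h3, h4, fun z hz => hsub z (by simpa using h5 z hz), h6, h7⟩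
    push Not at h1 h2
    exact ⟨u, v, l, h, hS, hT, fun _ => id, h2, h1⟩

/-- In a 2-connected graph, two disjoint paths lead from an initial part `p 0, …, p α` of a path
to its part beyond `p t`, where one of them starts at `p α` and one of them ends at `p t`. -/
theorem exists_disjoint_paths
    (hcut : ∀ z u w, u ≠ z → w ≠ z → ∃ l, IsPathList G u w l ∧ z ∉ l)
    (hp : IsIndexedPath G p n) {α : ℕ} (hα : 0 < α) (t : ℕ) (hαt : α ≤ t) (htn : t < n) :
    ∃ b₁ b₂ t' K₁ K₂, (b₁ = α ∧ b₂ < α ∨ b₂ = α ∧ b₁ < α) ∧ t < t' ∧ t' ≤ n ∧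
      IsPathList G (p b₁) (p t) K₁ ∧ IsPathList G (p b₂) (p t') K₂ ∧ (∀ y ∈ K₁, y ∉ K₂) ∧
      (∀ s ≤ α, p s ∈ K₁ → s = b₁) ∧ (∀ s ≤ α, p s ∈ K₂ → s = b₂) ∧
      (∀ s, t < s → s ≤ n → p s ∉ K₁) ∧ (∀ s, t < s → s ≤ n → p s ∈ K₂ → s = t') := by
  induction t, hαt using Nat.le_induction with
  | base =>
    obtain ⟨l, hl, hαl⟩ := hcut (p α) (p 0) (p n)
      (fun h => by have := hp.inj _ (by omega) _ (by omega) h; omega)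
      (fun h => by have := hp.inj _ (by omega) _ (by omega) h; omega)
    obtain ⟨s, t, l', h1, ⟨a, ha, rfl⟩, ⟨t', ht', htn', rfl⟩, h4, h5, h6⟩ := hl.exists_trim
      (S := fun x => ∃ s, s < α ∧ p s = x) (T := fun x => ∃ s, α < s ∧ s ≤ n ∧ p s = x)
      ⟨0, hα, rfl⟩ ⟨n, htn, le_rfl, rfl⟩
    refine ⟨α, a, t', [p α], l', Or.inl ⟨rfl, ha⟩, ht', htn', .singleton _, h1, ?_, ?_, ?_, ?_, ?_⟩
    · intro y hy hy'
      simp only [List.mem_singleton] at hy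
      exact hαl (h4 _ (hy ▸ hy'))
    · intro s hs hs'
      simp only [List.mem_singleton] at hs'
      exact hp.inj _ (by omega) _ (by omega) hs'
    · intro s hs hs'
      have hne : s ≠ α := by rintro rfl; exact hαl (h4 _ hs')
      exact hp.inj _ (by omega) _ (by omega) (h5 _ hs' ⟨s, by omega, rfl⟩)
    · intro s hs hs1 hs'
      simp only [List.mem_singleton] at hs'
      have := hp.inj _ (by omega) _ (by omega) hs'
      omega
    · intro s hs hs1 hs'
      exact hp.inj _ (by omega) _ (by omega) (h6 _ hs' ⟨s, by omega, hs1, rfl⟩)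
  | succ t hαt ih =>
    obtain ⟨b₁, b₂, t', K₁, K₂, hb, htt', ht'n, hK₁, hK₂, hdis, hA₁, hA₂, hB₁, hB₂⟩ :=
      ih (by omega)
    have hstep : p (t + 1) ∉ K₁ := hB₁ _ (by omega) (by omega)
    have hK₁' : IsPathList G (p b₁) (p (t + 1)) (K₁ ++ [p (t + 1)]) :=
      hK₁.concat (hp.adj _ (by omega)) hstep
    have hA₁' : ∀ s ≤ α, p s ∈ K₁ ++ [p (t + 1)] → s = b₁ := by
      intro s hs hs'
      simp only [List.mem_append, List.mem_singleton] at hs'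
      rcases hs' with hs' | hs'
      · exact hA₁ s hs hs'
      · have := hp.inj _ (by omega) _ (by omega) hs'
        omega
    have hB₁' : ∀ s, t + 1 < s → s ≤ n → p s ∉ K₁ ++ [p (t + 1)] := by
      intro s hs hs1 hs'
      simp only [List.mem_append, List.mem_singleton] at hs'
      rcases hs' with hs' | hs'
      · exact hB₁ s (by omega) hs1 hs'
      · have := hp.inj _ (by omega) _ (by omega) hs'
        omega
    by_cases hne : t' = t + 1
    swap
    · refine ⟨b₁, b₂, t', _, K₂, hb, by omega, ht'n, hK₁', hK₂, ?_, hA₁', hA₂, hB₁',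
        fun s hs => hB₂ s (by omega)⟩
      intro y hy hy'
      simp only [List.mem_append, List.mem_singleton] at hy
      rcases hy with hy | rfl
      · exact hdis y hy hy'
      · exact hne (hB₂ _ (by omega) (by omega) hy').symm
    subst hne
    have hpαne : p α ≠ p (t + 1) := fun h => by
      have := hp.inj _ (by omega) _ (by omega) h
      omega
    have hαmem : p α ∈ K₁ ∨ p α ∈ K₂ := by
      rcases hb with ⟨rfl, -⟩ | ⟨rfl, -⟩
      · exact Or.inl hK₁.head_mem
      · exact Or.inr hK₂.head_mem
    obtain ⟨l, hl, hzl⟩ := hcut (p (t + 1)) (p α) (p n) hpαne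
      (fun h => by have := hp.inj _ (by omega) _ (by omega) h; omega)
    obtain ⟨s₀, t₀, Z, hZ, hs₀, ⟨t'', ht'', htn'', rfl⟩, hZl, hZS, hZT⟩ := hl.exists_trim
      (S := fun x => x ∈ K₁ ∨ x ∈ K₂ ∨ ∃ s, s ≤ α ∧ p s = x)
      (T := fun x => ∃ s, t + 1 < s ∧ s ≤ n ∧ p s = x)
      (Or.inr (Or.inr ⟨α, le_rfl, rfl⟩)) ⟨n, htn, le_rfl, rfl⟩
    have hZt : p (t + 1) ∉ Z := fun h => hzl (hZl _ h)
    have hs₀t : p (t + 1) ≠ s₀ := fun h => hZt (h ▸ hZ.head_mem)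
    have hZB : ∀ s, t + 1 < s → s ≤ n → p s ∈ Z → s = t'' := fun s hs hs1 hs' =>
      hp.inj _ (by omega) _ (by omega) (hZT _ hs' ⟨s, hs, hs1, rfl⟩)
    by_cases h1 : s₀ ∈ K₁
    · obtain ⟨L, hL, hLK, -, -⟩ := hK₁.exists_prefix h1
      obtain ⟨K, hK, hKmem, -⟩ := hL.join hZ
        (fun y hy hy' => hZS y hy' (Or.inl (hLK y hy)))
      have hKK : ∀ y ∈ K, y ∈ K₁ ∨ y ∈ Z := fun y hy => ((hKmem y).1 hy).imp_left (hLK y)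
      refine ⟨b₂, b₁, t'', K₂, K, hb.symm, ht'', htn'', hK₂, hK, ?_, hA₂, ?_, ?_, ?_⟩
      · intro y hy hy'
        rcases hKK y hy' with hy' | hy'
        · exact hdis y hy' hy
        · have := hZS y hy' (Or.inr (Or.inl hy))
          exact hdis y (this ▸ h1) hy
      · intro s hs hs'
        rcases hKK _ hs' with hs' | hs'
        · exact hA₁ s hs hs'
        · exact hA₁ s hs (hZS _ hs' (Or.inr (Or.inr ⟨s, hs, rfl⟩)) ▸ h1)
      · intro s hs hs1 hs'
        have := hB₂ s (by omega) hs1 hs'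
        omega
      · intro s hs hs1 hs'
        rcases hKK _ hs' with hs' | hs'
        · exact absurd hs' (hB₁ s (by omega) hs1)
        · exact hZB s hs hs1 hs'
    by_cases h2 : s₀ ∈ K₂
    · obtain ⟨L, hL, hLK, hLt, -⟩ := hK₂.exists_prefix h2
      obtain ⟨K, hK, hKmem, -⟩ := hL.join hZ
        (fun y hy hy' => hZS y hy' (Or.inr (Or.inl (hLK y hy))))
      have hKK : ∀ y ∈ K, y ∈ K₂ ∨ y ∈ Z := fun y hy => ((hKmem y).1 hy).imp_left (hLK y)
      refine ⟨b₁, b₂, t'', _, K, hb, ht'', htn'', hK₁', hK, ?_, hA₁', ?_, hB₁', ?_⟩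
      · intro y hy hy'
        simp only [List.mem_append, List.mem_singleton] at hy
        rcases hy with hy | rfl
        · rcases hKK y hy' with hy' | hy'
          · exact hdis y hy hy'
          · have := hZS y hy' (Or.inl hy)
            exact hdis y hy (this ▸ h2)
        · rcases (hKmem _).1 hy' with hy' | hy'
          · exact hs₀t (hLt hy')
          · exact hZt hy'
      · intro s hs hs'
        rcases hKK _ hs' with hs' | hs'
        · exact hA₂ s hs hs'
        · exact hA₂ s hs (hZS _ hs' (Or.inr (Or.inr ⟨s, hs, rfl⟩)) ▸ h2)
      · intro s hs hs1 hs'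
        rcases hKK _ hs' with hs' | hs'
        · have := hB₂ s (by omega) hs1 hs'
          omega
        · exact hZB s hs hs1 hs'
    obtain ⟨a, ha, rfl⟩ : ∃ s, s ≤ α ∧ p s = s₀ := by tauto
    have haα : a < α := by
      refine lt_of_le_of_ne ha ?_
      rintro rfl
      tauto
    have hZA : ∀ s ≤ α, p s ∈ Z → s = a := fun s hs hs' =>
      hp.inj _ (by omega) _ (by omega) (hZS _ hs' (Or.inr (Or.inr ⟨s, hs, rfl⟩)))
    rcases hb with ⟨rfl, hb⟩ | ⟨rfl, hb⟩
    · refine ⟨b₁, a, t'', _, Z, Or.inl ⟨rfl, haα⟩, ht'', htn'', hK₁', hZ, ?_, hA₁', hZA, hB₁', hZB⟩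
      intro y hy hy'
      simp only [List.mem_append, List.mem_singleton] at hy
      rcases hy with hy | rfl
      · exact h1 (hZS y hy' (Or.inl hy) ▸ hy)
      · exact hZt hy'
    · refine ⟨b₂, a, t'', K₂, Z, Or.inl ⟨rfl, haα⟩, ht'', htn'', hK₂, hZ, ?_, hA₂, hZA, ?_, hZB⟩
      · intro y hy hy'
        exact h2 (hZS y hy' (Or.inr (Or.inl hy)) ▸ hy)
      · intro s hs hs1 hs'
        have := hB₂ s (by omega) hs1 hs'
        omega

end Vine

section ClosedEnds

variable {V : Type*} {G : SimpleGraph V} {p : ℕ → V} {n : ℕ} {u v x : V} {l : List V}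

theorem IsIndexedPath.isCycleList_of_crossing (h : IsIndexedPath G p n) {i j : ℕ} (hij : i < j)
    (hjn : j ≤ n) (hi : G.Adj (p n) (p i)) (hj : G.Adj (p 0) (p j)) :
    ∃ C, IsCycleList G C ∧ (∀ y, y ∈ C ↔ ∃ s ≤ n, (s ≤ i ∨ j ≤ s) ∧ p s = y) ∧
      C.length + j = n + 2 + i := by
  have h1 := h.isPathList (Nat.zero_le i) (by omega)
  have h2 := (h.isPathList hjn le_rfl).reverse
  refine ⟨_, ⟨_, _, h1.append h2 hi.symm ?_, hj.symm⟩, ?_, ?_⟩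
  · simp only [List.mem_reverse, mem_pathSegment]
    rintro y ⟨s, -, hs, rfl⟩ ⟨s', hs', hs'n, he⟩
    have := h.inj _ (by omega) _ (by omega) he
    omega
  · intro y
    simp only [List.mem_append, List.mem_reverse, mem_pathSegment]
    constructor
    · rintro (⟨s, -, hs, rfl⟩ | ⟨s, hs, hs', rfl⟩)
      · exact ⟨s, by omega, Or.inl hs, rfl⟩
      · exact ⟨s, by omega, Or.inr hs, rfl⟩
    · rintro ⟨s, hs, hs' | hs', rfl⟩
      · exact Or.inl ⟨s, by omega, hs', rfl⟩
      · exact Or.inr ⟨s, hs', hs, rfl⟩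
  · simp
    omega

variable {c : V → Bool} (hc : ∀ u v, G.Adj u v → c u ≠ c v)
include hc

theorem IsIndexedPath.neighborIndices_parity (h : IsIndexedPath G p n) {i j : ℕ} (hj : j ≤ n)
    (hi : i ∈ neighborIndices G p n (p j)) : i % 2 ≠ j % 2 := by
  rw [mem_neighborIndices] at hi
  have h1 := hc _ _ hi.2
  have h2 := h.color hc hi.1
  have h3 := h.color hc hj
  intro he
  rw [he] at h2
  apply h1
  revert h2 h3
  cases c (p i) <;> cases c (p j) <;> cases c (p 0) <;> simp

theorem IsIndexedPath.exists_cycle_of_not_crossing (h : IsIndexedPath G p n)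
    (hcut : ∀ z u w, u ≠ z → w ≠ z → ∃ l, IsPathList G u w l ∧ z ∉ l) (hn : 0 < n)
    (hcross : ∀ i ∈ neighborIndices G p n (p n), ∀ j ∈ neighborIndices G p n (p 0), j ≤ i) :
    ∃ C, IsCycleList G C ∧ 2 * ((neighborIndices G p n (p 0)).card +
      (neighborIndices G p n (p n)).card) ≤ C.length + 2 := by
  classical
  have hpar : ∀ i ∈ neighborIndices G p n (p 0), i % 2 = 1 := fun i hi => by
    have := h.neighborIndices_parity hc (Nat.zero_le n) hi
    omega
  have hpar' : ∀ i ∈ neighborIndices G p n (p n), i % 2 ≠ n % 2 := fun i hi =>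
    h.neighborIndices_parity hc le_rfl hi
  have hI1 : 1 ∈ neighborIndices G p n (p 0) := by
    rw [mem_neighborIndices]
    exact ⟨hn, h.adj 0 hn⟩
  have hJ1 : n - 1 ∈ neighborIndices G p n (p n) := by
    rw [mem_neighborIndices]
    have := h.adj (n - 1) (by omega)
    rw [Nat.sub_add_cancel hn] at this
    exact ⟨by omega, this.symm⟩
  have hIn : ∀ i ∈ neighborIndices G p n (p 0), i ≤ n ∧ G.Adj (p 0) (p i) := fun i hi => by
    rwa [mem_neighborIndices] at hi
  have hJn : ∀ i ∈ neighborIndices G p n (p n), i ≤ n ∧ G.Adj (p n) (p i) := fun i hi => by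
    rwa [mem_neighborIndices] at hi
  generalize neighborIndices G p n (p 0) = I at *
  generalize neighborIndices G p n (p n) = J at *
  obtain ⟨α, hαI, hα⟩ := I.exists_max_image id ⟨1, hI1⟩
  obtain ⟨β, hβJ, hβ⟩ := J.exists_min_image id ⟨_, hJ1⟩
  simp only [id] at hα hβ
  have hα1 := hα 1 hI1
  have hβ1 := hβ _ hJ1
  have hαβ := hcross β hβJ α hαI
  obtain ⟨b₁, b₂, t, K₁, K₂, hb, hβt, htn, hK₁, hK₂, hdis, hA₁, hA₂, hB₁, hB₂⟩ :=
    exists_disjoint_paths hcut h (by omega : 0 < α) β hαβ (by omega)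
  obtain ⟨a, ha⟩ : ∃ a, a = min b₁ b₂ := ⟨_, rfl⟩
  have haα : a < α := by omega
  obtain ⟨j, hj, hjmin⟩ := (I.filter (a < ·)).exists_min_image id
    ⟨α, Finset.mem_filter.2 ⟨hαI, haα⟩⟩
  obtain ⟨i, hi, himax⟩ := (J.filter (· < t)).exists_max_image id
    ⟨β, Finset.mem_filter.2 ⟨hβJ, hβt⟩⟩
  simp only [Finset.mem_filter, id, and_imp] at hj hi hjmin himax
  have hjα := hα _ hj.1
  have hβi := hβ _ hi.1
  have hA0 : IsPathList G (p a) (p α) ((pathSegment p 0 a).reverse ++ pathSegment p j α) := by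
    refine (h.isPathList (Nat.zero_le a) (by omega)).reverse.append
      (h.isPathList hjα (by omega)) (hIn j hj.1).2 ?_
    simp only [List.mem_reverse, mem_pathSegment]
    rintro y ⟨s, -, hs, rfl⟩ ⟨s', hs', hs'n, he⟩
    have := h.inj _ (by omega) _ (by omega) he
    omega
  have hAex : ∃ A, IsPathList G (p b₁) (p b₂) A ∧
      ∀ y, y ∈ A ↔ ∃ s ≤ α, (s ≤ a ∨ j ≤ s) ∧ p s = y := by
    have hmem : ∀ y, y ∈ (pathSegment p 0 a).reverse ++ pathSegment p j α ↔
        ∃ s ≤ α, (s ≤ a ∨ j ≤ s) ∧ p s = y := by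
      intro y
      simp only [List.mem_append, List.mem_reverse, mem_pathSegment]
      constructor
      · rintro (⟨s, -, hs, rfl⟩ | ⟨s, hs, hs', rfl⟩)
        · exact ⟨s, by omega, Or.inl hs, rfl⟩
        · exact ⟨s, by omega, Or.inr hs, rfl⟩
      · rintro ⟨s, hs, hs' | hs', rfl⟩
        · exact Or.inl ⟨s, by omega, hs', rfl⟩
        · exact Or.inr ⟨s, hs', hs, rfl⟩
    rcases hb with ⟨rfl, hb⟩ | ⟨rfl, hb⟩
    · rw [min_eq_right hb.le] at ha
      subst ha
      exact ⟨_, hA0.reverse, by simpa [or_comm] using hmem⟩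
    · rw [min_eq_left hb.le] at ha
      subst ha
      exact ⟨_, hA0, hmem⟩
  obtain ⟨A, hA, hAmem⟩ := hAex
  have hB : IsPathList G (p β) (p t) (pathSegment p β i ++ (pathSegment p t n).reverse) := by
    refine (h.isPathList hβi (by omega)).append (h.isPathList htn le_rfl).reverse
      (hJn i hi.1).2.symm ?_
    simp only [List.mem_reverse, mem_pathSegment]
    rintro y ⟨s, -, hs, rfl⟩ ⟨s', hs', hs'n, he⟩
    have := h.inj _ (by omega) _ (by omega) he
    omega
  obtain ⟨M₁, hM₁, hM₁mem, -⟩ := hK₁.reverse.join hA (by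
    intro y hy hy'
    obtain ⟨s, hs, -, rfl⟩ := (hAmem y).1 hy'
    rw [hA₁ s hs (List.mem_reverse.1 hy)])
  obtain ⟨M, hM, hMmem, -⟩ := hM₁.join hK₂ (by
    intro y hy hy'
    rcases (hM₁mem y).1 hy with hy | hy
    · exact absurd hy' (hdis y (List.mem_reverse.1 hy))
    · obtain ⟨s, hs, -, rfl⟩ := (hAmem y).1 hy
      rw [hA₂ s hs hy'])
  obtain ⟨C, hC, hCmem, -⟩ := hM.isCycleList_of_two hB (fun he => by
    have := h.inj _ (by omega) _ (by omega) he
    omega) (by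
    intro y hy hy'
    simp only [List.mem_append, List.mem_reverse, mem_pathSegment] at hy'
    obtain ⟨s, hβs, hsn, rfl⟩ : ∃ s, β ≤ s ∧ s ≤ n ∧ p s = y := by
      rcases hy' with ⟨s, h1, h2, rfl⟩ | ⟨s, h1, h2, rfl⟩ <;> exact ⟨s, by omega, by omega, rfl⟩
    rcases eq_or_lt_of_le hβs with rfl | hβs
    · exact Or.inl rfl
    right
    rcases (hMmem _).1 hy with hy | hy
    · exfalso
      rcases (hM₁mem _).1 hy with hy | hy
      · exact hB₁ s hβs hsn (List.mem_reverse.1 hy)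
      · obtain ⟨s', hs', -, he⟩ := (hAmem _).1 hy
        have := h.inj _ (by omega) _ (by omega) he
        omega
    · rw [hB₂ s hβs hsn hy])
  have hCA : ∀ s ≤ α, (s ≤ a ∨ j ≤ s) → p s ∈ C := fun s hs hs' =>
    (hCmem _).2 (Or.inl ((hMmem _).2 (Or.inl ((hM₁mem _).2 (Or.inr ((hAmem _).2
      ⟨s, hs, hs', rfl⟩))))))
  have hCJ : ∀ s ∈ J, p s ∈ C := fun s hs => (hCmem _).2 (Or.inr (by
    simp only [List.mem_append, List.mem_reverse, mem_pathSegment]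
    rcases lt_or_ge s t with hst | hst
    · exact Or.inl ⟨s, hβ s hs, himax s hs hst, rfl⟩
    · exact Or.inr ⟨s, hst, (hJn s hs).1, rfl⟩))
  have key : ∀ S : Finset ℕ, I.card + J.card ≤ S.card + 1 →
      (∃ r, ∀ s ∈ S, s ≤ n ∧ s % 2 = r ∧ p s ∈ C) → 2 * (I.card + J.card) ≤ C.length + 2 := by
    rintro S hcard ⟨r, hS⟩
    have hinj : (S.image p).card = S.card := Finset.card_image_of_injOn fun x hx y hy hxy =>
      h.inj _ (hS x hx).1 _ (hS y hy).1 hxy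
    have := hC.two_mul_card_le hc (S.image p) (if r = 0 then c (p 0) else !(c (p 0))) (by
      intro y hy
      obtain ⟨s, hs, rfl⟩ := Finset.mem_image.1 hy
      obtain ⟨h1, h2, h3⟩ := hS s hs
      refine ⟨h3, ?_⟩
      have := h.color hc h1
      rw [h2] at this
      split_ifs with hr
      · exact this.2 hr
      · have := mt this.1 hr
        revert this
        cases c (p s) <;> cases c (p 0) <;> simp)
    omega
  refine ⟨C, hC, ?_⟩
  rcases Nat.mod_two_eq_zero_or_one n with hn2 | hn2
  · refine key (I.erase α ∪ J) ?_ ⟨1, fun s hs => ?_⟩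
    · rw [Finset.card_union_of_disjoint, Finset.card_erase_of_mem hαI]
      · omega
      · rw [Finset.disjoint_left]
        intro s hs hs'
        rw [Finset.mem_erase] at hs
        have := hα s hs.2
        have := hβ s hs'
        omega
    · rw [Finset.mem_union, Finset.mem_erase] at hs
      rcases hs with hs | hs
      · refine ⟨(hIn s hs.2).1, hpar s hs.2, hCA s (hα s hs.2) ?_⟩
        by_cases hsa : s ≤ a
        · exact Or.inl hsa
        · exact Or.inr (hjmin s hs.2 (by omega))
      · exact ⟨(hJn s hs).1, by have := hpar' s hs; omega, hCJ s hs⟩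
  · refine key ((I.erase j).image (· - 1) ∪ J) ?_ ⟨0, fun s hs => ?_⟩
    · rw [Finset.card_union_of_disjoint, Finset.card_image_of_injOn,
        Finset.card_erase_of_mem hj.1]
      · omega
      · intro x hx y hy hxy
        have := hpar x (Finset.mem_of_mem_erase hx)
        have := hpar y (Finset.mem_of_mem_erase hy)
        simp only at hxy
        omega
      · rw [Finset.disjoint_left]
        intro s hs hs'
        obtain ⟨r, hr, rfl⟩ := Finset.mem_image.1 hs
        rw [Finset.mem_erase] at hr
        have := hα r hr.2
        have := hβ _ hs'
        have := hpar r hr.2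
        omega
    · rw [Finset.mem_union, Finset.mem_image] at hs
      rcases hs with ⟨s, hs, rfl⟩ | hs
      · rw [Finset.mem_erase] at hs
        have h1 := hpar s hs.2
        have h2 := hα s hs.2
        refine ⟨by omega, by omega, hCA _ (by omega) ?_⟩
        by_cases hsa : s ≤ a
        · left; omega
        · have := hjmin s hs.2 (by omega)
          right; omega
      · exact ⟨(hJn s hs).1, by have := hpar' s hs; omega, hCJ s hs⟩

theorem IsPathList.exists_cycle_of_color_ne [Finite V] (h : IsPathList G u v l)
    (hcut : ∀ z u w, u ≠ z → w ≠ z → ∃ l, IsPathList G u w l ∧ z ∉ l)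
    (hu : ∀ z, G.Adj u z → z ∈ l) (hv : ∀ z, G.Adj v z → z ∈ l) (huv : c u ≠ c v) :
    ∃ C, IsCycleList G C ∧ (2 * ((G.neighborSet u).ncard + (G.neighborSet v).ncard) ≤ C.length + 2 ∨
      (∀ y, y ∈ C ↔ y ∈ l) ∧ C.length = l.length) := by
  classical
  obtain ⟨p, n, hn, hp, rfl, rfl, hmem⟩ := h.exists_indexed
  have hd0 := ncard_neighborSet_le_card (x := p 0) (fun y hy => (hmem y).1 (hu y hy))
  have hdn := ncard_neighborSet_le_card (x := p n) (fun y hy => (hmem y).1 (hv y hy))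
  have hn1 : n % 2 = 1 := by
    have := mt (hp.color hc le_rfl).2 huv.symm
    omega
  by_cases hcross : ∀ i ∈ neighborIndices G p n (p n), ∀ j ∈ neighborIndices G p n (p 0), j ≤ i
  · obtain ⟨C, hC, hlen⟩ := hp.exists_cycle_of_not_crossing hc hcut (by omega) hcross
    exact ⟨C, hC, Or.inl (by omega)⟩
  push Not at hcross
  have hpar : ∀ i ∈ neighborIndices G p n (p 0), i % 2 = 1 := fun i hi => by
    have := hp.neighborIndices_parity hc (Nat.zero_le n) hi
    omega
  have hpar' : ∀ i ∈ neighborIndices G p n (p n), i % 2 = 0 := fun i hi => by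
    have := hp.neighborIndices_parity hc le_rfl hi
    omega
  obtain ⟨⟨i, j⟩, hij, hmin⟩ := ((neighborIndices G p n (p n) ×ˢ neighborIndices G p n (p 0)).filter
    fun q => q.1 < q.2).exists_min_image (fun q => q.2 - q.1) (by
      obtain ⟨i, hi, j, hj, hij⟩ := hcross
      exact ⟨(i, j), by simp only [Finset.mem_filter, Finset.mem_product]; exact ⟨⟨hi, hj⟩, hij⟩⟩)
  simp only [Finset.mem_filter, Finset.mem_product, Prod.forall, and_imp] at hij hmin
  obtain ⟨⟨hi, hj⟩, hij⟩ := hij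
  have hi' := mem_neighborIndices.1 hi
  have hj' := mem_neighborIndices.1 hj
  obtain ⟨C, hC, hCmem, hClen⟩ := hp.isCycleList_of_crossing hij hj'.1 hi'.2 hj'.2
  refine ⟨C, hC, ?_⟩
  by_cases hji : j = i + 1
  · right
    refine ⟨fun y => ?_, by omega⟩
    rw [hCmem, hmem]
    exact exists_congr fun s => and_congr_right fun _ => and_iff_right (by omega)
  left
  have hF := card_even_le (F := (neighborIndices G p n (p 0)).image (· - 1) ∪
    neighborIndices G p n (p n)) (a := i) (b := j - 1) (m := n) (by omega) (by
      intro s hs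
      rw [Finset.mem_union, Finset.mem_image] at hs
      rcases hs with ⟨s, hs, rfl⟩ | hs
      · have h1 := hpar s hs
        have h2 := (mem_neighborIndices.1 hs).1
        have h3 := hmin i s hi hs
        omega
      · have h1 := hpar' s hs
        have h2 := (mem_neighborIndices.1 hs).1
        have h3 := hmin s j hs hj
        omega)
  rw [Finset.card_union_of_disjoint, Finset.card_image_of_injOn] at hF
  · have := hpar j hj
    have := hpar' i hi
    omega
  · intro x hx y hy hxy
    have := hpar x hx
    have := hpar y hy
    simp only at hxy
    omega
  · rw [Finset.disjoint_left]
    intro s hs hs'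
    obtain ⟨r, hr, rfl⟩ := Finset.mem_image.1 hs
    have h1 := hpar r hr
    have h2 := hmin (r - 1) r hs' hr (by omega)
    have := hpar j hj
    have := hpar' i hi
    omega

theorem IsPathList.exists_cycle_of_color_eq [Finite V] (h : IsPathList G u v l)
    (hcut : ∀ z u w, u ≠ z → w ≠ z → ∃ l, IsPathList G u w l ∧ z ∉ l)
    (hu : ∀ z, G.Adj u z → z ∈ l) (hv : ∀ z, G.Adj v z → z ∈ l) (huv : c u = c v) (hne : u ≠ v) :
    (∃ C, IsCycleList G C ∧
      2 * ((G.neighborSet u).ncard + (G.neighborSet v).ncard) ≤ C.length + 4) ∨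
    ∃ z C l', IsCycleList G C ∧ z ∉ C ∧ c z = c u ∧ (∀ x, x ∈ l ↔ x ∈ C ∨ x = z) ∧
      C.length + 1 = l.length ∧ IsPathList G z u l' ∧ (∀ x, x ∈ l' ↔ x ∈ l) := by
  classical
  obtain ⟨p, n, hn, hp, rfl, rfl, hmem⟩ := h.exists_indexed
  have hd0 := ncard_neighborSet_le_card (x := p 0) (fun y hy => (hmem y).1 (hu y hy))
  have hdn := ncard_neighborSet_le_card (x := p n) (fun y hy => (hmem y).1 (hv y hy))
  have hn0 : n ≠ 0 := by rintro rfl; exact hne rfl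
  have hn1 : n % 2 = 0 := (hp.color hc le_rfl).1 huv.symm
  by_cases hcross : ∀ i ∈ neighborIndices G p n (p n), ∀ j ∈ neighborIndices G p n (p 0), j ≤ i
  · obtain ⟨C, hC, hlen⟩ := hp.exists_cycle_of_not_crossing hc hcut (by omega) hcross
    exact Or.inl ⟨C, hC, by omega⟩
  push Not at hcross
  have hpar : ∀ i ∈ neighborIndices G p n (p 0), i % 2 = 1 := fun i hi => by
    have := hp.neighborIndices_parity hc (Nat.zero_le n) hi
    omega
  have hpar' : ∀ i ∈ neighborIndices G p n (p n), i % 2 = 1 := fun i hi => by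
    have := hp.neighborIndices_parity hc le_rfl hi
    omega
  obtain ⟨⟨i, j⟩, hij, hmin⟩ := ((neighborIndices G p n (p n) ×ˢ neighborIndices G p n (p 0)).filter
    fun q => q.1 < q.2).exists_min_image (fun q => q.2 - q.1) (by
      obtain ⟨i, hi, j, hj, hij⟩ := hcross
      exact ⟨(i, j), by simp only [Finset.mem_filter, Finset.mem_product]; exact ⟨⟨hi, hj⟩, hij⟩⟩)
  simp only [Finset.mem_filter, Finset.mem_product, Prod.forall, and_imp] at hij hmin
  obtain ⟨⟨hi, hj⟩, hij⟩ := hij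
  have hi' := mem_neighborIndices.1 hi
  have hj' := mem_neighborIndices.1 hj
  have hi2 := hpar' i hi
  have hj2 := hpar j hj
  obtain ⟨C, hC, hCmem, hClen⟩ := hp.isCycleList_of_crossing hij hj'.1 hi'.2 hj'.2
  by_cases hji : j = i + 2
  · right
    refine ⟨p (i + 1), C, _, hC, ?_, (hp.color hc (by omega)).2 (by omega), ?_, by omega,
      (hp.isPathList (a := i + 1) (by omega) le_rfl).append
        (hp.isPathList (Nat.zero_le i) (by omega)).reverse hi'.2 ?_, ?_⟩
    · rw [hCmem]
      rintro ⟨s, hs, hs', he⟩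
      have := hp.inj _ hs _ (by omega) he
      omega
    · intro x
      rw [hCmem, hmem]
      constructor
      · rintro ⟨s, hs, rfl⟩
        by_cases hsi : s = i + 1
        · exact Or.inr (by rw [hsi])
        · exact Or.inl ⟨s, hs, by omega, rfl⟩
      · rintro (⟨s, hs, -, rfl⟩ | rfl)
        · exact ⟨s, hs, rfl⟩
        · exact ⟨i + 1, by omega, rfl⟩
    · simp only [List.mem_reverse, mem_pathSegment]
      rintro y ⟨s, hs, hs', rfl⟩ ⟨s', -, hs'i, he⟩
      have := hp.inj _ (by omega) _ (by omega) he
      omega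
    · intro x
      simp only [hmem, List.mem_append, List.mem_reverse, mem_pathSegment]
      constructor
      · rintro (⟨s, -, hs, rfl⟩ | ⟨s, -, hs, rfl⟩)
        · exact ⟨s, hs, rfl⟩
        · exact ⟨s, by omega, rfl⟩
      · rintro ⟨s, hs, rfl⟩
        by_cases hsi : s ≤ i
        · exact Or.inr ⟨s, by omega, hsi, rfl⟩
        · exact Or.inl ⟨s, by omega, hs, rfl⟩
  left
  refine ⟨C, hC, ?_⟩
  have hI1 : 1 ∈ neighborIndices G p n (p 0) := by
    rw [mem_neighborIndices]
    exact ⟨by omega, hp.adj 0 (by omega)⟩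
  have hF := card_odd_le (F := ((neighborIndices G p n (p 0)).erase 1).image (· - 2) ∪
    neighborIndices G p n (p n)) (a := i) (b := j - 2) (m := n) (by omega) (by
      intro s hs
      rw [Finset.mem_union, Finset.mem_image] at hs
      rcases hs with ⟨s, hs, rfl⟩ | hs
      · rw [Finset.mem_erase] at hs
        have h1 := hpar s hs.2
        have h2 := (mem_neighborIndices.1 hs.2).1
        have h3 := hmin i s hi hs.2
        omega
      · have h1 := hpar' s hs
        have h2 := (mem_neighborIndices.1 hs).1
        have h3 := hmin s j hs hj
        omega)
  rw [Finset.card_union_of_disjoint, Finset.card_image_of_injOn, Finset.card_erase_of_mem hI1] at hF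
  · omega
  · intro x hx y hy hxy
    have h1 := Finset.mem_erase.1 hx
    have h2 := Finset.mem_erase.1 hy
    have := hpar x h1.2
    have := hpar y h2.2
    simp only at hxy
    omega
  · rw [Finset.disjoint_left]
    intro s hs hs'
    obtain ⟨r, hr, rfl⟩ := Finset.mem_image.1 hs
    rw [Finset.mem_erase] at hr
    have h1 := hpar r hr.2
    have h2 := hmin (r - 2) r hs' hr.2 (by omega)
    omega

end ClosedEnds

section Search

variable {V : Type*} {G : SimpleGraph V} {c : V → Bool} (hc : ∀ u v, G.Adj u v → c u ≠ c v)
include hc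

/-- Depth-first search: inside `U` either some path from `r` ends at a `true` vertex without
neighbours in `U` off the path, or the `true` vertices are in the minority (strictly if `r` is
`false`) in a set closed under adjacency in `U` and containing `r`. -/
theorem exists_path_or_closed_set (U : Finset V) {r : V} (hr : r ∈ U) :
    (∃ a l, IsPathList G r a l ∧ (∀ y ∈ l, y ∈ U) ∧ c a = true ∧ (∀ z ∈ U, G.Adj a z → z ∈ l) ∧
      (a = r → ∀ z ∈ U, ¬ G.Adj r z)) ∨
    ∃ R ⊆ U, r ∈ R ∧ (∀ x ∈ R, ∀ z ∈ U, G.Adj x z → z ∈ R) ∧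
      (R.filter (c · = true)).card + (if c r = true then 0 else 1) ≤
        (R.filter (c · = false)).card := by
  classical
  induction hk : U.card using Nat.strong_induction_on generalizing U r with
  | _ k ih =>
    subst hk
    by_cases hiso : ∀ z ∈ U, ¬ G.Adj r z
    · cases hcr : c r
      · exact Or.inr ⟨{r}, by simpa using hr, by simp,
        by simpa using fun z hz h => absurd h (hiso z hz), by
          simp [Finset.filter_singleton, hcr]⟩
      · exact Or.inl ⟨r, [r], .singleton r, by simpa using hr, hcr,
          fun z hz h => absurd h (hiso z hz), fun _ => hiso⟩
    push Not at hiso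
    obtain ⟨r', hr'U, hrr'⟩ := hiso
    have hcr := hc _ _ hrr'
    rcases ih (U.erase r).card (Finset.card_erase_lt_of_mem hr) (U.erase r) (r := r')
      (Finset.mem_erase.2 ⟨hrr'.ne', hr'U⟩) rfl with
      ⟨a, l, hl, hlU, hca, hal, -⟩ | ⟨R₁, hR₁U, hrR₁, hR₁, hcard₁⟩
    · left
      refine ⟨a, r :: l, hl.cons hrr' (fun h => by simpa using hlU r h), ?_, hca, ?_, ?_⟩
      · simp only [List.mem_cons, forall_eq_or_imp]
        exact ⟨hr, fun y hy => Finset.mem_of_mem_erase (hlU y hy)⟩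
      · intro z hz haz
        rw [List.mem_cons]
        by_cases hzr : z = r
        · exact Or.inl hzr
        · exact Or.inr (hal z (Finset.mem_erase.2 ⟨hzr, hz⟩) haz)
      · rintro rfl
        simpa using hlU _ hl.last_mem
    have hrR₁' : r ∉ R₁ := fun h => by simpa using hR₁U h
    rcases ih (U \ R₁).card (Finset.card_lt_card ⟨Finset.sdiff_subset, fun h =>
        (Finset.mem_sdiff.1 (h hr'U)).2 hrR₁⟩) (U \ R₁) (r := r)
      (Finset.mem_sdiff.2 ⟨hr, hrR₁'⟩) rfl with
      ⟨a, l, hl, hlU, hca, hal, har⟩ | ⟨R₂, hR₂U, hrR₂, hR₂, hcard₂⟩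
    · by_cases hne : a = r
      · subst hne
        right
        refine ⟨insert a R₁, ?_, Finset.mem_insert_self _ _, ?_, ?_⟩
        · exact Finset.insert_subset hr (hR₁U.trans (Finset.erase_subset _ _))
        · intro x hx z hz hxz
          rw [Finset.mem_insert] at hx ⊢
          by_cases hza : z = a
          · exact Or.inl hza
          right
          rcases hx with rfl | hx
          · by_contra hzR
            exact har rfl z (Finset.mem_sdiff.2 ⟨hz, hzR⟩) hxz
          · exact hR₁ x hx z (Finset.mem_erase.2 ⟨hza, hz⟩) hxz
        · rw [hca] at hcr
          rw [if_neg (by simpa using hcr.symm)] at hcard₁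
          have h1 := Finset.card_insert_le a (R₁.filter (c · = true))
          simp only [Finset.filter_insert, hca, reduceCtorEq, if_true, if_false]
          omega
      · left
        refine ⟨a, l, hl, fun y hy => (Finset.mem_sdiff.1 (hlU y hy)).1, hca, ?_,
          fun h => absurd h hne⟩
        intro z hz haz
        refine hal z (Finset.mem_sdiff.2 ⟨hz, fun hzR => ?_⟩) haz
        have haU := Finset.mem_sdiff.1 (hlU a hl.last_mem)
        exact haU.2 (hR₁ z hzR a (Finset.mem_erase.2 ⟨hne, haU.1⟩) haz.symm)
    · right
      have hdis : Disjoint R₁ R₂ := Finset.disjoint_left.2 fun x hx hx' =>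
        (Finset.mem_sdiff.1 (hR₂U hx')).2 hx
      refine ⟨R₁ ∪ R₂, ?_, Finset.mem_union_right _ hrR₂, ?_, ?_⟩
      · exact Finset.union_subset (hR₁U.trans (Finset.erase_subset _ _))
          (hR₂U.trans Finset.sdiff_subset)
      · intro x hx z hz hxz
        rw [Finset.mem_union] at hx ⊢
        by_cases hzR : z ∈ R₁
        · exact Or.inl hzR
        right
        rcases hx with hx | hx
        · by_cases hzr : z = r
          · exact hzr ▸ hrR₂
          · exact absurd (hR₁ x hx z (Finset.mem_erase.2 ⟨hzr, hz⟩) hxz) hzR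
        · exact hR₂ x hx z (Finset.mem_sdiff.2 ⟨hz, hzR⟩) hxz
      · rw [Finset.filter_union, Finset.filter_union,
          Finset.card_union_of_disjoint (Finset.disjoint_filter_filter hdis),
          Finset.card_union_of_disjoint (Finset.disjoint_filter_filter hdis)]
        have : c r' = true ↔ ¬ c r = true := by
          revert hcr
          cases c r <;> cases c r' <;> simp
        simp only [this] at hcard₁
        split_ifs at * <;> omega

/-- If `true` is the majority colour of `W`, some nonempty `U ⊆ W`, closed under adjacency in `W`,
is such that from each vertex of `U` a path in `U` leads to a `true` vertex all of whose
neighbours in `W` lie on the path. -/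
theorem exists_closed_set_forall_path (W : Finset V)
    (hW : (W.filter (c · = false)).card < (W.filter (c · = true)).card) :
    ∃ U ⊆ W, U.Nonempty ∧ (∀ x ∈ U, ∀ z ∈ W, G.Adj x z → z ∈ U) ∧
      ∀ r ∈ U, ∃ a l, IsPathList G r a l ∧ (∀ y ∈ l, y ∈ U) ∧ c a = true ∧
        ∀ z ∈ W, G.Adj a z → z ∈ l := by
  classical
  obtain ⟨U, hU, hmin⟩ := (W.powerset.filter fun U => (∀ x ∈ U, ∀ z ∈ W, G.Adj x z → z ∈ U) ∧
    (U.filter (c · = false)).card < (U.filter (c · = true)).card).exists_min_image Finset.card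
    ⟨W, by simpa only [Finset.mem_filter, Finset.mem_powerset] using
      ⟨subset_rfl, fun _ _ z hz _ => hz, hW⟩⟩
  simp only [Finset.mem_filter, Finset.mem_powerset, and_imp] at hU hmin
  obtain ⟨hUW, hUcl, hUc⟩ := hU
  refine ⟨U, hUW, ?_, hUcl, fun r hr => ?_⟩
  · rw [Finset.nonempty_iff_ne_empty]
    rintro rfl
    simp at hUc
  rcases exists_path_or_closed_set hc U hr with
    ⟨a, l, hl, hlU, hca, hal, -⟩ | ⟨R, hRU, hrR, hR, hRc⟩
  · exact ⟨a, l, hl, hlU, hca, fun z hz haz => hal z (hUcl a (hlU a hl.last_mem) z hz haz) haz⟩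
  exfalso
  have key := hmin (U \ R) (Finset.sdiff_subset.trans hUW) (by
    intro x hx z hz hxz
    rw [Finset.mem_sdiff] at hx ⊢
    exact ⟨hUcl x hx.1 z hz hxz, fun hzR => hx.2 (hR z hzR x hx.1 hxz.symm)⟩) (by
    have h1 : ∀ b, ((U \ R).filter (c · = b)).card + (R.filter (c · = b)).card =
        (U.filter (c · = b)).card := fun b => by
      rw [← Finset.card_union_of_disjoint (Finset.disjoint_filter_filter Finset.sdiff_disjoint),
        ← Finset.filter_union, Finset.sdiff_union_of_subset hRU]
    have h2 := h1 true
    have h3 := h1 false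
    omega)
  exact absurd (Finset.card_lt_card ⟨Finset.sdiff_subset, fun h =>
    (Finset.mem_sdiff.1 (h hr)).2 hrR⟩) (by omega)

end Search

section OffCycle

variable {V : Type*} {G : SimpleGraph V} {c : V → Bool} (hc : ∀ u v, G.Adj u v → c u ≠ c v)
include hc

/-- Suppose all paths that contain all neighbours of their `true` first vertex have at most
`C.length + 1` vertices, for some cycle `C`. If a `true` vertex `z` off `C` has all its neighbours
on `C`, and some `false` vertex lies off `C`, then `C` is long. -/
theorem IsCycleList.exists_ncard_neighborSet_le [Fintype V] {C : List V} (hC : IsCycleList G C)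
    (hconn : ∀ u w, ∃ l, IsPathList G u w l) {z y₀ : V} (hzC : z ∉ C) (hcz : c z = true)
    (hz : ∀ y, G.Adj z y → y ∈ C) (hz' : ∃ y, G.Adj z y) (hy₀ : y₀ ∉ C) (hcy₀ : c y₀ = false)
    (hmax : ∀ a w l, IsPathList G a w l → c a = true → (∀ y, G.Adj a y → y ∈ l) →
      l.length ≤ C.length + 1) :
    ∃ t, 2 * ((G.neighborSet z).ncard + (G.neighborSet t).ncard) ≤ C.length + 2 := by
  classical
  obtain ⟨T, ⟨t₁, t, hT, hTC, hzT, ⟨s₀, hs₀C, hs₀⟩, ⟨y₁, hy₁T, hcy₁⟩⟩, hTmax⟩ :=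
    exists_longest_nodup (fun T => ∃ t₁ t, IsPathList G t₁ t T ∧ (∀ y ∈ T, y ∉ C) ∧ z ∉ T ∧
      (∃ s ∈ C, G.Adj s t₁) ∧ ∃ y ∈ T, c y = false)
      (fun l ⟨_, _, h, _⟩ => h.nodup) (by
        obtain ⟨l, hl⟩ := hconn z y₀
        obtain ⟨s, y, l', hl', hs, rfl, -, hS, -⟩ := hl.exists_trim
          (S := fun x => x ∈ C ∨ x = z) (T := fun x => x = y₀) (Or.inr rfl) rfl
        have hyz : y ≠ z := by rintro rfl; rw [hcz] at hcy₀; cases hcy₀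
        obtain ⟨l'', rfl⟩ := hl'.eq_cons
        cases l'' with
        | nil =>
          have : s = y := by simpa using hl'.last
          subst this
          exact absurd hs (by tauto)
        | cons b l'' =>
          obtain ⟨-, hsb, hb⟩ := hl'.of_cons_cons
          have hsn := hl'.nodup
          rw [List.nodup_cons] at hsn
          have hoff : ∀ x ∈ b :: l'', ¬ (x ∈ C ∨ x = z) := fun x hx h =>
            hsn.1 (hS x (List.mem_cons_of_mem _ hx) h ▸ hx)
          have hsC : s ∈ C := by
            rcases hs with hs | rfl
            · exact hs
            · exact absurd (Or.inl (hz b hsb)) (hoff b (by simp))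
          exact ⟨_, b, y, hb, fun x hx h => hoff x hx (Or.inl h), fun h => hoff z h (Or.inr rfl),
            ⟨s, hsC, hsb⟩, y, hb.last_mem, hcy₀⟩)
  have htN : ∀ w, G.Adj t w → w ∈ T ∨ w ∈ C := by
    intro w htw
    by_contra! hw
    have hwz : w ≠ z := by
      rintro rfl
      exact hTC t hT.last_mem (hz t htw.symm)
    have := hTmax (T ++ [w]) ⟨t₁, w, hT.concat htw hw.1, by
      simp only [List.mem_append, List.mem_singleton]
      rintro y (hy | rfl)
      · exact hTC y hy
      · exact hw.2, by simpa using ⟨hzT, hwz.symm⟩, ⟨s₀, hs₀C, hs₀⟩, y₁, by simp [hy₁T], hcy₁⟩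
    simp at this
  obtain ⟨y, hzy⟩ := hz'
  obtain ⟨w, L, hL, hwy, hLC, hLlen⟩ := hC.exists_path (hz y hzy)
  obtain ⟨p, n, hn, hp, rfl, rfl, hmem⟩ := hL.exists_indexed
  have hCp : ∀ x, x ∈ C ↔ ∃ i ≤ n, p i = x := fun x => (hLC x).symm.trans (hmem x)
  have hcp0 : c (p 0) = false := by
    have := hc _ _ hzy
    rw [hcz] at this
    simpa using this.symm
  have hn2 : n % 2 = 1 := by
    have := mt (hp.color hc le_rfl).2 (hc _ _ hwy)
    omega
  have hI : ∀ i, i ∈ neighborIndices G p n z ↔ i ≤ n ∧ G.Adj z (p i) := fun i =>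
    mem_neighborIndices
  have hI2 : ∀ i ∈ neighborIndices G p n z, i % 2 = 0 := fun i hi => by
    rw [hI] at hi
    have := hc _ _ hi.2
    rw [hcz] at this
    rw [← hp.color hc hi.1, hcp0]
    simpa using this.symm
  have hdz := ncard_neighborSet_le_card (G := G) (x := z) (fun y hy => (hCp y).1 (hz y hy))
  have hdt := two_mul_ncard_neighborSet_le (p := p) (n := n) hc hT
    (fun y hy => (htN y hy).imp_right (hCp y).1)
  have hJ : ∀ i, i ∈ neighborIndices G p n t ↔ i ≤ n ∧ G.Adj t (p i) := fun i =>
    mem_neighborIndices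
  generalize neighborIndices G p n z = I at *
  generalize neighborIndices G p n t = J at *
  have hTpos := hT.length_pos
  have hpC : ∀ i ≤ n, p i ∈ C := fun i hi => (hCp _).2 ⟨i, hi, rfl⟩
  have hgap : ∀ j ≤ n, (∃ e e' T', IsPathList G e e' T' ∧ (∀ y, y ∈ T' ↔ y ∈ T) ∧
      T'.length = T.length ∧ G.Adj (p j) e) →
      ∃ s, j + 1 + T.length ≤ s ∧ s ≤ n + 1 ∧ ∀ i ∈ I, i ≤ j ∨ s ≤ i := by
    rintro j hj ⟨e, e', T', hT', hTT', hlen, hje⟩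
    have hPj := hp.isPathList (Nat.zero_le j) hj
    by_cases hne : (I.filter (j < ·)).Nonempty
    · obtain ⟨s, hs, hsmin⟩ := (I.filter (j < ·)).exists_min_image id hne
      simp only [Finset.mem_filter, id, and_imp] at hs hsmin
      have hsn := (hI s).1 hs.1
      have hP1 := ((hp.isPathList hsn.1 le_rfl).append hPj hwy (by
        simp only [mem_pathSegment]
        rintro y ⟨a, ha, ha', rfl⟩ ⟨b, -, hb, he⟩
        have := hp.inj _ (by omega) _ (by omega) he
        omega)).append hT' hje (by
        intro y hy hy'
        refine hTC y ((hTT' y).1 hy') ?_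
        simp only [List.mem_append, mem_pathSegment] at hy
        rcases hy with ⟨a, -, ha, rfl⟩ | ⟨a, -, ha, rfl⟩ <;> exact hpC a (by omega))
      have hcov : ∀ i ∈ I, i ≤ j ∨ s ≤ i := fun i hi => by
        by_cases hij : i ≤ j
        · exact Or.inl hij
        · exact Or.inr (hsmin i hi (by omega))
      have := hmax _ _ _ (hP1.cons hsn.2 (by
        simp only [List.mem_append, mem_pathSegment, hTT']
        rintro ((⟨a, -, ha, rfl⟩ | ⟨a, -, ha, rfl⟩) | h)
        · exact hzC (hpC a ha)
        · exact hzC (hpC a (by omega))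
        · exact hzT h)) hcz (by
        intro y hy
        obtain ⟨i, hi, rfl⟩ := (hCp y).1 (hz y hy)
        simp only [List.mem_cons, List.mem_append, mem_pathSegment]
        rcases hcov i ((hI i).2 ⟨hi, hy⟩) with h | h
        · exact Or.inr (Or.inl (Or.inr ⟨i, by omega, h, rfl⟩))
        · exact Or.inr (Or.inl (Or.inl ⟨i, h, hi, rfl⟩)))
      simp only [List.length_cons, List.length_append, length_pathSegment, hlen] at this
      exact ⟨s, by omega, by omega, hcov⟩
    · have hcov : ∀ i ∈ I, i ≤ j := fun i hi => by
        by_contra hij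
        exact hne ⟨i, Finset.mem_filter.2 ⟨hi, by omega⟩⟩
      have hP1 := hPj.append hT' hje (by
        intro y hy hy'
        refine hTC y ((hTT' y).1 hy') ?_
        simp only [mem_pathSegment] at hy
        obtain ⟨a, -, ha, rfl⟩ := hy
        exact hpC a (by omega))
      have := hmax _ _ _ (hP1.cons hzy (by
        simp only [List.mem_append, mem_pathSegment, hTT']
        rintro (⟨a, -, ha, rfl⟩ | h)
        · exact hzC (hpC a (by omega))
        · exact hzT h)) hcz (by
        intro y hy
        obtain ⟨i, hi, rfl⟩ := (hCp y).1 (hz y hy)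
        simp only [List.mem_cons, List.mem_append, mem_pathSegment]
        exact Or.inr (Or.inl ⟨i, by omega, hcov i ((hI i).2 ⟨hi, hy⟩), rfl⟩))
      simp only [List.length_cons, List.length_append, length_pathSegment, hlen] at this
      exact ⟨n + 1, by omega, by omega, fun i hi => Or.inl (hcov i hi)⟩
  have hgapJ : ∀ j ∈ J, ∃ s, j + 1 + T.length ≤ s ∧ s ≤ n + 1 ∧ ∀ i ∈ I, i ≤ j ∨ s ≤ i :=
    fun j hj => hgap j ((hJ j).1 hj).1
      ⟨t, t₁, _, hT.reverse, by simp, by simp, ((hJ j).1 hj).2.symm⟩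
  refine ⟨t, ?_⟩
  rcases J.eq_empty_or_nonempty with rfl | hJne
  · obtain ⟨b, hb, rfl⟩ := (hCp s₀).1 hs₀C
    obtain ⟨s, hs, hsn, hcov⟩ := hgap b hb ⟨t₁, t, T, hT, by simp, rfl, hs₀⟩
    have hF := card_even_le (F := I) (a := b) (b := s) (m := n) hsn fun i hi => by
      have h1 := hI2 i hi
      have h2 := ((hI i).1 hi).1
      have h3 := hcov i hi
      omega
    simp only [Finset.card_empty] at hdt
    omega
  obtain ⟨j, hj, hjmax⟩ := J.exists_max_image id hJne
  simp only [id] at hjmax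
  obtain ⟨s, hs, hsn, hcov⟩ := hgapJ j hj
  by_cases hct : c t = true
  · have hJ2 : ∀ i ∈ J, i % 2 = 0 := fun i hi => by
      rw [hJ] at hi
      have := hc _ _ hi.2
      rw [hct] at this
      rw [← hp.color hc hi.1, hcp0]
      simpa using this.symm
    have hT2 : 2 ≤ T.length := by
      by_contra! hlt
      obtain ⟨x, rfl⟩ := List.length_eq_one_iff.1 (by omega : T.length = 1)
      have h1 := hT.last_mem
      rw [List.mem_singleton] at h1 hy₁T
      rw [h1, ← hy₁T, hcy₁] at hct
      cases hct
    have hdis : Disjoint I J := by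
      rw [Finset.disjoint_left]
      intro i hi hi'
      rw [hI] at hi
      rw [hJ] at hi'
      obtain ⟨w, K, hK, hwi, hKC, hKlen⟩ := hC.exists_path (hpC i hi.1)
      have hzK := hK.cons hi.2 (by rwa [hKC])
      have hcw : c w = true := by
        have h1 := hc _ _ hwi
        have h2 := hc _ _ hi.2
        rw [hcz] at h2
        revert h1 h2
        cases c w <;> cases c (p i) <;> simp
      have hwC : ∀ x, G.Adj w x → x ∈ C := by
        intro x hx
        by_contra hxC
        have hxz : x ≠ z := by
          rintro rfl
          exact hc _ _ hx (hcw.trans hcz.symm)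
        have := hmax _ _ _ (hzK.concat hx (by
          rw [List.mem_cons, hKC]; tauto)) hcz (by
          intro y hy
          simp [hKC, hz y hy])
        simp at this
        omega
      have := hmax _ _ _ (hK.reverse.append hT.reverse hi'.2.symm (by
        intro y hy hy'
        exact hTC y (List.mem_reverse.1 hy') ((hKC y).1 (List.mem_reverse.1 hy)))) hcw (by
        intro y hy
        simp [hKC, hwC y hy])
      simp at this
      omega
    have hF := card_even_le (F := I ∪ J) (a := j) (b := s) (m := n) hsn fun i hi => by
      rcases Finset.mem_union.1 hi with hi | hi
      · have h1 := hI2 i hi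
        have h2 := ((hI i).1 hi).1
        have h3 := hcov i hi
        omega
      · exact ⟨hJ2 i hi, Or.inl (hjmax i hi)⟩
    rw [Finset.card_union_of_disjoint hdis] at hF
    omega
  · have hJ2 : ∀ i ∈ J, i % 2 = 1 := fun i hi => by
      rw [hJ] at hi
      have h1 := hc _ _ hi.2
      have h2 := hp.color hc hi.1
      rw [hcp0] at h2
      have : c (p i) ≠ false := by
        revert h1 hct
        cases c t <;> cases c (p i) <;> simp
      have := mt h2.2 this
      omega
    have hF := card_even_le (F := I ∪ J.image (· + 1)) (a := j + 1) (b := s) (m := n) hsn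
      fun i hi => by
        rcases Finset.mem_union.1 hi with hi | hi
        · have h1 := hI2 i hi
          have h2 := ((hI i).1 hi).1
          have h3 := hcov i hi
          omega
        · obtain ⟨i, hi', rfl⟩ := Finset.mem_image.1 hi
          have h1 := hJ2 i hi'
          have h2 := hjmax i hi'
          omega
    rw [Finset.card_union_of_disjoint, Finset.card_image_of_injective _ (add_left_injective 1)]
      at hF
    · have := hJ2 j hj
      omega
    · rw [Finset.disjoint_left]
      intro i hi hi'
      obtain ⟨q, hq, rfl⟩ := Finset.mem_image.1 hi'
      obtain ⟨s', h1, h2, h3⟩ := hgapJ q hq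
      have := h3 _ hi
      omega

end OffCycle

section OffPath

variable {V : Type*} {G : SimpleGraph V} {c : V → Bool} (hc : ∀ u v, G.Adj u v → c u ≠ c v)
include hc

/-- Let `p` be a longest path of `G` and `T` a path off `p`, attached to `p` at `p b`, where all
vertices of `p` adjacent to the component `U` containing `T` come no later than `p b`. -/
theorem IsIndexedPath.exists_cycle_of_attached [Finite V] {p : ℕ → V} {n b : ℕ} {t₁ t : V}
    {T : List V} {U : Finset V} (hp : IsIndexedPath G p n)
    (hcut : ∀ z u w, u ≠ z → w ≠ z → ∃ l, IsPathList G u w l ∧ z ∉ l)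
    (hmax : ∀ u v l, IsPathList G u v l → l.length ≤ n + 1)
    (hU : ∀ i ≤ n, p i ∉ U) (hUb : ∀ x ∈ U, ∀ i ≤ n, G.Adj x (p i) → i ≤ b) (hb : b ≤ n)
    (hT : IsPathList G t₁ t T) (hTU : ∀ y ∈ T, y ∈ U) (hbt : G.Adj (p b) t₁)
    (ht : ∀ y, G.Adj t y → y ∈ T ∨ ∃ i ≤ n, p i = y) (hct : c t ≠ c (p 0)) :
    ∃ C, IsCycleList G C ∧
      2 * ((G.neighborSet (p 0)).ncard + (G.neighborSet t).ncard) ≤ C.length + 2 := by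
  classical
  have hTp : ∀ i ≤ n, p i ∉ T := fun i hi h => hU i hi (hTU _ h)
  have hTpos := hT.length_pos
  have h0 : ∀ y, G.Adj (p 0) y → ∃ i ≤ n, p i = y := by
    intro y hy
    by_contra! h
    have := hmax _ _ _ ((hp.isPathList (Nat.zero_le n) le_rfl).cons hy.symm (by
      simp only [mem_pathSegment]
      rintro ⟨i, -, hi, rfl⟩
      exact h i hi rfl))
    simp at this
  have hbn : b < n := by
    refine lt_of_le_of_ne hb ?_
    rintro rfl
    have := hmax _ _ _ ((hp.isPathList (Nat.zero_le b) le_rfl).append hT hbt (by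
      simp only [mem_pathSegment]
      rintro y ⟨i, -, hi, rfl⟩
      exact hTp i hi))
    rw [List.length_append, length_pathSegment] at this
    omega
  by_cases hIb : ∀ i ≤ n, G.Adj (p 0) (p i) → i ≤ b
  · obtain ⟨C, hC, hlen | ⟨hCmem, hlen⟩⟩ := IsPathList.exists_cycle_of_color_ne hc
      ((hp.isPathList (Nat.zero_le b) hb).append hT hbt (by
        simp only [mem_pathSegment]
        rintro y ⟨i, -, hi, rfl⟩
        exact hTp i (by omega))) hcut (by
        intro y hy
        obtain ⟨i, hi, rfl⟩ := h0 y hy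
        simp only [List.mem_append, mem_pathSegment]
        exact Or.inl ⟨i, by omega, hIb i hi hy, rfl⟩) (by
        intro y hy
        simp only [List.mem_append, mem_pathSegment]
        rcases ht y hy with h | ⟨i, hi, rfl⟩
        · exact Or.inr h
        · exact Or.inl ⟨i, by omega, hUb t (hTU _ hT.last_mem) i hi hy, rfl⟩) hct.symm
    · exact ⟨C, hC, hlen⟩
    exfalso
    obtain ⟨w, K, hK, -, hKC, hKlen⟩ := hC.exists_path (v := p b) ((hCmem _).2 (by
      simp only [List.mem_append, mem_pathSegment]
      exact Or.inl ⟨b, by omega, le_rfl, rfl⟩))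
    have := hmax _ _ _ ((hp.isPathList (a := b + 1) (by omega) le_rfl).reverse.append hK
      (hp.adj b hbn).symm (by
      simp only [List.mem_reverse, mem_pathSegment, hKC, hCmem, List.mem_append]
      rintro y ⟨i, hi, hi', rfl⟩ (⟨j, -, hj, he⟩ | h)
      · have := hp.inj _ (by omega) _ (by omega) he
        omega
      · exact hTp i hi' h))
    simp only [List.length_append, List.length_reverse, length_pathSegment] at this hlen
    omega
  push Not at hIb
  have hn2 : ∀ i ∈ neighborIndices G p n (p 0), i % 2 = 1 := fun i hi => by
    have := hp.neighborIndices_parity hc (Nat.zero_le n) hi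
    omega
  have hI : ∀ i, i ∈ neighborIndices G p n (p 0) ↔ i ≤ n ∧ G.Adj (p 0) (p i) := fun i =>
    mem_neighborIndices
  have hJ : ∀ i, i ∈ neighborIndices G p n t ↔ i ≤ n ∧ G.Adj t (p i) := fun i =>
    mem_neighborIndices
  have hd0 := ncard_neighborSet_le_card h0
  have hdt := two_mul_ncard_neighborSet_le hc hT ht
  generalize neighborIndices G p n (p 0) = I at *
  generalize neighborIndices G p n t = J at *
  have hJ2 : ∀ j ∈ J, j % 2 = 0 := fun j hj => by
    rw [hJ] at hj
    have := hc _ _ hj.2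
    rw [← hp.color hc hj.1]
    revert this hct
    cases c t <;> cases c (p 0) <;> cases c (p j) <;> simp
  obtain ⟨i, hi, himax⟩ := I.exists_max_image id (by
    obtain ⟨i, hi, hi', -⟩ := hIb
    exact ⟨i, (hI i).2 ⟨hi, hi'⟩⟩)
  simp only [id] at himax
  have hbi : b < i := by
    obtain ⟨i', h1, h2, h3⟩ := hIb
    have := himax i' ((hI i').2 ⟨h1, h2⟩)
    omega
  have hiI := (hI i).1 hi
  have hrot : ∀ j ≤ n, (∃ e e' T', IsPathList G e e' T' ∧ (∀ y, y ∈ T' ↔ y ∈ T) ∧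
      T'.length = T.length ∧ G.Adj (p j) e') → ∀ s ∈ I, j < s → j + 1 + T.length ≤ s := by
    rintro j hj ⟨e, e', T', hT', hTT', hlen, hje⟩ s hs hjs
    rw [hI] at hs
    have := hmax _ _ _ ((hT'.append (hp.isPathList (Nat.zero_le j) hj).reverse hje.symm (by
      simp only [List.mem_reverse, mem_pathSegment]
      rintro y hy ⟨a, -, ha, rfl⟩
      exact hTp a (by omega) ((hTT' _).1 hy))).append (hp.isPathList hs.1 le_rfl) hs.2 (by
      simp only [List.mem_append, List.mem_reverse, mem_pathSegment]
      rintro y (hy | ⟨a, -, ha, rfl⟩) ⟨a', ha', han', he⟩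
      · rw [← he] at hy
        exact hTp a' han' ((hTT' _).1 hy)
      · have := hp.inj _ (by omega) _ (by omega) he
        omega))
    simp only [List.length_append, List.length_reverse, length_pathSegment, hlen] at this
    omega
  have hrotJ : ∀ j ∈ J, ∀ s ∈ I, j < s → j + 1 + T.length ≤ s := fun j hj =>
    hrot j ((hJ j).1 hj).1 ⟨t₁, t, T, hT, by simp, rfl, ((hJ j).1 hj).2.symm⟩
  obtain ⟨j, hjb, hjJ, hj⟩ : ∃ j ≤ b, (∀ a ∈ J, a ≤ j) ∧ ∀ s ∈ I, j < s → j + 1 + T.length ≤ s := by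
    rcases J.eq_empty_or_nonempty with rfl | hJne
    · exact ⟨b, le_rfl, by simp, hrot b hb ⟨t, t₁, _, hT.reverse, by simp, by simp, hbt⟩⟩
    · obtain ⟨j, hj, hjmax⟩ := J.exists_max_image id hJne
      exact ⟨j, hUb t (hTU t hT.last_mem) j ((hJ j).1 hj).1 ((hJ j).1 hj).2, hjmax, hrotJ j hj⟩
  obtain ⟨s, hs, hsmin⟩ := (I.filter (j < ·)).exists_min_image id
    ⟨i, Finset.mem_filter.2 ⟨hi, by omega⟩⟩
  simp only [Finset.mem_filter, id, and_imp] at hs hsmin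
  have hjs := hj s hs.1 hs.2
  have hsi := himax s hs.1
  refine ⟨_, ⟨_, _, hp.isPathList (Nat.zero_le i) hiI.1, hiI.2.symm⟩, ?_⟩
  have hF := card_even_le (F := I.image (· - 1) ∪ J) (a := j) (b := s - 1) (m := i) (by omega)
    fun a ha => by
      rcases Finset.mem_union.1 ha with ha | ha
      · obtain ⟨q, hq, rfl⟩ := Finset.mem_image.1 ha
        have h1 := hn2 q hq
        have h2 := himax q hq
        have h3 := hsmin q hq
        omega
      · have := hJ2 a ha
        have := hjJ a ha
        omega
  rw [Finset.card_union_of_disjoint, Finset.card_image_of_injOn] at hF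
  · have := hn2 s hs.1
    have := hn2 i hi
    rw [length_pathSegment]
    omega
  · intro x hx y hy hxy
    have := hn2 x hx
    have := hn2 y hy
    simp only at hxy
    omega
  · rw [Finset.disjoint_left]
    intro a ha ha'
    obtain ⟨q, hq, rfl⟩ := Finset.mem_image.1 ha
    have := hn2 q hq
    have := hrotJ _ ha' q hq (by omega)
    omega

end OffPath

section LongCycles

variable {V : Type*} {G : SimpleGraph V} {u v : V} {l : List V}

theorem IsPathList.exists_adj_mem_notMem (h : IsPathList G u v l) {S : V → Prop} (hu : S u)
    (hv : ¬ S v) : ∃ s a, S s ∧ ¬ S a ∧ G.Adj s a := by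
  obtain ⟨p, n, -, hp, rfl, rfl, -⟩ := h.exists_indexed
  by_contra! hno
  have : ∀ i ≤ n, S (p i) := by
    intro i
    induction i with
    | zero => exact fun _ => hu
    | succ i ih =>
      intro hi
      by_contra hS
      exact hno _ _ (ih (by omega)) hS (hp.adj i (by omega))
  exact hv (this n le_rfl)

theorem IsPathList.length_eq {u' v' : V} {l' : List V} (h : IsPathList G u v l)
    (h' : IsPathList G u' v' l') (hmem : ∀ x, x ∈ l' ↔ x ∈ l) : l'.length = l.length :=
  ((List.perm_ext_iff_of_nodup h'.nodup h.nodup).2 hmem).length_eq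

variable {c : V → Bool} (hc : ∀ u v, G.Adj u v → c u ≠ c v)
include hc

theorem IsPathList.exists_cycle_of_longest_of_color_eq [Fintype V] (h : IsPathList G u v l)
    (hmax : ∀ u v l', IsPathList G u v l' → l'.length ≤ l.length)
    (hconn : ∀ u w, ∃ l, IsPathList G u w l)
    (hcut : ∀ z u w, u ≠ z → w ≠ z → ∃ l, IsPathList G u w l ∧ z ∉ l)
    (hcard : (Finset.univ.filter (c · = true)).card = (Finset.univ.filter (c · = false)).card)
    (huv : c u = c v) :
    ∃ C t, IsCycleList G C ∧
      2 * ((G.neighborSet u).ncard + (G.neighborSet t).ncard) ≤ C.length + 2 := by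
  classical
  wlog hcu : c u = true generalizing c
  · exact this (c := fun x => !(c x)) (by simpa using hc) (by simpa using hcard.symm)
      (by simpa using huv) (by simpa using hcu)
  have hW : ((Finset.univ \ l.toFinset).filter (c · = true)).card <
      ((Finset.univ \ l.toFinset).filter (c · = false)).card := by
    have h1 : ∀ b, ((Finset.univ \ l.toFinset).filter (c · = b)).card +
        (l.toFinset.filter (c · = b)).card = (Finset.univ.filter (c · = b)).card := fun b => by
      rw [← Finset.card_union_of_disjoint (Finset.disjoint_filter_filter Finset.sdiff_disjoint),
        ← Finset.filter_union, Finset.sdiff_union_of_subset (Finset.subset_univ _)]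
    have h2 := h1 true
    have h3 := h1 false
    have h4 := h.two_mul_card_le hc (l.toFinset.filter (c · = false)) (fun x hx => by
      rw [Finset.mem_filter, List.mem_toFinset] at hx
      exact ⟨hx.1, by rw [hx.2, hcu]; simp⟩)
    have h5 := Finset.card_filter_add_card_filter_not (s := l.toFinset) (c · = true)
    simp only [Bool.not_eq_true] at h5
    rw [List.toFinset_card_of_nodup h.nodup] at h5
    obtain ⟨p, n, hn, hp, rfl, rfl, -⟩ := h.exists_indexed
    have := (hp.color hc le_rfl).1 huv.symm
    omega
  obtain ⟨U, hUW, ⟨r, hr⟩, hUcl, hUpath⟩ := exists_closed_set_forall_path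
    (c := fun x => !(c x)) (G := G) (by simpa using hc) (Finset.univ \ l.toFinset)
    (by simpa using hW)
  have hUl : ∀ x ∈ U, x ∉ l := fun x hx => by simpa using hUW hx
  have hUcl' : ∀ x ∈ U, ∀ z, G.Adj x z → z ∈ U ∨ z ∈ l := fun x hx z hz => by
    by_cases hzl : z ∈ l
    · exact Or.inr hzl
    · exact Or.inl (hUcl x hx z (by simpa using hzl) hz)
  obtain ⟨p, n, hn, hp, rfl, rfl, hmem⟩ := h.exists_indexed
  obtain ⟨L, hL⟩ := hconn r (p 0)
  obtain ⟨s, a, hs, ha, hsa⟩ := hL.exists_adj_mem_notMem (S := (· ∈ U)) hr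
    (fun h0 => hUl _ h0 h.head_mem)
  obtain ⟨i, hi, rfl⟩ := (hmem a).1 ((hUcl' s hs a hsa).resolve_left ha)
  obtain ⟨b, hb, hbmax⟩ := ((Finset.range (n + 1)).filter fun i =>
    ∃ x ∈ U, G.Adj x (p i)).exists_max_image id
    ⟨i, by simp only [Finset.mem_filter, Finset.mem_range]; exact ⟨by omega, s, hs, hsa⟩⟩
  simp only [Finset.mem_filter, Finset.mem_range, id, and_imp, forall_exists_index] at hb hbmax
  obtain ⟨hb, t₁, ht₁, hbt⟩ := hb
  obtain ⟨t, T, hT, hTU, hct, ht⟩ := hUpath t₁ ht₁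
  obtain ⟨C, hC, hlen⟩ := hp.exists_cycle_of_attached hc (b := b) (U := U) hcut
    (fun u v l' hl' => hn ▸ hmax u v l' hl') (fun i hi hiU => hUl _ hiU ((hmem _).2 ⟨i, hi, rfl⟩))
    (fun x hx i hi hxi => hbmax i (by omega) x hx hxi) (by omega) hT hTU hbt.symm (by
      intro y hy
      rw [← hmem]
      rcases hUcl' t (hTU t hT.last_mem) y hy with h | h
      · exact Or.inl (ht y (hUW h) hy)
      · exact Or.inr h) (by
      rw [hcu]
      simpa using hct)
  exact ⟨C, t, hC, hlen⟩

theorem exists_cycle_of_card_eq [Fintype V] [Nonempty V] (hconn : ∀ u w, ∃ l, IsPathList G u w l)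
    (hcut : ∀ z u w, u ≠ z → w ≠ z → ∃ l, IsPathList G u w l ∧ z ∉ l)
    (hcard : (Finset.univ.filter (c · = true)).card = (Finset.univ.filter (c · = false)).card)
    {k : ℕ} (hdeg : ∀ v, k ≤ (G.neighborSet v).ncard) :
    ∃ C, IsCycleList G C ∧
      2 * min (Finset.univ.filter (c · = false)).card (2 * k - 1) ≤ C.length := by
  classical
  obtain ⟨l, ⟨u, v, hl⟩, hmax⟩ := exists_longest_nodup (fun l => ∃ u v, IsPathList G u v l)
    (fun l ⟨_, _, h⟩ => h.nodup) (by
      obtain ⟨x⟩ := ‹Nonempty V›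
      exact ⟨_, x, x, .singleton x⟩)
  have hmax' : ∀ u v l', IsPathList G u v l' → l'.length ≤ l.length :=
    fun u v l' h => hmax l' ⟨u, v, h⟩
  by_cases huv : c u = c v
  · obtain ⟨C, t, hC, hlen⟩ := hl.exists_cycle_of_longest_of_color_eq hc hmax' hconn hcut hcard huv
    have := hdeg u
    have := hdeg t
    exact ⟨C, hC, by omega⟩
  have hcl : ∀ {u v l'}, IsPathList G u v l' → l'.length = l.length → ∀ z, G.Adj u z → z ∈ l' := by
    intro u v l' hl' hlen z hz
    by_contra hzl
    have := hmax' _ _ _ (hl'.cons hz.symm hzl)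
    simp [hlen] at this
  obtain ⟨C, hC, hlen | ⟨hCl, hlen⟩⟩ := hl.exists_cycle_of_color_ne hc hcut (hcl hl rfl)
    (by simpa using hcl hl.reverse (by simp)) huv
  · have := hdeg u
    have := hdeg v
    exact ⟨C, hC, by omega⟩
  refine ⟨C, hC, ?_⟩
  have := hC.two_mul_card_le hc (Finset.univ.filter (c · = false)) false (fun x hx => by
    refine ⟨?_, by simpa using hx⟩
    by_contra hxC
    obtain ⟨L, hL⟩ := hconn u x
    obtain ⟨s, a, hs, ha, hsa⟩ := hL.exists_adj_mem_notMem (S := (· ∈ C))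
      ((hCl u).2 hl.head_mem) hxC
    obtain ⟨w, K, hK, -, hKC, hKlen⟩ := hC.exists_path hs
    exact ha ((hKC a).1 (hcl hK (hKlen.trans hlen) a hsa)))
  omega

theorem exists_cycle_of_card_le [Fintype V] (hconn : ∀ u w, ∃ l, IsPathList G u w l)
    (hcut : ∀ z u w, u ≠ z → w ≠ z → ∃ l, IsPathList G u w l ∧ z ∉ l)
    (hcard : (Finset.univ.filter (c · = false)).card ≤ (Finset.univ.filter (c · = true)).card)
    (hfalse : ∃ r, c r = false) {k m : ℕ} (hk : 1 ≤ k)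
    (hdegk : ∀ v, c v = true → k ≤ (G.neighborSet v).ncard)
    (hdegm : ∀ v, c v = false → m ≤ (G.neighborSet v).ncard) :
    ∃ C, IsCycleList G C ∧ 2 * min (Finset.univ.filter (c · = false)).card
      (min (k + m - 1) (2 * k - 2)) ≤ C.length := by
  classical
  by_contra! hno
  have hnbr : ∀ v, c v = true → ∃ y, G.Adj v y := fun v hv => by
    have := hdegk v hv
    exact (Set.ncard_pos (Set.toFinite _)).1 (by omega : 0 < (G.neighborSet v).ncard)
  have hspan : ∀ C, IsCycleList G C → ∃ y ∉ C, c y = false := by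
    intro C hC
    by_contra! hall
    have h1 := hC.two_mul_card_le hc (Finset.univ.filter (c · = false)) false (fun x hx => by
      have hx' : c x = false := by simpa using hx
      exact ⟨by by_contra hxC; exact hall x hxC hx', hx'⟩)
    have := hno C hC
    omega
  obtain ⟨Q, ⟨u, s, hQ, hcu, hu⟩, hQmax⟩ := exists_longest_nodup
    (fun l => ∃ a w, IsPathList G a w l ∧ c a = true ∧ ∀ z, G.Adj a z → z ∈ l)
    (fun l ⟨_, _, h, _⟩ => h.nodup) (by
      obtain ⟨r, hr⟩ := hfalse
      rcases exists_path_or_closed_set hc Finset.univ (Finset.mem_univ r) with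
        ⟨a, l, hl, -, hca, ha, -⟩ | ⟨R, -, hrR, hR, hRc⟩
      · exact ⟨_, a, r, hl.reverse, hca, fun z hz => by simpa using ha z (Finset.mem_univ z) hz⟩
      · have hRu : R = Finset.univ := by
          by_contra hne
          obtain ⟨x, hx⟩ : ∃ x, x ∉ R := by simpa [Finset.eq_univ_iff_forall] using hne
          obtain ⟨L, hL⟩ := hconn r x
          obtain ⟨s, a, hs, ha, hsa⟩ := hL.exists_adj_mem_notMem (S := (· ∈ R)) hrR hx
          exact ha (hR s hs a (Finset.mem_univ a) hsa)
        rw [hRu, hr] at hRc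
        simp at hRc hcard
        omega)
  have hmax : ∀ a w l, IsPathList G a w l → c a = true → (∀ z, G.Adj a z → z ∈ l) →
      l.length ≤ Q.length := fun a w l h1 h2 h3 => hQmax l ⟨a, w, h1, h2, h3⟩
  have hs : ∀ z, G.Adj s z → z ∈ Q := by
    intro z hz
    by_contra hzQ
    have := hmax _ _ _ (hQ.concat hz hzQ) hcu (fun y hy => by simp [hu y hy])
    simp at this
  by_cases hcs : c u = c s
  · have hus : u ≠ s := by
      rintro rfl
      obtain ⟨y, hy⟩ := hnbr u hcu
      obtain ⟨p, n, -, hp, hp0, hpn, hmem⟩ := hQ.exists_indexed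
      have hn0 := hp.inj 0 (Nat.zero_le n) n le_rfl (hp0.trans hpn.symm)
      obtain ⟨i, hi, rfl⟩ := (hmem y).1 (hu y hy)
      obtain rfl : i = 0 := by omega
      exact hy.ne hp0.symm
    rcases hQ.exists_cycle_of_color_eq hc hcut hu hs hcs hus with
      ⟨C, hC, hlen⟩ | ⟨z, C, l', hC, hzC, hcz, hQC, hlen, hl', hl'Q⟩
    · have := hno C hC
      have := hdegk u hcu
      have := hdegk s (hcs ▸ hcu)
      omega
    have hz : ∀ y, G.Adj z y → y ∈ C := by
      intro y hy
      by_contra hyC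
      have hyl : y ∉ l' := by
        rw [hl'Q, hQC]
        rintro (h | rfl)
        · exact hyC h
        · exact hy.ne rfl
      have := hmax _ _ _ (hl'.reverse.concat hy (by simpa using hyl)) hcu
        (fun x hx => by simp [hl'Q, hu x hx])
      have := hQ.length_eq hl' hl'Q
      simp at *
      omega
    obtain ⟨y₀, hy₀, hcy₀⟩ := hspan C hC
    obtain ⟨t, ht⟩ := hC.exists_ncard_neighborSet_le hc hconn hzC (hcz.trans hcu) hz
      (hnbr z (hcz.trans hcu)) hy₀ hcy₀ (hlen ▸ hmax)
    have := hno C hC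
    have := hdegk z (hcz.trans hcu)
    cases hct : c t
    · have := hdegm t hct
      omega
    · have := hdegk t hct
      omega
  have hcs' : c s = false := by
    rw [hcu] at hcs
    simpa using Ne.symm hcs
  obtain ⟨C, hC, hlen | ⟨hCQ, hlen⟩⟩ := hQ.exists_cycle_of_color_ne hc hcut hu hs hcs
  · have := hno C hC
    have := hdegk u hcu
    have := hdegm s hcs'
    omega
  have hattach : ∀ v ∈ C, ∀ r a l, G.Adj v r → IsPathList G r a l → (∀ y ∈ l, y ∉ C) →
      c a = true → (∀ z, G.Adj a z → z ∈ C ∨ z ∈ l) → False := by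
    intro v hv r a l hvr hl hlC hca ha
    obtain ⟨w, K, hK, -, hKC, hKlen⟩ := hC.exists_path hv
    have := hmax _ _ _ (hl.reverse.append hK hvr.symm (by
      intro y hy hy'
      exact hlC y (by simpa using hy) ((hKC y).1 hy'))) hca (by
      intro z hz
      simpa [hKC, or_comm] using ha z hz)
    have := hl.length_pos
    simp at *
    omega
  have hW : ∀ x, x ∈ Finset.univ \ C.toFinset ↔ x ∉ C := by simp
  have hfalse_adj : ∀ v ∈ C, ∀ x ∉ C, G.Adj v x → c x = true := by
    intro v hv x hxC hvx
    by_contra hcx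
    rcases exists_path_or_closed_set hc (Finset.univ \ C.toFinset) ((hW x).2 hxC) with
      ⟨a, l, hl, hlW, hca, ha, -⟩ | ⟨R, hRW, hxR, hR, hRc⟩
    · exact hattach v hv x a l hvx hl (fun y hy => (hW y).1 (hlW y hy)) hca fun z hz => by
        by_cases hzC : z ∈ C
        · exact Or.inl hzC
        · exact Or.inr (ha z ((hW z).2 hzC) hz)
    rw [if_neg hcx] at hRc
    obtain ⟨U, hUW, ⟨r, hr⟩, hUcl, hUpath⟩ := exists_closed_set_forall_path hc
      ((Finset.univ \ C.toFinset) \ R) (by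
        have h1 : ∀ S T : Finset V, T ⊆ S → ∀ b, ((S \ T).filter (c · = b)).card +
            (T.filter (c · = b)).card = (S.filter (c · = b)).card := fun S T hTS b => by
          rw [← Finset.card_union_of_disjoint (Finset.disjoint_filter_filter Finset.sdiff_disjoint),
            ← Finset.filter_union, Finset.sdiff_union_of_subset hTS]
        have h2 := h1 _ _ hRW true
        have h3 := h1 _ _ hRW false
        have h4 := h1 _ _ (Finset.subset_univ C.toFinset) true
        have h5 := h1 _ _ (Finset.subset_univ C.toFinset) false
        have h6 := hC.two_mul_card_le hc (C.toFinset.filter (c · = true)) true (by simp)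
        have h7 := Finset.card_filter_add_card_filter_not (s := C.toFinset) (c · = true)
        simp only [Bool.not_eq_true] at h7
        have h8 : C.toFinset.card = C.length := by
          obtain ⟨a, b, hab, -⟩ := hC
          exact List.toFinset_card_of_nodup hab.nodup
        omega)
    have hU : ∀ y ∈ U, y ∉ C ∧ y ∉ R := fun y hy => by
      have := Finset.mem_sdiff.1 (hUW hy)
      exact ⟨(hW y).1 this.1, this.2⟩
    have hUR : ∀ y ∈ U, ∀ z ∉ C, G.Adj y z → z ∈ (Finset.univ \ C.toFinset) \ R :=
      fun y hy z hz hyz => Finset.mem_sdiff.2 ⟨(hW z).2 hz, fun hzR =>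
        (hU y hy).2 (hR z hzR y ((hW y).2 (hU y hy).1) hyz.symm)⟩
    obtain ⟨L, hL⟩ := hconn r v
    obtain ⟨s', b, hs', hb, hsb⟩ := hL.exists_adj_mem_notMem (S := (· ∈ U)) hr
      (fun h => (hU v h).1 hv)
    have hbC : b ∈ C := by
      by_contra hbC
      exact hb (hUcl s' hs' b (hUR s' hs' b hbC hsb) hsb)
    obtain ⟨a, l, hl, hlU, hca, ha⟩ := hUpath s' hs'
    refine hattach b hbC s' a l hsb.symm hl (fun y hy => (hU y (hlU y hy)).1) hca fun z hz => ?_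
    by_cases hzC : z ∈ C
    · exact Or.inl hzC
    · exact Or.inr (ha z (hUR a (hlU a hl.last_mem) z hzC hz) hz)
  obtain ⟨y, hyC, -⟩ := hspan C hC
  obtain ⟨L, hL⟩ := hconn u y
  obtain ⟨v, x, hv, hx, hvx⟩ := hL.exists_adj_mem_notMem (S := (· ∈ C))
    ((hCQ u).2 hQ.head_mem) hyC
  have hcx := hfalse_adj v hv x hx hvx
  obtain ⟨w, K, hK, hwv, hKC, hKlen⟩ := hC.exists_path hv
  have hcw : c w = true := by
    have h1 := hc _ _ hvx
    have h2 := hc _ _ hwv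
    rw [hcx] at h1
    revert h1 h2
    cases c w <;> cases c v <;> simp
  have := hmax _ _ _ (hK.reverse.concat hvx (by simpa [hKC] using hx)) hcw (by
    intro z hz
    have hzC : z ∈ C := by
      by_contra hzC
      exact hc _ _ hz (hcw.trans (hfalse_adj w ((hKC w).1 hK.last_mem) z hzC hz).symm)
    simp [hKC, hzC])
  simp at this
  omega

end LongCycles

section Walks

variable {V : Type*} {G : SimpleGraph V} {u v : V} {l : List V}

theorem SimpleGraph.Walk.IsPath.isPathList {w : G.Walk u v} (hw : w.IsPath) :
    IsPathList G u v w.support :=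
  ⟨w.isChain_adj_support, hw.support_nodup,
    by rw [List.head?_eq_some_head w.support_ne_nil, w.head_support],
    by rw [List.getLast?_eq_some_getLast w.support_ne_nil, w.getLast_support]⟩

theorem IsPathList.exists_walk (h : IsPathList G u v l) :
    ∃ w : G.Walk u v, w.IsPath ∧ w.length + 1 = l.length := by
  have hu : l.head h.ne_nil = u := by
    simpa [List.head?_eq_some_head h.ne_nil] using h.head
  have hv : l.getLast h.ne_nil = v := by
    simpa [List.getLast?_eq_some_getLast h.ne_nil] using h.last
  refine ⟨(SimpleGraph.Walk.ofSupport l h.ne_nil h.chain).copy hu hv, ?_, ?_⟩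
  · rw [SimpleGraph.Walk.isPath_copy, SimpleGraph.Walk.isPath_def,
      SimpleGraph.Walk.support_ofSupport]
    exact h.nodup
  · rw [SimpleGraph.Walk.length_copy, SimpleGraph.Walk.length_ofSupport]
    have := h.length_pos
    omega

theorem IsCycleList.exists_isCycle {C : List V} (h : IsCycleList G C) (hlen : 3 ≤ C.length) :
    ∃ (v : V) (w : G.Walk v v), w.IsCycle ∧ w.length = C.length := by
  obtain ⟨u, v, hC, hvu⟩ := h
  obtain ⟨w, hw, hwC⟩ := hC.exists_walk
  refine ⟨v, .cons hvu w, ?_, by simpa using hwC⟩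
  refine (SimpleGraph.Walk.cons_isCycle_iff w hvu).2 ⟨hw, fun he => ?_⟩
  rw [Sym2.eq_swap] at he
  have := hw.length_eq_one_of_mem_edges he
  omega

theorem SimpleGraph.Connected.exists_isPathList_notMem {z : V}
    (h : (G.induce {u : V | u ≠ z}).Connected) {w : V} (hu : u ≠ z) (hw : w ≠ z) :
    ∃ l, IsPathList G u w l ∧ z ∉ l := by
  obtain ⟨q, hq⟩ := h.exists_isPath ⟨u, hu⟩ ⟨w, hw⟩
  let f := SimpleGraph.Embedding.induce (G := G) {u : V | u ≠ z}
  refine ⟨_, (SimpleGraph.Walk.IsPath.map (f := f.toHom) f.injective hq).isPathList, ?_⟩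
  rw [SimpleGraph.Walk.support_map, List.mem_map]
  rintro ⟨⟨x, hx⟩, -, hxz⟩
  exact hx hxz

theorem two_le_ncard_neighborSet [Fintype V] (hV : 3 ≤ Fintype.card V)
    (hcut : ∀ z u w, u ≠ z → w ≠ z → ∃ l, IsPathList G u w l ∧ z ∉ l) (v : V) :
    2 ≤ (G.neighborSet v).ncard := by
  classical
  have key : ∀ z ≠ v, ∃ b ≠ z, G.Adj v b := by
    intro z hz
    obtain ⟨w, hw⟩ : ∃ w, w ∉ ({v, z} : Finset V) := by
      by_contra! hall
      have := Finset.card_le_card fun x (_ : x ∈ Finset.univ) => hall x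
      have := Finset.card_le_two (a := v) (b := z)
      rw [Finset.card_univ] at *
      omega
    simp only [Finset.mem_insert, Finset.mem_singleton, not_or] at hw
    obtain ⟨l, hl, hzl⟩ := hcut z v w hz.symm hw.2
    obtain ⟨b, hb, hvb⟩ := hl.exists_adj_mem hl.head_mem hl.last_mem hw.1
    exact ⟨b, fun h => hzl (h ▸ hb), hvb⟩
  obtain ⟨w, hw⟩ : ∃ w, w ≠ v := Fintype.exists_ne_of_one_lt_card (by omega) v
  obtain ⟨a, -, ha⟩ := key w hw
  obtain ⟨b, hba, hb⟩ := key a ha.ne'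
  exact (Set.one_lt_ncard_iff (Set.toFinite _)).2 ⟨a, b, ha, hb, hba.symm⟩

end Walks

/-- **Lemma (Jackson).** Let `G = (X,Y;E)` be a 2-connected bipartite graph with
`|X| ≥ |Y|`. If every vertex of `X` has degree at least `k` and every vertex of `Y` has
degree at least `l`, then `G` contains a cycle of length at least
`2·min{|Y|, k + l - 1, 2k - 2}`. Moreover, if `k = l` and `|X| = |Y|`, then `G` contains a
cycle of length at least `2·min{|Y|, 2k - 1}`. -/
theorem stmt_14 {V : Type} [Fintype V] [DecidableEq V]
    (G : SimpleGraph V) [DecidableRel G.Adj] (X Y : Finset V) (k l : ℕ)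
    (hpart : ∀ v : V, v ∈ X ∨ v ∈ Y) (hdisj : Disjoint X Y)
    (hbip : ∀ u v : V, G.Adj u v → (u ∈ X ∧ v ∈ Y) ∨ (u ∈ Y ∧ v ∈ X))
    (h2conn : 3 ≤ Fintype.card V ∧ G.Connected ∧
      ∀ v : V, (G.induce {u : V | u ≠ v}).Connected)
    (hXY : Y.card ≤ X.card)
    (hdegX : ∀ x ∈ X, k ≤ G.degree x) (hdegY : ∀ y ∈ Y, l ≤ G.degree y) :
    (∃ (v : V) (w : G.Walk v v), w.IsCycle ∧
        2 * min Y.card (min (k + l - 1) (2 * k - 2)) ≤ w.length) ∧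
    (k = l → X.card = Y.card →
      ∃ (v : V) (w : G.Walk v v), w.IsCycle ∧
        2 * min Y.card (2 * k - 1) ≤ w.length) := by
  obtain ⟨hV, hG, hGcut⟩ := h2conn
  have hnotX : ∀ v, v ∉ X ↔ v ∈ Y := fun v =>
    ⟨fun h => (hpart v).resolve_left h, fun h h' => Finset.disjoint_left.1 hdisj h' h⟩
  have hc : ∀ u v, G.Adj u v → decide (u ∈ X) ≠ decide (v ∈ X) := by
    intro u v huv
    rcases hbip u v huv with ⟨hu, hv⟩ | ⟨hu, hv⟩ <;> rw [← hnotX] at * <;> simp_all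
  have hXc : Finset.univ.filter (fun v => decide (v ∈ X) = true) = X := by ext; simp
  have hYc : Finset.univ.filter (fun v => decide (v ∈ X) = false) = Y := by
    ext; simp [hnotX]
  have hconn : ∀ u w, ∃ q, IsPathList G u w q := fun u w => by
    obtain ⟨q, hq⟩ := hG.exists_isPath u w
    exact ⟨_, hq.isPathList⟩
  have hcut : ∀ z u w, u ≠ z → w ≠ z → ∃ q, IsPathList G u w q ∧ z ∉ q := fun z u w hu hw =>
    (hGcut z).exists_isPathList_notMem hu hw
  have hdeg : ∀ v, (G.neighborSet v).ncard = G.degree v := fun v => by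
    rw [← G.card_neighborSet_eq_degree, Set.ncard_eq_toFinset_card', Set.toFinset_card]
  have hdeg2 := two_le_ncard_neighborSet hV hcut
  have hcardV : X.card + Y.card = Fintype.card V := by
    rw [← Finset.card_union_of_disjoint hdisj, ← Finset.card_univ]
    congr 1
    ext v
    simp [hpart]
  have hY2 : 2 ≤ Y.card := by
    obtain ⟨x, hx⟩ := Finset.card_pos.1 (by omega : 0 < X.card)
    refine (hdeg2 x).trans ?_
    rw [← Set.ncard_coe_finset Y]
    refine Set.ncard_le_ncard (fun y hy => ?_) Y.finite_toSet
    have := hbip x y hy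
    rw [← hnotX x] at this
    simp_all
  have hdX : ∀ v, decide (v ∈ X) = true → max k 2 ≤ (G.neighborSet v).ncard := fun v hv =>
    max_le ((hdegX v (by simpa using hv)).trans (hdeg v).ge) (hdeg2 v)
  have hdY : ∀ v, decide (v ∈ X) = false → max l 2 ≤ (G.neighborSet v).ncard := fun v hv =>
    max_le ((hdegY v (by simpa [hnotX] using hv)).trans (hdeg v).ge) (hdeg2 v)
  constructor
  · obtain ⟨C, hC, hlen⟩ := exists_cycle_of_card_le hc hconn hcut (by rwa [hXc, hYc]) (by
      obtain ⟨y, hy⟩ := Finset.card_pos.1 (by omega : 0 < Y.card)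
      exact ⟨y, by simpa [hnotX] using hy⟩) (by omega) hdX hdY
    rw [hYc] at hlen
    obtain ⟨v, w, hw, hwC⟩ := hC.exists_isCycle (by omega)
    exact ⟨v, w, hw, by omega⟩
  · rintro rfl hcard
    have := hG.nonempty
    obtain ⟨C, hC, hlen⟩ := exists_cycle_of_card_eq hc hconn hcut (by rw [hXc, hYc, hcard])
      (k := max k 2) (fun v => by
        cases hv : decide (v ∈ X)
        · exact hdY v hv
        · exact hdX v hv)
    rw [hYc] at hlen
    obtain ⟨v, w, hw, hwC⟩ := hC.exists_isCycle (by omega)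
    exact ⟨v, w, hw, by omega⟩
end

section
/- Let G=(X,Y;E) be a balanced bipartite graph of order 2n. If d(x) + d(y) ≥ n+2 for every pair of vertices x ∈ X and y ∈ Y, then G is Hamilton-biconnected, i.e. for every x ∈ X and y ∈ Y there is a Hamiltonian path of G with end-vertices x and y. -/
namespace List

variable {α : Type*}

theorem exists_eq_append_of_not_isChain {R : α → α → Prop} {l : List α} (h : ¬ l.IsChain R) :
    ∃ s a b t, l = s ++ a :: b :: t ∧ ¬ R a b := by
  rw [isChain_iff_forall_rel_of_append_cons_cons] at h
  grind

/-- If no consecutive pair `c, d` of `l` satisfies `c ∈ A` and `d ∈ B`, and each such pair with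
`c ∈ A` or `d ∈ B` has `c ∈ S`, then counting the pairs bounds `A` and `B` in terms of `S`. -/
theorem countP_dropLast_add_countP_tail_le [DecidableEq α] {A B S : Finset α} (hAS : A ⊆ S)
    {l : List α} (h : l.IsChain fun c d ↦ ¬ (c ∈ A ∧ d ∈ B) ∧ (d ∈ B → c ∈ S)) :
    l.dropLast.countP (· ∈ A) + l.tail.countP (· ∈ B) ≤ l.dropLast.countP (· ∈ S) := by
  induction l with
  | nil => simp
  | cons x l ih =>
    cases l with
    | nil => simp
    | cons y l =>
      rw [isChain_cons_cons] at h
      have := ih h.2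
      have hx := @hAS x
      simp only [dropLast_cons_cons, tail_cons, countP_cons, decide_eq_true_eq] at this ⊢
      split_ifs <;> first | omega | (exfalso; tauto)

theorem Nodup.countP_mem_eq_card [DecidableEq α] {l : List α} (hl : l.Nodup)
    (hmem : ∀ v, v ∈ l) (A : Finset α) : l.countP (· ∈ A) = A.card := by
  rw [countP_eq_length_filter, ← toFinset_card_of_nodup (hl.filter _)]
  congr 1
  ext v
  simp [hmem v]

theorem exists_isChain_perm_append {R : α → α → Prop} [Std.Symm R] {s t : List α}
    (hlen : s.length = t.length) (h : ∀ x ∈ s, ∀ y ∈ t, R x y) :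
    ∃ l : List α, l.IsChain R ∧ l.Perm (s ++ t) ∧ l.head? = s.head? ∧ l.getLast? = t.getLast? := by
  induction s generalizing t with
  | nil =>
    obtain rfl : t = [] := by simpa [eq_comm] using hlen
    exact ⟨[], by simp⟩
  | cons x s ih =>
    cases t with
    | nil => simp at hlen
    | cons y t =>
      obtain ⟨l, hl, hp, hh, ht⟩ := ih (t := t) (by simpa using hlen)
        fun a ha b hb ↦ h a (by simp [ha]) b (by simp [hb])
      refine ⟨x :: y :: l, ?_, ?_, by simp, by simp [getLast?_cons, ht]⟩
      · rw [isChain_cons_cons, isChain_cons]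
        refine ⟨h x (by simp) y (by simp), fun z hz ↦ symm (h z ?_ y (by simp)), hl⟩
        rw [hh] at hz
        exact mem_cons_of_mem _ (mem_of_mem_head? hz)
      · exact ((hp.cons y).trans perm_middle.symm).cons x

end List

namespace SimpleGraph

variable {V : Type*} {G : SimpleGraph V} {x y a b : V}

/-- The list `l` enumerates the vertices of a Hamiltonian path of `G` from `x` to `y`. -/
structure IsHamiltonianList (G : SimpleGraph V) (x y : V) (l : List V) : Prop where
  isChain : l.IsChain G.Adj
  nodup : l.Nodup
  mem : ∀ v, v ∈ l
  head : l.head? = some x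
  last : l.getLast? = some y

theorem exists_walk_support_eq {l : List V} (hl : l.IsChain G.Adj) (hx : l.head? = some x)
    (hy : l.getLast? = some y) : ∃ p : G.Walk x y, p.support = l := by
  induction l generalizing x with
  | nil => simp at hx
  | cons z l ih =>
    obtain rfl : z = x := by simpa using hx
    cases l with
    | nil =>
      obtain rfl : z = y := by simpa using hy
      exact ⟨.nil, rfl⟩
    | cons w l =>
      rw [List.isChain_cons_cons] at hl
      obtain ⟨p, hp⟩ := ih hl.2 rfl (by simpa using hy)
      exact ⟨.cons hl.1 p, by simp [hp]⟩

/-- Replacing the edges `ab` and `cd` of a Hamiltonian path by `ac` and `bd`. -/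
theorem exists_isHamiltonianList_of_crossing {c d : V} {A B C D : List V}
    (hAa : (A ++ [a]).IsChain G.Adj) (hbB : (b :: B).IsChain G.Adj)
    (hnodup : (A ++ a :: b :: B).Nodup) (hmem : ∀ v, v ∈ A ++ a :: b :: B)
    (hx : (A ++ a :: b :: B).head? = some x) (hy : (A ++ a :: b :: B).getLast? = some y)
    (hCD : A ++ a :: b :: B = C ++ c :: d :: D) (hac : G.Adj a c) (hbd : G.Adj b d) :
    ∃ l, G.IsHamiltonianList x y l := by
  have key : (∃ E, A ++ [a] = C ++ c :: d :: E ∧ D = E ++ b :: B) ∨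
      ∃ E, b :: B = E ++ c :: d :: D := by
    have hca := hac.ne
    rw [List.append_eq_append_iff] at hCD
    rcases hCD with ⟨E, rfl, hE⟩ | ⟨E, rfl, hE⟩
    · cases E with
      | nil => simp_all
      | cons e E =>
        simp only [List.cons_append, List.cons.injEq] at hE
        exact .inr ⟨E, hE.2⟩
    · match E with
      | [] => simp_all
      | [e] =>
        simp only [List.cons_append, List.nil_append, List.cons.injEq] at hE
        exact .inl ⟨[], by simp [hE], by simp [hE]⟩
      | e :: f :: E =>
        simp only [List.cons_append, List.cons.injEq] at hE
        exact .inl ⟨E ++ [a], by simp [hE], by simp [hE]⟩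
  have hsymm : (fun u v ↦ G.Adj v u) = G.Adj := by
    ext u v
    exact G.adj_comm v u
  have of_perm {l : List V} (hp : l.Perm (A ++ a :: b :: B)) (h : l.IsChain G.Adj)
      (hx : l.head? = some x) (hy : l.getLast? = some y) : ∃ l, G.IsHamiltonianList x y l :=
    ⟨l, h, hp.nodup_iff.2 hnodup, fun v ↦ hp.mem_iff.2 (hmem v), hx, hy⟩
  have hsplit : A ++ a :: b :: B = (A ++ [a]) ++ (b :: B) := by simp
  rw [hsplit] at hx hy of_perm
  rcases key with ⟨E, hE, rfl⟩ | ⟨E, hE⟩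
  · have hl : (d :: E).getLast? = some a := by
      have := congrArg List.getLast? hE
      simpa using this.symm
    rw [hE] at hAa hx of_perm
    refine of_perm (l := (C ++ [c]) ++ ((d :: E).reverse ++ (b :: B))) ?_ ?_ ?_ ?_
    · rw [show C ++ c :: d :: E ++ b :: B = C ++ [c] ++ ((d :: E) ++ b :: B) by simp]
      exact ((List.reverse_perm _).append_right _).append_left _
    · rw [show C ++ c :: d :: E = (C ++ [c]) ++ (d :: E) by simp, List.isChain_append] at hAa
      rw [List.isChain_append, List.isChain_append (l₁ := List.reverse _), List.isChain_reverse,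
        hsymm]
      refine ⟨hAa.1, ⟨hAa.2.1, hbB, ?_⟩, ?_⟩
      · simpa using hbd.symm
      · rw [List.head?_append, List.head?_reverse, hl]
        simpa using hac.symm
    · cases C <;> simpa using hx
    · rw [List.getLast?_append_of_ne_nil _ (by simp)] at hy
      rw [List.getLast?_append_of_ne_nil _ (by simp), List.getLast?_append_of_ne_nil _ (by simp)]
      simpa using hy
  · have hl : (E ++ [c]).head? = some b := by
      have := congrArg List.head? hE
      cases E <;> simpa using this.symm
    rw [hE] at hbB hy of_perm
    refine of_perm (l := (A ++ [a]) ++ ((E ++ [c]).reverse ++ (d :: D))) ?_ ?_ ?_ ?_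
    · rw [show E ++ c :: d :: D = E ++ [c] ++ (d :: D) by simp]
      exact ((List.reverse_perm _).append_right _).append_left _
    · rw [show E ++ c :: d :: D = (E ++ [c]) ++ (d :: D) by simp, List.isChain_append] at hbB
      rw [List.isChain_append, List.isChain_append (l₁ := List.reverse _), List.isChain_reverse,
        hsymm]
      refine ⟨hAa, ⟨hbB.1, hbB.2.1, ?_⟩, ?_⟩
      · rw [List.getLast?_reverse, hl]
        simpa using hbd
      · simpa using hac
    · cases A <;> simpa using hx
    · rw [List.getLast?_append_of_ne_nil _ (by simp)] at hy
      rw [List.getLast?_append_of_ne_nil _ (by simp), List.getLast?_append_of_ne_nil _ (by simp)]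
      simpa using hy

theorem exists_isHamiltonianList_of_missing_edge [Fintype V] [DecidableEq V]
    [DecidableRel G.Adj] {S : Finset V} (hS : ∀ u v, G.Adj u v → (u ∈ S ↔ v ∉ S))
    (ha : a ∉ S) (hb : b ∈ S) (hdeg : S.card + 2 ≤ G.degree a + G.degree b) {A B : List V}
    (hAa : (A ++ [a]).IsChain G.Adj) (hbB : (b :: B).IsChain G.Adj)
    (hnodup : (A ++ a :: b :: B).Nodup) (hmem : ∀ v, v ∈ A ++ a :: b :: B)
    (hx : (A ++ a :: b :: B).head? = some x) (hy : (A ++ a :: b :: B).getLast? = some y) :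
    ∃ l, G.IsHamiltonianList x y l := by
  have hSchain : (A ++ a :: b :: B).IsChain fun u v ↦ (u ∈ S ↔ v ∉ S) := by
    rw [List.isChain_append_cons_cons]
    exact ⟨hAa.imp hS, by tauto, hbB.imp hS⟩
  have hNa : G.neighborFinset a ⊆ S := fun v hv ↦ by
    have := hS a v (by simpa using hv)
    tauto
  by_cases h : (A ++ a :: b :: B).IsChain
      fun c d ↦ ¬ (c ∈ G.neighborFinset a ∧ d ∈ G.neighborFinset b)
  · have hcount := List.countP_dropLast_add_countP_tail_le hNa (B := G.neighborFinset b)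
      (l := A ++ a :: b :: B) (by
        rw [List.isChain_iff_forall_rel_of_append_cons_cons] at hSchain h ⊢
        refine fun c d s t hst ↦ ⟨h hst, fun hd ↦ ?_⟩
        have := hSchain hst
        have := hS b d (by simpa using hd)
        tauto)
    have hcA := hnodup.countP_mem_eq_card hmem (G.neighborFinset a)
    have hcB := hnodup.countP_mem_eq_card hmem (G.neighborFinset b)
    have hcS := hnodup.countP_mem_eq_card hmem S
    rw [← List.dropLast_append_getLast? y hy, List.countP_append] at hcA hcS
    rw [← List.cons_head?_tail hx, List.countP_cons] at hcB
    have hyS := @hNa y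
    simp only [List.countP_singleton, decide_eq_true_eq, card_neighborFinset_eq_degree]
      at hcA hcB hcS
    split_ifs at hcA hcB hcS <;> first | omega | (exfalso; tauto)
  · obtain ⟨C, c, d, D, hCD, hcd⟩ := List.exists_eq_append_of_not_isChain h
    simp only [mem_neighborFinset, not_not] at hcd
    exact exists_isHamiltonianList_of_crossing hAa hbB hnodup hmem hx hy hCD hcd.1 hcd.2

/-- Deleting from `G ⊔ edge u v` the edge `uv` between vertices of large degree sum preserves the
existence of a Hamiltonian path with given ends, for a balanced bipartite graph `G`. -/
theorem IsHamiltonianList.exists_of_sup_edge [Fintype V] [DecidableEq V] [DecidableRel G.Adj]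
    {X Y : Finset V} {u v : V} (hX : ∀ s t, G.Adj s t → (s ∈ X ↔ t ∉ X))
    (hY : ∀ s t, G.Adj s t → (s ∈ Y ↔ t ∉ Y)) (hdisj : Disjoint X Y)
    (hcard : X.card = Y.card) (hu : u ∈ X) (hv : v ∈ Y)
    (hdeg : X.card + 2 ≤ G.degree u + G.degree v) {l : List V}
    (hl : (G ⊔ edge u v).IsHamiltonianList x y l) : ∃ l, G.IsHamiltonianList x y l := by
  by_cases h : l.IsChain G.Adj
  · exact ⟨l, h, hl.nodup, hl.mem, hl.head, hl.last⟩
  obtain ⟨A, a, b, B, rfl, hab⟩ := List.exists_eq_append_of_not_isChain h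
  obtain ⟨hch, hnodup, hmem, hx, hy⟩ := hl
  rw [List.isChain_append_cons_cons] at hch
  have hedge {s t : V} (hst : (G ⊔ edge u v).Adj s t) :
      G.Adj s t ∨ s = u ∧ t = v ∨ s = v ∧ t = u := by
    rw [sup_adj, edge_adj] at hst
    tauto
  have hends := (hedge hch.2.1).resolve_left hab
  have hnd : (A ++ [a] ++ b :: B).Nodup := by simpa using hnodup
  rw [List.nodup_append] at hnd
  have hAa : (A ++ [a]).IsChain G.Adj := hch.1.imp_of_mem_imp fun s t hs ht hst ↦ by
    have h1 := hnd.2.2 s hs b (by simp)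
    have h2 := hnd.2.2 t ht b (by simp)
    rcases hedge hst with h | h | h
    · exact h
    all_goals exfalso; grind
  have hbB : (b :: B).IsChain G.Adj := hch.2.2.imp_of_mem_imp fun s t hs ht hst ↦ by
    have h1 := hnd.2.2 a (by simp) s hs
    have h2 := hnd.2.2 a (by simp) t ht
    rcases hedge hst with h | h | h
    · exact h
    all_goals exfalso; grind
  rcases hends with ⟨rfl, rfl⟩ | ⟨rfl, rfl⟩
  · exact exists_isHamiltonianList_of_missing_edge hY (Finset.disjoint_left.1 hdisj hu) hv
      (by omega) hAa hbB hnodup hmem hx hy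
  · exact exists_isHamiltonianList_of_missing_edge hX (Finset.disjoint_right.1 hdisj hv) hu
      (by omega) hAa hbB hnodup hmem hx hy

theorem exists_isHamiltonianList_of_forall_adj {X Y : Finset V}
    (hpart : ∀ v, v ∈ X ∨ v ∈ Y) (hdisj : Disjoint X Y) (hcard : X.card = Y.card)
    (hadj : ∀ s ∈ X, ∀ t ∈ Y, G.Adj s t) (hx : x ∈ X) (hy : y ∈ Y) :
    ∃ l, G.IsHamiltonianList x y l := by
  classical
  have hs : (x :: (X.erase x).toList).Perm X.toList :=
    (Finset.toList_insert (Finset.notMem_erase x X)).symm.trans (by rw [Finset.insert_erase hx])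
  have ht : ((Y.erase y).toList ++ [y]).Perm Y.toList :=
    (List.perm_append_singleton _ _).trans <|
      (Finset.toList_insert (Finset.notMem_erase y Y)).symm.trans (by rw [Finset.insert_erase hy])
  have : Std.Symm G.Adj := ⟨fun _ _ h ↦ h.symm⟩
  obtain ⟨l, hl, hp, hh, hlast⟩ := List.exists_isChain_perm_append (R := G.Adj)
    (s := x :: (X.erase x).toList) (t := (Y.erase y).toList ++ [y])
    (by rw [hs.length_eq, ht.length_eq]; simpa)
    fun s hsm t htm ↦ hadj s (by simpa using hs.mem_iff.1 hsm) t (by simpa using ht.mem_iff.1 htm)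
  have hp := hp.trans (hs.append ht)
  refine ⟨l, hl, hp.nodup_iff.2 ?_, fun v ↦ hp.mem_iff.2 ?_, hh, by simpa using hlast⟩
  · rw [List.nodup_append']
    refine ⟨X.nodup_toList, Y.nodup_toList, fun v hvX hvY ↦ ?_⟩
    exact Finset.disjoint_left.1 hdisj (by simpa using hvX) (by simpa using hvY)
  · simpa using hpart v

open Classical in
theorem exists_isHamiltonianList_of_degree_sum [Fintype V] {X Y : Finset V}
    (hpart : ∀ v, v ∈ X ∨ v ∈ Y) (hdisj : Disjoint X Y) (hcard : X.card = Y.card)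
    (hbip : ∀ u v, G.Adj u v → (u ∈ X ∧ v ∈ Y) ∨ (u ∈ Y ∧ v ∈ X))
    (hdeg : ∀ s ∈ X, ∀ t ∈ Y, X.card + 2 ≤ G.degree s + G.degree t) (hx : x ∈ X) (hy : y ∈ Y) :
    ∃ l, G.IsHamiltonianList x y l := by
  induction G using WellFoundedGT.induction with
  | ind G ih =>
    by_cases hadj : ∀ s ∈ X, ∀ t ∈ Y, G.Adj s t
    · exact exists_isHamiltonianList_of_forall_adj hpart hdisj hcard hadj hx hy
    push Not at hadj
    obtain ⟨u, hu, v, hv, huv⟩ := hadj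
    have hne : u ≠ v := fun h ↦ Finset.disjoint_left.1 hdisj hu (h ▸ hv)
    obtain ⟨l, hl⟩ := ih (G ⊔ edge u v) (G.lt_sup_edge _ _ hne huv)
      (fun s t hst ↦ by
        rw [sup_adj, edge_adj] at hst
        rcases hst with hst | ⟨⟨rfl, rfl⟩ | ⟨rfl, rfl⟩, -⟩
        · exact hbip s t hst
        · exact .inl ⟨hu, hv⟩
        · exact .inr ⟨hv, hu⟩)
      (fun s hs t ht ↦ (hdeg s hs t ht).trans <|
        add_le_add (by convert degree_le_of_le le_sup_left)
          (by convert degree_le_of_le le_sup_left))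
    have hdisj' (w : V) : ¬ (w ∈ X ∧ w ∈ Y) := fun h ↦ Finset.disjoint_left.1 hdisj h.1 h.2
    refine hl.exists_of_sup_edge (fun s t hst ↦ ?_) (fun s t hst ↦ ?_) hdisj hcard hu hv
      (hdeg u hu v hv)
    all_goals
      have := hbip s t hst
      have := hdisj' s
      have := hdisj' t
      tauto

end SimpleGraph


/-- **Lemma (Bagga–Varma).** Let `G = (X,Y;E)` be a balanced bipartite graph of order `2n`.
If `d(x) + d(y) ≥ n + 2` for every `(x,y) ∈ (X,Y)`, then `G` is Hamilton-biconnected: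
for every `x ∈ X` and `y ∈ Y` there is a Hamiltonian path of `G` with end-vertices
`x` and `y`. -/
theorem stmt_15 {V : Type} [Fintype V] [DecidableEq V]
    (G : SimpleGraph V) [DecidableRel G.Adj] (X Y : Finset V) (n : ℕ)
    (hpart : ∀ v : V, v ∈ X ∨ v ∈ Y) (hdisj : Disjoint X Y)
    (hbip : ∀ u v : V, G.Adj u v → (u ∈ X ∧ v ∈ Y) ∨ (u ∈ Y ∧ v ∈ X))
    (hX : X.card = n) (hY : Y.card = n)
    (hdeg : ∀ x ∈ X, ∀ y ∈ Y, n + 2 ≤ G.degree x + G.degree y) :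
    ∀ x ∈ X, ∀ y ∈ Y,
      ∃ p : G.Walk x y, p.IsPath ∧ ∀ v : V, v ∈ p.support := by
  intro x hx y hy
  obtain ⟨l, hl⟩ := G.exists_isHamiltonianList_of_degree_sum hpart hdisj (hX.trans hY.symm) hbip
    (fun s hs t ht ↦ by rw [hX]; convert hdeg s hs t ht) hx hy
  obtain ⟨p, rfl⟩ := SimpleGraph.exists_walk_support_eq hl.isChain hl.head hl.last
  exact ⟨p, .mk' hl.nodup, hl.mem⟩
end

section
/- Let G be a 2-connected graph, C a longest cycle of G, and H a connected component of G−V(C). If d(v) ≥ d for every vertex v ∈ V(H), then for every vertex x ∈ V(H) there is an (x,C)-fan F in G with at least d edges. -/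
/-- `v :: l` is a walk in `G` that ends in `T` and meets `T` only in its last vertex. -/
def IsLeg {V : Type*} (G : SimpleGraph V) (T : Set V) (v : V) (l : List V) : Prop :=
  (v :: l).IsChain G.Adj ∧ ∃ y ∈ T, (v :: l).getLast? = some y ∧ ∀ z ∈ v :: l, z ∈ T → z = y

/-- The lists in `L`, each preceded by `v`, are the paths of a fan from `v` to `T`. -/
def IsFan {V : Type*} (G : SimpleGraph V) (T : Set V) (v : V) (L : List (List V)) : Prop :=
  (v :: L.flatten).Nodup ∧ ∀ l ∈ L, IsLeg G T v l

section Fan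

variable {V : Type*} {G : SimpleGraph V} {T : Set V}

theorem IsLeg.exists_truncation {l : List V} : ∀ {v : V}, v ∉ T → (v :: l).IsChain G.Adj →
    (∃ z ∈ l, z ∈ T) → ∃ l', l' <+: l ∧ IsLeg G T v l' := by
  induction l with
  | nil => simp
  | cons w l ih =>
    intro v hv hc hz
    by_cases hw : w ∈ T
    · refine ⟨[w], by simp, ?_, w, hw, by simp, ?_⟩
      · simp_all
      · intro z hz hzT
        grind
    · obtain ⟨l', hl', hleg, y, hy, hlast, honly⟩ := ih hw (by simp_all) (by grind)
      refine ⟨w :: l', by simpa using hl', ?_, y, hy, by simpa using hlast, ?_⟩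
      · simp_all
      · grind

theorem IsLeg.eq_concat {v : V} {l : List V} (hv : v ∉ T) (h : IsLeg G T v l) :
    ∃ m y, l = m ++ [y] ∧ y ∈ T ∧ (∀ z ∈ v :: m, z ∈ T → z = y) ∧
      (v :: (m ++ [y])).IsChain G.Adj := by
  obtain ⟨hc, y, hy, hlast, honly⟩ := h
  rcases List.eq_nil_or_concat l with rfl | ⟨m, a, rfl⟩
  · grind
  · have : a = y := by grind
    subst this
    rw [List.concat_eq_append] at *
    exact ⟨m, a, rfl, hy, by grind, hc⟩

theorem IsFan.perm {v : V} {L L' : List (List V)} (h : IsFan G T v L) (hp : L.Perm L') :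
    IsFan G T v L' :=
  ⟨((hp.flatten).cons v).nodup_iff.1 h.1, fun l hl => h.2 l (hp.mem_iff.2 hl)⟩

theorem IsFan.cons {v : V} {l : List V} {L : List (List V)} (h : IsFan G T v L)
    (hl : IsLeg G T v l) (hnd : l.Nodup) (hv : v ∉ l) (hd : ∀ z ∈ l, z ∉ L.flatten) :
    IsFan G T v (l :: L) := by
  refine ⟨?_, ?_⟩
  · have := h.1
    simp only [List.flatten_cons, List.nodup_cons, List.nodup_append, List.mem_append] at *
    grind
  · have := h.2
    grind

/-- Replacing the segment `M` between `a` and `b` on a path of a fan by a new segment `R`. -/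
theorem IsFan.reroute {x a b : V} {l l' P M R S : List V} {L : List (List V)}
    (h : IsFan G T x (l :: L)) (hl : x :: l = P ++ a :: (M ++ b :: S))
    (hl' : x :: l' = P ++ a :: (R ++ b :: S)) (hR : R.Nodup)
    (hchain : (a :: (R ++ [b])).IsChain G.Adj)
    (hRT : ∀ z ∈ R, z ∉ T) (hRL : ∀ z ∈ R, z ∉ x :: (l :: L).flatten) :
    IsFan G T x (l' :: L) := by
  obtain ⟨hnd, hleg⟩ := h
  have hnd1 : ((x :: l) ++ L.flatten).Nodup := by simpa using hnd
  refine ⟨?_, ?_⟩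
  · have : ((x :: l') ++ L.flatten).Nodup := by
      have hRL' : ∀ z ∈ R, z ∉ (x :: l) ∧ z ∉ L.flatten := by
        intro z hz
        have := hRL z hz
        simp only [List.flatten_cons, List.mem_cons, List.mem_append] at this ⊢
        tauto
      rw [hl] at hnd1 hRL'
      rw [hl']
      simp only [List.nodup_append, List.nodup_cons, List.mem_append, List.mem_cons] at *
      grind
    simpa using this
  · intro k hk
    rcases List.mem_cons.1 hk with rfl | hk
    · obtain ⟨hc, y, hy, hlast, honly⟩ := hleg l (by simp)
      rw [hl] at hc hlast honly
      refine ⟨?_, y, hy, ?_, ?_⟩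
      · rw [hl']
        have hc2 := List.isChain_split.1 hc
        have hc3 := List.isChain_split (l₁ := a :: M).1 hc2.2
        exact List.isChain_split.2 ⟨hc2.1, List.isChain_split (l₁ := a :: R).2 ⟨hchain, hc3.2⟩⟩
      · rw [hl']
        simp_all [List.getLast?_append, List.getLast?_cons]
      · rw [hl']
        intro z hz hzT
        grind
    · exact hleg k (by simp [hk])

theorem isFan_pair {v : V} {p q : List V} : IsFan G T v [p, q] ↔
    (v :: (p ++ q)).Nodup ∧ IsLeg G T v p ∧ IsLeg G T v q := by
  simp [IsFan]

theorem IsLeg.suffix {w v : V} {A B p : List V} (h : IsLeg G T w p)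
    (hp : w :: p = A ++ v :: B) : IsLeg G T v B := by
  obtain ⟨hc, y, hy, hlast, honly⟩ := h
  rw [hp] at hc hlast honly
  refine ⟨(List.isChain_split.1 hc).2, y, hy, ?_, fun z hz => honly z (by simp_all)⟩
  simpa [List.getLast?_append, List.getLast?_cons] using hlast

theorem IsLeg.cons {w v : V} {p : List V} (h : IsLeg G T w p) (hv : v ∉ T) (hvw : G.Adj v w) :
    IsLeg G T v (w :: p) := by
  obtain ⟨hc, y, hy, hlast, honly⟩ := h
  refine ⟨List.IsChain.cons_cons hvw hc, y, hy, by simpa using hlast, ?_⟩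
  intro z hz hzT
  grind

theorem isLeg_singleton {v w : V} (hv : v ∉ T) (hw : w ∈ T) (hvw : G.Adj v w) :
    IsLeg G T v [w] :=
  IsLeg.cons ⟨by simp, w, hw, by simp, by simp⟩ hv hvw

theorem IsFan.move_of_mem {w v : V} {p q : List V} (h : IsFan G T w [p, q]) (hv : v ∉ T)
    (hvw : G.Adj v w) (hvp : v ∈ p) : ∃ p' q', IsFan G T v [p', q'] := by
  rw [isFan_pair] at h
  obtain ⟨A, B, rfl⟩ := List.append_of_mem hvp
  refine ⟨B, w :: q, isFan_pair.2 ⟨?_, h.2.1.suffix (A := w :: A) rfl, h.2.2.cons hv hvw⟩⟩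
  have := h.1
  simp only [List.nodup_append, List.nodup_cons, List.mem_append, List.mem_cons] at *
  grind

theorem IsFan.move_of_path {w v z : V} {m p q : List V} (h : IsFan G T w [p, q]) (hv : v ∉ T)
    (hvw : G.Adj v w) (hc : (v :: (m ++ [z])).IsChain G.Adj) (hnd : (v :: (m ++ [z])).Nodup)
    (hwm : w ∉ m ++ [z]) (hm : ∀ a ∈ v :: m, a ∉ T ∧ a ∉ p ∧ a ∉ q) (hz : z ∈ p) :
    ∃ p' q', IsFan G T v [p', q'] := by
  rw [isFan_pair] at h
  obtain ⟨A, B, rfl⟩ := List.append_of_mem hz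
  obtain ⟨h1, h2, h3⟩ := h
  refine ⟨m ++ z :: B, w :: q, isFan_pair.2 ⟨?_, ?_, h3.cons hv hvw⟩⟩
  · have := hvw.ne
    simp only [List.nodup_append, List.nodup_cons, List.mem_append, List.mem_cons] at *
    grind
  · obtain ⟨hcB, y, hy, hlast, honly⟩ := h2.suffix (A := w :: A) rfl
    refine ⟨List.isChain_split (l₁ := v :: m).2 ⟨hc, hcB⟩, y, hy, ?_, ?_⟩
    · simp_all [List.getLast?_append, List.getLast?_cons]
    · intro a ha haT
      by_cases ham : a ∈ v :: m
      · exact absurd haT (hm a ham).1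
      · exact honly a (by simp_all) haT

theorem exists_isFan_pair {H : Set V} (hHT : ∀ v ∈ H, v ∉ T)
    (hN : ∀ v ∈ H, ∀ w, G.Adj v w → w ∈ H ∨ w ∈ T)
    (hsep : ∀ v ∈ H, ∀ c, c ≠ v → ∃ l, IsLeg G T v l ∧ (v :: l).Nodup ∧ c ∉ l) (l : List V) :
    ∀ v ∈ H, (v :: l).IsChain G.Adj → (∃ z ∈ l, z ∈ T) → ∃ p q, IsFan G T v [p, q] := by
  induction l with
  | nil => simp
  | cons w l ih =>
    intro v hv hc hz
    have hvw : G.Adj v w := by simp_all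
    have hvT := hHT v hv
    obtain ⟨r, hr, hrnd, hwr⟩ := hsep v hv w hvw.ne'
    by_cases hw : w ∈ T
    · refine ⟨[w], r, isFan_pair.2 ⟨?_, isLeg_singleton hvT hw hvw, hr⟩⟩
      have := hvw.ne
      simp_all
    have hwH : w ∈ H := (hN v hv w hvw).resolve_right hw
    obtain ⟨p, q, hpq⟩ := ih w hwH (by simp_all) (by grind)
    have hqp : IsFan G T w [q, p] := hpq.perm (List.Perm.swap _ _ _)
    by_cases hvp : v ∈ p
    · exact hpq.move_of_mem hvT hvw hvp
    by_cases hvq : v ∈ q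
    · exact hqp.move_of_mem hvT hvw hvq
    obtain ⟨m, y, rfl, hy, -, hrc⟩ := hr.eq_concat hvT
    obtain ⟨r', hpre, hr'⟩ := IsLeg.exists_truncation (T := T ∪ {z | z ∈ p ∨ z ∈ q})
      (l := m ++ [y]) (v := v) (by simp_all) hrc ⟨y, by simp, Or.inl hy⟩
    have hr'nd : (v :: r').Nodup := hrnd.sublist (hpre.sublist.cons_cons v)
    have hwr' : w ∉ r' := fun h => hwr (hpre.subset h)
    obtain ⟨m', z, rfl, hzT, honly, hc'⟩ := hr'.eq_concat (by simp_all)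
    have hm : ∀ a ∈ v :: m', a ∉ T ∧ a ∉ p ∧ a ∉ q := by
      intro a ha
      have : a ≠ z := by
        rintro rfl
        simp only [List.nodup_append, List.nodup_cons, List.mem_append, List.mem_cons] at ha hr'nd
        grind
      have := fun h => this (honly a ha h)
      simpa using this
    by_cases hzp : z ∈ p
    · exact hpq.move_of_path hvT hvw hc' hr'nd hwr' hm hzp
    by_cases hzq : z ∈ q
    · exact hqp.move_of_path hvT hvw hc' hr'nd hwr' (fun a ha => by have := hm a ha; tauto) hzq
    have hzT : z ∈ T := by simp_all
    refine ⟨m' ++ [z], w :: p, isFan_pair.2 ⟨?_, ⟨hc', z, hzT, ?_, ?_⟩, ?_⟩⟩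
    · have h1 := (isFan_pair.1 hpq).1
      have := hvw.ne
      simp only [List.nodup_append, List.nodup_cons, List.mem_append, List.mem_cons] at *
      grind
    · simp [List.getLast?_cons]
    · intro a ha haT
      by_contra hne
      exact (hm a (by simp_all)).1 haT
    · exact (isFan_pair.1 hpq).2.1.cons hvT hvw

/-- If any two positive values of `q` on `a :: l` are at most the distance of their positions
apart, then either `q` vanishes on `l` or `l` is long. -/
theorem sum_le_length_of_gaps (q : V → ℕ) : ∀ (n : ℕ) (a : V) (l : List V), l.length ≤ n →
    0 < q a →
    (∀ P a' M b S, a :: l = P ++ a' :: (M ++ b :: S) → 0 < q a' → 0 < q b →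
      q a' + q b ≤ M.length + 1) →
    (l.map q).sum = 0 ∨ q a + (l.map q).sum ≤ l.length := by
  intro n
  induction n with
  | zero =>
    intro a l hl
    simp_all
  | succ n ih =>
    intro a l hl ha hgap
    by_cases h0 : ∃ b ∈ l, 0 < q b
    · right
      obtain ⟨b, M, S, hMS, hM, hb⟩ : ∃ b M S, l = M ++ b :: S ∧ (∀ z ∈ M, q z = 0) ∧ 0 < q b := by
        obtain ⟨b, hb⟩ := Option.isSome_iff_exists.1
          (List.find?_isSome (p := fun z => decide (0 < q z)) (xs := l) |>.2 (by simpa using h0))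
        obtain ⟨hqb, M, S, rfl, hM⟩ := List.find?_eq_some_iff_append.1 hb
        exact ⟨b, M, S, rfl, by simpa using hM, by simpa using hqb⟩
      subst hMS
      have h1 := hgap [] a M b S rfl ha hb
      have hM0 : (M.map q).sum = 0 := by
        rw [List.sum_eq_zero_iff]
        simpa using hM
      have := ih b S (by simp at hl; omega) hb (fun P a' M' b' S' h =>
        hgap (a :: M ++ P) a' M' b' S' (by simp [h]))
      simp only [List.map_append, List.map_cons, List.sum_append, List.sum_cons,
        List.length_append, List.length_cons]
      omega
    · left
      rw [List.sum_eq_zero_iff]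
      simp only [List.mem_map]
      grind

open Classical in
/-- The number of edges of the paths in `Q` that end in `z`. -/
noncomputable def footWeight (Q : List (List V)) (z : V) : ℕ :=
  (Q.map fun l => if l.getLast? = some z then l.length else 0).sum

open Classical in
theorem footWeight_cons (l : List V) (Q : List (List V)) (z : V) : footWeight (l :: Q) z =
    (if l.getLast? = some z then l.length else 0) + footWeight Q z := by
  simp [footWeight]

theorem exists_mem_of_footWeight_pos {Q : List (List V)} {z : V} (hQ : Q.flatten.Nodup)
    (hz : 0 < footWeight Q z) : ∃ l ∈ Q, l.getLast? = some z ∧ l.length = footWeight Q z := by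
  induction Q with
  | nil => simp [footWeight] at hz
  | cons l Q ih =>
    have hcons := footWeight_cons l Q z
    rw [List.flatten_cons, List.nodup_append] at hQ
    by_cases hl : l.getLast? = some z
    · refine ⟨l, by simp, hl, ?_⟩
      have : footWeight Q z = 0 := by
        by_contra hne
        obtain ⟨l', hl', hlast, -⟩ := ih hQ.2.1 (Nat.pos_of_ne_zero hne)
        exact hQ.2.2 z (List.mem_of_getLast? hl) z
          (List.mem_flatten.2 ⟨l', hl', List.mem_of_getLast? hlast⟩) rfl
      rw [hcons, this, if_pos hl, Nat.add_zero]
    · rw [if_neg hl, Nat.zero_add] at hcons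
      rw [hcons] at hz ⊢
      obtain ⟨l', hl', h⟩ := ih hQ.2.1 hz
      exact ⟨l', by simp [hl'], h⟩

theorem length_le_footWeight {Q : List (List V)} {l : List V} {z : V} (hl : l ∈ Q)
    (hz : l.getLast? = some z) : l.length ≤ footWeight Q z := by
  classical
  refine le_trans ?_ (List.single_le_sum (fun _ _ => Nat.zero_le _) _ (List.mem_map_of_mem hl))
  simp [hz]

theorem length_flatten_le_sum_footWeight {Q : List (List V)} {S : List V}
    (h : ∀ l ∈ Q, ∃ z ∈ S, l.getLast? = some z) :
    Q.flatten.length ≤ (S.map (footWeight Q)).sum := by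
  classical
  induction Q with
  | nil => simp
  | cons l Q ih =>
    have hcons : footWeight (l :: Q) =
        fun z => (if l.getLast? = some z then l.length else 0) + footWeight Q z :=
      funext (footWeight_cons l Q)
    obtain ⟨z, hz, hlast⟩ := h l (by simp)
    have h1 : l.length ≤ (S.map fun z => if l.getLast? = some z then l.length else 0).sum := by
      refine le_trans ?_ (List.single_le_sum (fun _ _ => Nat.zero_le _) _ (List.mem_map_of_mem hz))
      simp [hlast]
    have h2 := ih fun l hl => h l (by simp [hl])
    rw [hcons, List.sum_map_add, List.flatten_cons, List.length_append]
    omega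

/-- Two paths of a fan with different ends join up to a path between these ends. -/
theorem IsFan.exists_connection {v a b : V} {Q : List (List V)} {la lb : List V} (hv : v ∉ T)
    (h : IsFan G T v Q) (hla : la ∈ Q) (hlb : lb ∈ Q) (ha : la.getLast? = some a)
    (hb : lb.getLast? = some b) (hab : a ≠ b) :
    ∃ R : List V, R.Nodup ∧ (a :: (R ++ [b])).IsChain G.Adj ∧ (∀ z ∈ R, z ∉ T) ∧
      R.length + 1 = la.length + lb.length := by
  have hne : la ≠ lb := by
    rintro rfl
    simp_all
  have : Std.Symm (List.Disjoint (α := V)) := ⟨fun _ _ h => h.symm⟩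
  have hdisj := (List.nodup_flatten.1 (List.nodup_cons.1 h.1).2).2.forall hla hlb hne
  have hnda := (List.nodup_flatten.1 (List.nodup_cons.1 h.1).2).1 _ hla
  have hndb := (List.nodup_flatten.1 (List.nodup_cons.1 h.1).2).1 _ hlb
  have hva : v ∉ la := fun hva => (List.nodup_cons.1 h.1).1 (List.mem_flatten.2 ⟨la, hla, hva⟩)
  have hvb : v ∉ lb := fun hvb => (List.nodup_cons.1 h.1).1 (List.mem_flatten.2 ⟨lb, hlb, hvb⟩)
  obtain ⟨ma, a', rfl, -, honlya, hca⟩ := (h.2 _ hla).eq_concat hv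
  obtain ⟨mb, b', rfl, -, honlyb, hcb⟩ := (h.2 _ hlb).eq_concat hv
  obtain rfl : a' = a := by simpa using ha
  obtain rfl : b' = b := by simpa using hb
  simp only [List.Disjoint, List.nodup_append, List.mem_append, List.mem_singleton] at *
  refine ⟨ma.reverse ++ v :: mb, ?_, ?_, ?_, ?_⟩
  · simp only [List.nodup_append, List.nodup_cons, List.mem_cons, List.mem_reverse,
      List.nodup_reverse]
    grind
  · have h1 : (a' :: (ma.reverse ++ [v])).IsChain G.Adj := by
      have := (List.isChain_reverse (R := G.Adj) (l := v :: (ma ++ [a']))).2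
        (hca.imp fun _ _ h => h.symm)
      simpa using this
    have := List.isChain_split (l₁ := a' :: ma.reverse).2 ⟨h1, hcb⟩
    simpa using this
  · intro z hz
    simp only [List.mem_append, List.mem_reverse, List.mem_cons] at hz
    grind
  · simp
    omega

/-- In a fan with the maximum number of edges, two vertices of one path have distance at least
the length of any outside connection between them. -/
theorem IsFan.gap_le_of_maximal {x a b : V} {L : List (List V)} {l P M S R : List V}
    (hL : IsFan G T x L)
    (hmax : ∀ L', IsFan G T x L' → L.length ≤ L'.length → L'.flatten.length ≤ L.flatten.length)
    (hl : l ∈ L) (hsplit : x :: l = P ++ a :: (M ++ b :: S)) (hR : R.Nodup)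
    (hchain : (a :: (R ++ [b])).IsChain G.Adj) (hRT : ∀ z ∈ R, z ∉ T)
    (hRL : ∀ z ∈ R, z ∉ x :: L.flatten) : R.length ≤ M.length := by
  classical
  have hp := List.perm_cons_erase hl
  obtain ⟨l', hl'⟩ : ∃ l', x :: l' = P ++ a :: (R ++ b :: S) := by
    cases P with
    | nil =>
      refine ⟨R ++ b :: S, ?_⟩
      simp_all
    | cons y P =>
      refine ⟨P ++ a :: (R ++ b :: S), ?_⟩
      simp_all
  have hnew := (hL.perm hp).reroute hsplit hl' hR hchain hRT
    (fun z hz hmem => hRL z hz (((hp.flatten).cons x).mem_iff.2 hmem))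
  have h1 := hmax _ hnew (by rw [hp.length_eq]; simp)
  rw [hp.flatten.length_eq] at h1
  have h2 := congrArg List.length hsplit
  have h3 := congrArg List.length hl'
  simp at h1 h2 h3
  omega

theorem IsFan.length_le_of_maximal_of_mem {x v : V} {L Q : List (List V)} (hx : x ∉ T)
    (hv : v ∉ T) (hL : IsFan G T x L)
    (hmax : ∀ L', IsFan G T x L' → L.length ≤ L'.length → L'.flatten.length ≤ L.flatten.length)
    (hvL : v ∉ x :: L.flatten) (hQ : IsFan G (T ∪ {z | z ∈ x :: L.flatten}) v Q)
    (hQ2 : 2 ≤ Q.length) (hxQ : ∃ l ∈ Q, l.getLast? = some x) :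
    Q.flatten.length ≤ L.flatten.length := by
  classical
  have hv' : v ∉ T ∪ {z | z ∈ x :: L.flatten} := by
    rintro (h | h)
    exacts [hv h, hvL h]
  have hQnd : Q.flatten.Nodup := (List.nodup_cons.1 hQ.1).2
  have hlast : ∀ l ∈ Q, ∃ m z, l = m ++ [z] ∧ z ∈ T ∪ {z | z ∈ x :: L.flatten} := by
    intro l hl
    obtain ⟨m, z, h1, h2, -⟩ := (hQ.2 l hl).eq_concat hv'
    exact ⟨m, z, h1, h2⟩
  obtain ⟨lx, hlx, hlxlast⟩ := hxQ
  have hfeet : ∀ l ∈ Q, ∃ z ∈ x :: L.flatten, l.getLast? = some z := by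
    intro l hl
    obtain ⟨m, z, rfl, hz⟩ := hlast l hl
    refine ⟨z, ?_, by simp⟩
    by_contra hzL
    have hzT : z ∈ T := hz.resolve_right hzL
    have hxz : x ≠ z := by
      rintro rfl
      exact hx hzT
    obtain ⟨R, hRnd, hRc, hRT, -⟩ :=
      hQ.exists_connection hv' hlx hl hlxlast (by simp) hxz
    have hzR : z ∉ R := fun h => hRT z h hz
    have hnew : IsFan G T x ((R ++ [z]) :: L) := by
      refine hL.cons ⟨hRc, z, hzT, by simp [List.getLast?_cons], ?_⟩ ?_ ?_ ?_
      · intro a ha haT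
        simp only [List.mem_cons, List.mem_append, List.not_mem_nil, or_false] at ha
        rcases ha with rfl | ha | rfl
        · exact absurd haT hx
        · exact absurd (Or.inl haT) (hRT a ha)
        · rfl
      · simp only [List.nodup_append, List.nodup_cons]
        grind
      · simp only [List.mem_append, List.mem_singleton, not_or]
        exact ⟨fun h => hRT x h (Or.inr (by simp)), hxz⟩
      · intro a ha haL
        rcases List.mem_append.1 ha with ha | ha
        · exact hRT a ha (Or.inr (List.mem_cons_of_mem _ haL))
        · rw [List.mem_singleton.1 ha] at haL
          exact hzL (List.mem_cons_of_mem _ haL)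
    have := hmax _ hnew (by simp)
    simp at this
    omega
  have hxpos : 0 < footWeight Q x := by
    refine lt_of_lt_of_le ?_ (length_le_footWeight hlx hlxlast)
    exact List.length_pos_of_mem (List.mem_of_getLast? hlxlast)
  have hgap : ∀ l ∈ L, (l.map (footWeight Q)).sum = 0 ∨
      footWeight Q x + (l.map (footWeight Q)).sum ≤ l.length := by
    intro l hl
    refine sum_le_length_of_gaps _ _ x l le_rfl hxpos ?_
    intro P a M b S hsplit ha hb
    obtain ⟨la, hla, hlasta, hlena⟩ := exists_mem_of_footWeight_pos hQnd ha
    obtain ⟨lb, hlb, hlastb, hlenb⟩ := exists_mem_of_footWeight_pos hQnd hb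
    have hab : a ≠ b := by
      have : (x :: l).Nodup := hL.1.sublist ((List.sublist_flatten_of_mem hl).cons_cons x)
      rw [hsplit] at this
      simp only [List.nodup_append, List.nodup_cons] at this
      grind
    obtain ⟨R, hRnd, hRc, hRT, hRlen⟩ := hQ.exists_connection hv' hla hlb hlasta hlastb hab
    have := hL.gap_le_of_maximal hmax hl hsplit hRnd hRc (fun z hz h => hRT z hz (Or.inl h))
      (fun z hz h => hRT z hz (Or.inr h))
    omega
  obtain ⟨l₀, hl₀, hl₀sum⟩ : ∃ l ∈ L, (l.map (footWeight Q)).sum ≠ 0 := by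
    obtain ⟨l, hl, hlne⟩ : ∃ l ∈ Q, l.getLast? ≠ some x := by
      by_contra! hall
      match Q, hQ2 with
      | l :: l' :: Q, _ =>
        have h1 := List.mem_of_getLast? (hall l (by simp))
        have h2 := List.mem_of_getLast? (hall l' (by simp))
        simp only [List.flatten_cons, List.nodup_append, List.mem_append] at hQnd
        exact hQnd.2.2 x h1 x (Or.inl h2) rfl
    obtain ⟨z, hz, hzl⟩ := hfeet l hl
    have hzx : z ≠ x := by
      rintro rfl
      exact hlne hzl
    obtain ⟨l₀, hl₀, hzl₀⟩ := List.mem_flatten.1 ((List.mem_cons.1 hz).resolve_left hzx)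
    refine ⟨l₀, hl₀, fun h0 => ?_⟩
    have h1 := List.sum_eq_zero_iff.1 h0 _ (List.mem_map_of_mem hzl₀)
    have h2 := length_le_footWeight hl hzl
    have h3 := List.length_pos_of_mem (List.mem_of_getLast? hzl)
    omega
  have hsum := length_flatten_le_sum_footWeight hfeet
  have hp := List.perm_cons_erase hl₀
  have hrest : (((L.erase l₀).flatten).map (footWeight Q)).sum ≤ (L.erase l₀).flatten.length := by
    rw [List.map_flatten, List.sum_flatten, List.length_flatten, List.map_map]
    refine List.sum_le_sum fun l hl => ?_
    have := hgap l (List.mem_of_mem_erase hl)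
    simp only [Function.comp]
    omega
  have h0 := (hgap l₀ hl₀).resolve_left hl₀sum
  rw [List.map_cons, List.sum_cons, (hp.flatten.map _).sum_eq] at hsum
  rw [hp.flatten.length_eq]
  simp only [List.flatten_cons, List.map_append, List.sum_append, List.length_append] at hsum ⊢
  omega

theorem IsFan.length_le_of_maximal {x v : V} {L Q : List (List V)} (hx : x ∉ T)
    (hv : v ∉ T) (hL : IsFan G T x L)
    (hmax : ∀ L', IsFan G T x L' → L.length ≤ L'.length → L'.flatten.length ≤ L.flatten.length)
    (hvx : G.Adj v x) (hvL : v ∉ x :: L.flatten)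
    (hQ : IsFan G (T ∪ {z | z ∈ x :: L.flatten}) v Q) (hQ2 : 2 ≤ Q.length) :
    Q.flatten.length ≤ L.flatten.length := by
  by_cases hxQ : ∃ l ∈ Q, l.getLast? = some x
  · exact hL.length_le_of_maximal_of_mem hx hv hmax hvL hQ hQ2 hxQ
  have hv' : v ∉ T ∪ {z | z ∈ x :: L.flatten} := by
    rintro (h | h)
    exacts [hv h, hvL h]
  have hx' : x ∈ T ∪ {z | z ∈ x :: L.flatten} := Or.inr (by simp)
  have hnew := hQ.cons (isLeg_singleton hv' hx' hvx) (by simp) (by simpa using hvx.ne) (by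
    intro z hz hzQ
    rw [List.mem_singleton.1 hz] at hzQ
    obtain ⟨l, hl, hxl⟩ := List.mem_flatten.1 hzQ
    obtain ⟨m, y, rfl, -, honly, -⟩ := (hQ.2 l hl).eq_concat hv'
    refine hxQ ⟨_, hl, ?_⟩
    rcases List.mem_append.1 hxl with h | h
    · simp [honly x (by simp [h]) hx']
    · simp_all)
  have := hL.length_le_of_maximal_of_mem hx hv hmax hvL hnew (by simp; omega) ⟨[x], by simp, by simp⟩
  simp at this ⊢
  omega

theorem exists_isFan_length_ge [Fintype V] [DecidableRel G.Adj] (d : ℕ) (H : Finset V) :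
    ∀ T : Set V, (∀ v ∈ H, v ∉ T) → (∀ v ∈ H, ∀ w, G.Adj v w → w ∈ H ∨ w ∈ T) →
    T.Nonempty →
    (∀ v ∈ H, ∀ c, c ≠ v → ∃ l, IsLeg G T v l ∧ (v :: l).Nodup ∧ c ∉ l) →
    (∀ v ∈ H, d ≤ G.degree v) →
    ∀ x ∈ H, ∃ L, IsFan G T x L ∧ 2 ≤ L.length ∧ d ≤ L.flatten.length := by
  classical
  induction H using Finset.strongInduction with
  | H H ih =>
  intro T hHT hN hT hsep hdeg x hx
  have hxT := hHT x hx
  let A : Set ℕ := {n | ∃ L, IsFan G T x L ∧ 2 ≤ L.length ∧ L.flatten.length = n}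
  have hAne : A.Nonempty := by
    obtain ⟨t, ht⟩ := hT
    obtain ⟨l, hl, -⟩ := hsep x hx t (fun h => hxT (h ▸ ht))
    obtain ⟨m, y, rfl, hy, -, hc⟩ := hl.eq_concat hxT
    obtain ⟨p, q, hpq⟩ := exists_isFan_pair (H := (H : Set V)) hHT hN hsep _ x hx hc
      ⟨y, by simp, hy⟩
    exact ⟨_, _, hpq, by simp, rfl⟩
  have hAbdd : BddAbove A := by
    refine ⟨Fintype.card V, ?_⟩
    rintro n ⟨L, hL, -, rfl⟩
    exact (List.nodup_cons.1 hL.1).2.length_le_card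
  obtain ⟨L, hL, hL2, hLlen⟩ := Nat.sSup_mem hAne hAbdd
  have hmax : ∀ L', IsFan G T x L' → L.length ≤ L'.length →
      L'.flatten.length ≤ L.flatten.length := fun L' hL' hle => by
    rw [hLlen]
    exact le_csSup hAbdd ⟨L', hL', hL2.trans hle, rfl⟩
  refine ⟨L, hL, hL2, ?_⟩
  by_cases hnbr : ∀ w, G.Adj x w → w ∈ L.flatten
  · calc d ≤ G.degree x := hdeg x hx
      _ = (G.neighborFinset x).card := rfl
      _ ≤ L.flatten.toFinset.card := Finset.card_le_card fun w hw => by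
        simpa using hnbr w (by simpa using hw)
      _ ≤ L.flatten.length := List.toFinset_card_le _
  push Not at hnbr
  obtain ⟨v, hxv, hvL⟩ := hnbr
  have hvT : v ∉ T := by
    intro hvT
    have := hmax _ (hL.cons (isLeg_singleton hxT hvT hxv) (by simp) (by simpa using hxv.ne)
      (by simpa using hvL)) (by simp)
    simp at this
  have hvH := (hN x hx v hxv).resolve_right hvT
  have hvL' : v ∉ x :: L.flatten := by
    simp only [List.mem_cons, not_or]
    exact ⟨hxv.ne', hvL⟩
  have hsub : ∀ w, w ∈ H.filter (fun w => w ∉ x :: L.flatten) ↔ w ∈ H ∧ w ∉ x :: L.flatten := by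
    simp
  obtain ⟨Q, hQ, hQ2, hQd⟩ := ih (H.filter (fun w => w ∉ x :: L.flatten))
    (Finset.filter_ssubset.2 ⟨x, hx, by simp⟩) (T ∪ {z | z ∈ x :: L.flatten})
    (by
      rintro w hw (h | h)
      exacts [hHT w ((hsub w).1 hw).1 h, ((hsub w).1 hw).2 h])
    (by
      intro w hw u huw
      by_cases hu : u ∈ x :: L.flatten
      · exact Or.inr (Or.inr hu)
      · rcases hN w ((hsub w).1 hw).1 u huw with h | h
        · exact Or.inl ((hsub u).2 ⟨h, hu⟩)
        · exact Or.inr (Or.inl h))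
    hT.inl
    (by
      intro w hw c hc
      obtain ⟨hwH, hwL⟩ := (hsub w).1 hw
      obtain ⟨l, hl, hnd, hcl⟩ := hsep w hwH c hc
      obtain ⟨m, y, rfl, hy, -, hc⟩ := hl.eq_concat (hHT w hwH)
      obtain ⟨l', hpre, hl'⟩ := IsLeg.exists_truncation (T := T ∪ {z | z ∈ x :: L.flatten})
        (by
          rintro (h | h)
          exacts [hHT w hwH h, hwL h]) hc ⟨y, by simp, Or.inl hy⟩
      exact ⟨l', hl', hnd.sublist (hpre.sublist.cons_cons w), fun h => hcl (hpre.subset h)⟩)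
    (fun w hw => hdeg w ((hsub w).1 hw).1) v ((hsub v).2 ⟨hvH, hvL'⟩)
  exact hQd.trans (hL.length_le_of_maximal hxT hvT hmax hxv.symm hvL' hQ hQ2)

theorem IsLeg.exists_walk {x : V} {l : List V} (h : IsLeg G T x l) :
    ∃ (y : V) (p : G.Walk x y), p.support = x :: l ∧ y ∈ T ∧ ∀ z ∈ x :: l, z ∈ T → z = y := by
  obtain ⟨hc, y, hy, hlast, honly⟩ := h
  obtain rfl : (x :: l).getLast (by simp) = y := by
    rwa [List.getLast?_eq_some_getLast (by simp), Option.some_inj] at hlast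
  exact ⟨_, SimpleGraph.Walk.ofSupport (x :: l) (by simp) hc,
    SimpleGraph.Walk.support_ofSupport _ _, hy, honly⟩

theorem exists_isLeg_avoiding {v c t : V} (hv : v ∉ T) (ht : t ∈ T) (hvc : v ≠ c) (htc : t ≠ c)
    (h : (G.induce {u : V | u ≠ c}).Connected) :
    ∃ l, IsLeg G T v l ∧ (v :: l).Nodup ∧ c ∉ l := by
  classical
  obtain ⟨p, hp⟩ := (h.preconnected ⟨v, hvc⟩ ⟨t, htc⟩).exists_isPath
  let f : G.induce {u : V | u ≠ c} →g G := (SimpleGraph.Embedding.induce _).toHom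
  let w : G.Walk v t := p.map f
  have hw : w.IsPath := hp.map Subtype.val_injective
  have hcw : c ∉ w.support := by
    intro hc
    have hc' : c ∈ (p.map f).support := hc
    rw [SimpleGraph.Walk.support_map] at hc'
    obtain ⟨a, -, ha⟩ := List.mem_map.1 hc'
    exact a.2 ha
  have hvt : t ≠ v := by
    rintro rfl
    exact hv ht
  have htw := w.end_mem_support
  have hwc := w.isChain_adj_support
  have hnd := hw.support_nodup
  rw [← w.cons_tail_support] at hcw htw hwc hnd
  obtain ⟨l', hpre, hl'⟩ := IsLeg.exists_truncation hv hwc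
    ⟨t, (List.mem_cons.1 htw).resolve_left hvt, ht⟩
  exact ⟨l', hl', hnd.sublist (hpre.sublist.cons_cons v),
    fun h => hcw (List.mem_cons_of_mem _ (hpre.subset h))⟩

end Fan


/-- **Lemma (Fujisawa–Yoshimoto–Zhang, fan version).** Let `G` be a 2-connected graph, `C` a
longest cycle of `G`, and `H` a connected component of `G - V(C)`. If `d(v) ≥ d` for every
`v ∈ H`, then for every `x ∈ H` there is an `(x,C)`-fan with at least `d` edges: `k ≥ 2`
paths `P i` from `x` to vertices `y i ∈ V(C)`, each meeting `C` only in `y i`, pairwise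
meeting only in `x`, with total number of edges at least `d`. -/
theorem stmt_16 {V : Type} [Fintype V] [DecidableEq V]
    (G : SimpleGraph V) [DecidableRel G.Adj]
    (h2conn : 3 ≤ Fintype.card V ∧ G.Connected ∧
      ∀ v : V, (G.induce {u : V | u ≠ v}).Connected)
    (v₀ : V) (C : G.Walk v₀ v₀) (hC : C.IsCycle)
    (hlongest : ∀ (u : V) (w : G.Walk u u), w.IsCycle → w.length ≤ C.length)
    (H : Set V)
    (hHoff : ∀ v ∈ H, v ∉ C.support)
    (hHconn : (G.induce H).Connected)
    (hHmax : ∀ u ∈ H, ∀ v : V, v ∉ C.support → G.Adj u v → v ∈ H)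
    (d : ℕ) (hdeg : ∀ v ∈ H, d ≤ G.degree v)
    (x : V) (hx : x ∈ H) :
    ∃ (k : ℕ), 2 ≤ k ∧
      ∃ (y : Fin k → V) (P : ∀ i : Fin k, G.Walk x (y i)),
        (∀ i, (P i).IsPath) ∧
        (∀ i, y i ∈ C.support) ∧
        (∀ i, ∀ z ∈ (P i).support, z ∈ C.support → z = y i) ∧
        (∀ i j, i ≠ j → ∀ z : V, z ∈ (P i).support → z ∈ (P j).support → z = x) ∧
        d ≤ ∑ i, (P i).length := by
  classical
  have hsep : ∀ v ∈ H, ∀ c, c ≠ v →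
      ∃ l, IsLeg G {z | z ∈ C.support} v l ∧ (v :: l).Nodup ∧ c ∉ l := by
    intro v hv c hcv
    obtain ⟨t, ht, htc⟩ : ∃ t ∈ C.support, t ≠ c := by
      by_cases hc : v₀ = c
      · have hadj := C.adj_snd hC.not_nil
        exact ⟨C.snd, C.getVert_mem_support 1, fun h => hadj.ne (hc.trans h.symm)⟩
      · exact ⟨v₀, C.start_mem_support, hc⟩
    exact exists_isLeg_avoiding (hHoff v hv) ht hcv.symm htc (h2conn.2.2 c)
  obtain ⟨L, hL, hL2, hLd⟩ := exists_isFan_length_ge (G := G) d H.toFinset {z | z ∈ C.support}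
    (by simpa using hHoff)
    (by
      intro v hv w hvw
      by_cases hw : w ∈ C.support
      · exact Or.inr hw
      · exact Or.inl (by simpa using hHmax v (by simpa using hv) w hw hvw))
    ⟨v₀, C.start_mem_support⟩ (by simpa using hsep) (by simpa using hdeg) x (by simpa using hx)
  choose y P hsupp hyT honly using fun i : Fin L.length =>
    (hL.2 L[i] (List.getElem_mem _)).exists_walk
  obtain ⟨hxL, hnd⟩ := List.nodup_cons.1 hL.1
  obtain ⟨hleg, hdisj⟩ := List.nodup_flatten.1 hnd
  refine ⟨L.length, hL2, y, P, ?_, hyT, ?_, ?_, ?_⟩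
  · intro i
    rw [SimpleGraph.Walk.isPath_def, hsupp, List.nodup_cons]
    exact ⟨fun h => hxL (List.mem_flatten.2 ⟨_, List.getElem_mem _, h⟩),
      hleg _ (List.getElem_mem _)⟩
  · intro i z hz
    rw [hsupp] at hz
    exact honly i z hz
  · intro i j hij z hzi hzj
    rw [hsupp] at hzi hzj
    by_contra hzx
    have hzi := (List.mem_cons.1 hzi).resolve_left hzx
    have hzj := (List.mem_cons.1 hzj).resolve_left hzx
    rw [List.pairwise_iff_getElem] at hdisj
    rcases lt_or_gt_of_ne hij with h | h
    · exact hdisj i j i.2 j.2 h hzi hzj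
    · exact hdisj j i j.2 i.2 h hzj hzi
  · have hlen : ∀ i, (P i).length = L[i].length := by
      intro i
      have := (P i).length_support
      rw [hsupp] at this
      simpa using this.symm
    calc d ≤ (L.map List.length).sum := by rwa [← List.length_flatten]
      _ = ∑ i : Fin L.length, L[i].length := by
        rw [← Fin.sum_univ_fun_getElem]
        rfl
      _ = ∑ i, (P i).length := by simp only [hlen]
end

section
/- Let G=(X,Y;E) be a 2-connected bipartite graph and let P be a maximal path in G with end-vertices u and v. (i) If u ∈ X and v ∈ Y, then G contains a cycle of length at least min{|V(P)|, 2(d(u)+d(v)−1)}. (ii) If u, v ∈ X, then G contains a cycle of length at least min{|V(P)|−1, 2(d(u)+d(v)−2)}. -/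
namespace SimpleGraph

variable {V : Type*} {G : SimpleGraph V}

namespace Walk

theorem IsPath.append_of_inter {u v w : V} {p : G.Walk u v} {q : G.Walk v w} (hp : p.IsPath)
    (hq : q.IsPath) (h : ∀ z ∈ p.support, z ∈ q.support → z = v) : (p.append q).IsPath := by
  rw [isPath_def, support_append, List.nodup_append']
  refine ⟨hp.support_nodup, hq.support_nodup.tail, fun z hz hz' => ?_⟩
  obtain rfl := h z hz (List.mem_of_mem_tail hz')
  have hn := hq.support_nodup
  rw [← cons_tail_support] at hn
  exact (List.nodup_cons.1 hn).1 hz'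

theorem exists_isCycle_of_inter {u v : V} {p q : G.Walk u v} (hp : p.IsPath) (hq : q.IsPath)
    (h : ∀ z ∈ p.support, z ∈ q.support → z = u ∨ z = v) (hn : 1 < p.length ∨ 1 < q.length) :
    ∃ (a : V) (w : G.Walk a a), w.IsCycle ∧ w.length = p.length + q.length := by
  refine ⟨u, p.append q.reverse, hp.isCycle_append hq.reverse (fun z hz hz' => ?_) (by simpa),
    by simp⟩
  have hpn := hp.support_nodup
  have hqn := hq.reverse.support_nodup
  rw [← cons_tail_support] at hpn hqn
  have hzq : z ∈ q.support := by simpa using List.mem_of_mem_tail hz'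
  rcases h z (List.mem_of_mem_tail hz) hzq with rfl | rfl
  · exact (List.nodup_cons.1 hpn).1 hz
  · exact (List.nodup_cons.1 hqn).1 hz'

theorem exists_isPath_between {S T : Set V} {a b : V} (p : G.Walk a b) (ha : a ∈ S) (hb : b ∈ T) :
    ∃ (w z : V) (q : G.Walk w z), q.IsPath ∧ w ∈ S ∧ z ∈ T ∧ q.support ⊆ p.support ∧
      (∀ x ∈ q.support, x ∈ S → x = w) ∧ ∀ x ∈ q.support, x ∈ T → x = z := by
  classical
  induction hl : p.length using Nat.strong_induction_on generalizing a b with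
  | _ n ih =>
    by_cases h₁ : ∃ x ∈ p.support, x ∈ S ∧ x ≠ a
    · obtain ⟨x, hx, hxS, hxa⟩ := h₁
      obtain ⟨w, z, q, hq, hw, hz, hs, h⟩ :=
        ih _ (hl ▸ length_dropUntil_lt_length hx hxa) (p.dropUntil x hx) hxS hb rfl
      exact ⟨w, z, q, hq, hw, hz, fun _ hy => support_dropUntil_subset_support p hx (hs hy), h⟩
    by_cases h₂ : ∃ x ∈ p.support, x ∈ T ∧ x ≠ b
    · obtain ⟨x, hx, hxT, hxb⟩ := h₂
      obtain ⟨w, z, q, hq, hw, hz, hs, h⟩ :=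
        ih _ (hl ▸ length_takeUntil_lt_length hx hxb) (p.takeUntil x hx) ha hxT rfl
      exact ⟨w, z, q, hq, hw, hz, fun _ hy => support_takeUntil_subset_support p hx (hs hy), h⟩
    push Not at h₁ h₂
    have hs := support_bypass_subset_support p
    exact ⟨a, b, p.bypass, p.bypass_isPath, ha, hb, hs, fun x hx => h₁ x (hs hx),
      fun x hx => h₂ x (hs hx)⟩

theorem two_mul_card_le_length_add_two {u v : V} (p : G.Walk u v) (S : Finset V)
    (hS : ∀ x ∈ S, ∀ y ∈ S, ¬G.Adj x y) (hp : ∀ x ∈ S, x ∈ p.support) :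
    2 * S.card ≤ p.length + 2 := by
  classical
  have key : ∀ {a b : V} (q : G.Walk a b),
      2 * (q.support.filter (· ∈ S)).length ≤ q.length + (if a ∈ S then 2 else 1) := by
    intro a b q
    induction q with
    | nil => simp only [support_nil, List.filter_cons]; split_ifs <;> simp_all
    | @cons a b c h q ih =>
      simp only [support_cons, List.filter_cons, length_cons]
      by_cases ha : a ∈ S
      · have hb : b ∉ S := fun hb => hS a ha b hb h
        simp only [ha, hb] at ih ⊢
        simp at ih ⊢
        omega
      · simp only [ha] at ih ⊢
        simp at ih ⊢
        split_ifs at ih <;> omega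
  have h₁ : S ⊆ (p.support.filter (· ∈ S)).toFinset := fun x hx => by simp [hx, hp x hx]
  have h₂ := (Finset.card_le_card h₁).trans (List.toFinset_card_le _)
  have h₃ := key p
  split_ifs at h₃ <;> omega

theorem mem_support_take_iff {u v z : V} (p : G.Walk u v) {n : ℕ} (hn : n ≤ p.length) :
    z ∈ (p.take n).support ↔ ∃ k ≤ n, p.getVert k = z := by
  simp only [mem_support_iff_exists_getVert, take_getVert, take_length]
  constructor
  · rintro ⟨k, hk, hk'⟩
    exact ⟨n ⊓ k, by omega, hk⟩
  · rintro ⟨k, hk, hk'⟩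
    exact ⟨k, by rwa [min_eq_right hk], by omega⟩

theorem mem_support_drop_iff {u v z : V} (p : G.Walk u v) {n : ℕ} (hn : n ≤ p.length) :
    z ∈ (p.drop n).support ↔ ∃ k, n ≤ k ∧ k ≤ p.length ∧ p.getVert k = z := by
  simp only [mem_support_iff_exists_getVert, drop_getVert, drop_length]
  constructor
  · rintro ⟨k, hk, hk'⟩
    exact ⟨n + k, by omega, by omega, hk⟩
  · rintro ⟨k, hk, hk', h⟩
    exact ⟨k - n, by rwa [Nat.add_sub_cancel' hk], by omega⟩

/-- If `u` is adjacent to the last vertex `s` of a path `p` starting at `u`, then any other vertex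
`w` of `p` is joined to `s` by a path inside `p` that covers every neighbour of `u` on `p`. -/
theorem IsPath.exists_isPath_covering {u s w : V} {p : G.Walk u s} (hp : p.IsPath)
    (hus : G.Adj u s) (hw : w ∈ p.support) (hws : w ≠ s) :
    ∃ q : G.Walk w s, q.IsPath ∧ q.support ⊆ p.support ∧
      ∀ z ∈ p.support, G.Adj u z → z ∈ q.support := by
  classical
  obtain ⟨a, rfl, ha⟩ := mem_support_iff_exists_getVert.1 hw
  have ha' : a < p.length := lt_of_le_of_ne ha (by rintro rfl; simp at hws)
  have hex : ∃ y, a < y ∧ y ≤ p.length ∧ G.Adj u (p.getVert y) :=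
    ⟨p.length, ha', le_rfl, by simpa using hus⟩
  obtain ⟨hy₁, hy₂, hy₃⟩ := Nat.find_spec hex
  set y := Nat.find hex with hy
  have inj := hp.getVert_injOn
  refine ⟨(p.take a).reverse.append (cons hy₃ (p.drop y)), ?_, ?_, ?_⟩
  · refine (hp.take a).reverse.append_of_inter ((hp.drop y).cons ?_) ?_
    · rw [mem_support_drop_iff p hy₂]
      rintro ⟨k, hk, hk', h⟩
      have := inj (x₁ := k) (x₂ := 0) hk' (Nat.zero_le _) (by simpa using h)
      omega
    · intro z hz hz'
      rw [support_reverse, List.mem_reverse, mem_support_take_iff p ha] at hz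
      rw [support_cons, List.mem_cons, mem_support_drop_iff p hy₂] at hz'
      obtain ⟨k, hk, rfl⟩ := hz
      rcases hz' with h | ⟨l, hl, hl', h⟩
      · exact h
      · have := inj (x₁ := l) (x₂ := k) hl' (hk.trans ha) h
        omega
  · intro z hz
    rw [mem_support_append_iff, support_reverse, List.mem_reverse, support_cons, List.mem_cons]
      at hz
    rcases hz with hz | rfl | hz
    · exact (isSubwalk_take p a).support_subset hz
    · exact start_mem_support _
    · exact (isSubwalk_drop p y).support_subset hz
  · intro z hz huz
    obtain ⟨k, rfl, hk⟩ := mem_support_iff_exists_getVert.1 hz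
    rw [mem_support_append_iff, support_reverse, List.mem_reverse, support_cons, List.mem_cons,
      mem_support_take_iff p ha, mem_support_drop_iff p hy₂]
    by_cases hka : k ≤ a
    · exact .inl ⟨k, hka, rfl⟩
    · exact .inr (.inr ⟨k, Nat.find_min' hex ⟨by omega, hk, huz⟩, hk, rfl⟩)

end Walk

theorem exists_isPath_avoiding {d : V} (hd : (G.induce {x : V | x ≠ d}).Preconnected)
    {S T : Set V} (hS : ∃ a ∈ S, a ≠ d) (hT : ∃ b ∈ T, b ≠ d) :
    ∃ (w z : V) (q : G.Walk w z), q.IsPath ∧ w ∈ S ∧ z ∈ T ∧ d ∉ q.support ∧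
      (∀ x ∈ q.support, x ∈ S → x = w) ∧ ∀ x ∈ q.support, x ∈ T → x = z := by
  obtain ⟨a, ha, had⟩ := hS
  obtain ⟨b, hb, hbd⟩ := hT
  obtain ⟨r⟩ := hd ⟨a, had⟩ ⟨b, hbd⟩
  obtain ⟨w, z, q, hq, hw, hz, hs, h⟩ :=
    (r.map (Embedding.induce _).toHom).exists_isPath_between (S := S) (T := T) ha hb
  refine ⟨w, z, q, hq, hw, hz, fun hdq => ?_, h⟩
  have := hs hdq
  rw [Walk.support_map, List.mem_map] at this
  obtain ⟨x, -, hx⟩ := this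
  exact x.2 hx


/-- Two disjoint paths from the initial segment of `P` ending at index `s` to the final segment
starting at index `c`, such that index `s` and index `c` are among their ends. -/
theorem Walk.IsPath.exists_linkage {u v : V} {P : G.Walk u v} (hP : P.IsPath)
    (hG : ∀ d : V, (G.induce {x : V | x ≠ d}).Preconnected) {s c : ℕ} (hs : 0 < s) (hsc : s ≤ c)
    (hc : c < P.length) :
    ∃ (k j b : ℕ) (K : G.Walk (P.getVert k) (P.getVert c)) (J : G.Walk (P.getVert j) (P.getVert b)),
      K.IsPath ∧ J.IsPath ∧ (∀ x ∈ K.support, x ∉ J.support) ∧ k ≤ s ∧ j ≤ s ∧ (k = s ∨ j = s) ∧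
      c < b ∧ b ≤ P.length ∧
      (∀ n ≤ s, P.getVert n ∈ K.support → n = k) ∧ (∀ n ≤ s, P.getVert n ∈ J.support → n = j) ∧
      (∀ n, c ≤ n → n ≤ P.length → P.getVert n ∈ K.support → n = c) ∧
      ∀ n, c ≤ n → n ≤ P.length → P.getVert n ∈ J.support → n = b := by
  classical
  have inj : ∀ m n, m ≤ P.length → n ≤ P.length → P.getVert m = P.getVert n → m = n :=
    fun m n hm hn h => hP.getVert_injOn hm hn h
  induction c, hsc using Nat.le_induction with
  | base =>
    obtain ⟨w, z, Q, hQ, ⟨j, hj, rfl⟩, ⟨b, hb, hbl, rfl⟩, hd, hQS, hQT⟩ :=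
      exists_isPath_avoiding (hG (P.getVert s)) (S := {x | ∃ n, n < s ∧ P.getVert n = x})
        (T := {x | ∃ n, s < n ∧ n ≤ P.length ∧ P.getVert n = x})
        ⟨_, ⟨0, hs, rfl⟩, fun h => by have := inj _ _ (by omega) (by omega) h; omega⟩
        ⟨_, ⟨s + 1, by omega, by omega, rfl⟩,
          fun h => by have := inj _ _ (by omega) (by omega) h; omega⟩
    refine ⟨s, j, b, .nil, Q, .nil, hQ, by simpa using hd, le_rfl, hj.le, .inl rfl, hb, hbl,
      fun n hn h => inj _ _ (by omega) (by omega) (by simpa using h), fun n hn h => ?_,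
      fun n hn hn' h => inj _ _ (by omega) (by omega) (by simpa using h), fun n hn hn' h => ?_⟩
    · have : n ≠ s := by rintro rfl; exact hd h
      exact inj _ _ (by omega) (by omega) (hQS _ h ⟨n, by omega, rfl⟩)
    · have : n ≠ s := by rintro rfl; exact hd h
      exact inj _ _ (by omega) (by omega) (hQT _ h ⟨n, by omega, by omega, rfl⟩)
  | succ c hsc ih =>
    obtain ⟨k, j, b, K, J, hK, hJ, hKJ, hk, hj, hkj, hcb, hb, hKA, hJA, hKB, hJB⟩ := ih (by omega)
    have hadj : G.Adj (P.getVert c) (P.getVert (c + 1)) := P.adj_getVert_succ (by omega)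
    have hdK : P.getVert (c + 1) ∉ K.support := fun h => by
      have := hKB _ (by omega) (by omega) h
      omega
    have hKc : (K.concat hadj).IsPath := hK.concat hdK hadj
    have hmemKc : ∀ x, x ∈ (K.concat hadj).support ↔ x ∈ K.support ∨ x = P.getVert (c + 1) := by
      simp [support_concat]
    have hKcA : ∀ n ≤ s, P.getVert n ∈ (K.concat hadj).support → n = k := fun n hn h => by
      rcases (hmemKc _).1 h with h | h
      · exact hKA n hn h
      · have := inj _ _ (by omega) (by omega) h
        omega
    have hKcB : ∀ n, c + 1 ≤ n → n ≤ P.length → P.getVert n ∈ (K.concat hadj).support →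
        n = c + 1 := fun n hn hn' h => by
      rcases (hmemKc _).1 h with h | h
      · have := hKB n (by omega) hn' h
        omega
      · exact inj _ _ (by omega) (by omega) h
    by_cases hbc : b = c + 1
    · subst hbc
      obtain ⟨w, z, Q, hQ, hw, ⟨e, he, hel, rfl⟩, hd, hQS, hQT⟩ :=
        exists_isPath_avoiding (hG (P.getVert (c + 1)))
          (S := {x | x ∈ K.support ∨ x ∈ J.support ∨ ∃ n, n ≤ s ∧ P.getVert n = x})
          (T := {x | ∃ n, c + 1 < n ∧ n ≤ P.length ∧ P.getVert n = x})
          ⟨_, .inr (.inr ⟨0, hs.le, rfl⟩),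
            fun h => by have := inj _ _ (by omega) (by omega) h; omega⟩
          ⟨_, ⟨c + 2, by omega, by omega, rfl⟩,
            fun h => by have := inj _ _ (by omega) (by omega) h; omega⟩
      have hwd : P.getVert (c + 1) ≠ w := by rintro rfl; exact hd Q.start_mem_support
      have hQB : ∀ n, c + 1 ≤ n → n ≤ P.length → P.getVert n ∈ Q.support → n = e :=
        fun n hn hn' h => by
          have : n ≠ c + 1 := by rintro rfl; exact hd h
          exact inj _ _ (by omega) (by omega) (hQT _ h ⟨n, by omega, by omega, rfl⟩)
      by_cases hwK : w ∈ K.support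
      · have hsub := support_takeUntil_subset_support K hwK
        refine ⟨j, k, e, J, (K.takeUntil w hwK).append Q, hJ,
          (hK.takeUntil hwK).append_of_inter hQ fun x hx hx' => hQS x hx' (.inl (hsub hx)),
          ?_, hj, hk, hkj.symm, he, hel, hJA, ?_, fun n hn => hJB n (by omega), ?_⟩ <;>
        simp only [mem_support_append_iff]
        · rintro x hx (hx' | hx')
          · exact hKJ x (hsub hx') hx
          · exact hKJ x (hQS x hx' (.inr (.inl hx)) ▸ hwK) hx
        · rintro n hn (h | h)
          · exact hKA n hn (hsub h)
          · exact hKA n hn (hQS _ h (.inr (.inr ⟨n, hn, rfl⟩)) ▸ hwK)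
        · rintro n hn hn' (h | h)
          · have := hKB n (by omega) hn' (hsub h)
            omega
          · exact hQB n hn hn' h
      by_cases hwJ : w ∈ J.support
      · have hsub := support_takeUntil_subset_support J hwJ
        have hdJ := endpoint_notMem_support_takeUntil hJ hwJ hwd
        refine ⟨k, j, e, K.concat hadj, (J.takeUntil w hwJ).append Q, hKc,
          (hJ.takeUntil hwJ).append_of_inter hQ fun x hx hx' => hQS x hx' (.inr (.inl (hsub hx))),
          ?_, hk, hj, hkj, he, hel, hKcA, ?_, hKcB, ?_⟩ <;>
        simp only [mem_support_append_iff, hmemKc]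
        · rintro x (hx | rfl) (hx' | hx')
          · exact hKJ x hx (hsub hx')
          · exact hKJ x hx (hQS x hx' (.inl hx) ▸ hwJ)
          · exact hdJ hx'
          · exact hd hx'
        · rintro n hn (h | h)
          · exact hJA n hn (hsub h)
          · exact hJA n hn (hQS _ h (.inr (.inr ⟨n, hn, rfl⟩)) ▸ hwJ)
        · rintro n hn hn' (h | h)
          · have := hJB n (by omega) hn' (hsub h)
            subst this
            exact absurd h hdJ
          · exact hQB n hn hn' h
      obtain ⟨m, hm, rfl⟩ := (hw.resolve_left hwK).resolve_left hwJ
      have hQA : ∀ n ≤ s, P.getVert n ∈ Q.support → n = m := fun n hn h =>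
        inj _ _ (by omega) (by omega) (hQS _ h (.inr (.inr ⟨n, hn, rfl⟩)))
      rcases hkj with rfl | rfl
      · refine ⟨k, m, e, K.concat hadj, Q, hKc, hQ, ?_, hk, hm, .inl rfl, he, hel, hKcA, hQA, hKcB,
          hQB⟩
        simp only [hmemKc]
        rintro x (hx | rfl) hx'
        · exact hwK (hQS x hx' (.inl hx) ▸ hx)
        · exact hd hx'
      · exact ⟨j, m, e, J, Q, hJ, hQ, fun x hx hx' => hwJ (hQS x hx' (.inr (.inl hx)) ▸ hx), hj, hm,
          .inl rfl, he, hel, hJA, hQA, fun n hn => hJB n (by omega), hQB⟩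
    · refine ⟨k, j, b, K.concat hadj, J, hKc, hJ, ?_, hk, hj, hkj, by omega, hb, hKcA, hJA, hKcB,
        fun n hn => hJB n (by omega)⟩
      simp only [hmemKc]
      rintro x (hx | rfl) hx'
      · exact hKJ x hx hx'
      · exact hbc (hJB _ (by omega) (by omega) hx').symm

theorem Walk.IsPath.exists_isCycle_of_noncrossing [Fintype V] [DecidableRel G.Adj] {u v : V}
    {P : G.Walk u v} (hP : P.IsPath) (hG : ∀ d : V, (G.induce {x : V | x ≠ d}).Preconnected)
    (hu : ∀ x y, G.Adj u x → G.Adj u y → ¬G.Adj x y)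
    (hv : ∀ x y, G.Adj v x → G.Adj v y → ¬G.Adj x y) {s t : ℕ} (hs : 0 < s) (hst : s ≤ t)
    (ht : t < P.length) (hus : G.Adj u (P.getVert s)) (hvt : G.Adj v (P.getVert t))
    (huN : ∀ x, G.Adj u x → ∃ n ≤ s, P.getVert n = x)
    (hvN : ∀ x, G.Adj v x → ∃ n, t ≤ n ∧ n ≤ P.length ∧ P.getVert n = x) :
    ∃ (a : V) (w : G.Walk a a), w.IsCycle ∧ 2 * (G.degree u + G.degree v) ≤ w.length + 4 ∧
      (s < t → 2 * (G.degree u + G.degree v) ≤ w.length + 2) := by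
  have inj : ∀ m n, m ≤ P.length → n ≤ P.length → P.getVert m = P.getVert n → m = n :=
    fun m n hm hn h => hP.getVert_injOn hm hn h
  obtain ⟨k, j, b, K, J, hK, hJ, hKJ, hk, hj, hkj, htb, hb, hKA, hJA, hKB, hJB⟩ :=
    hP.exists_linkage hG hs hst ht
  have hkj_ne : P.getVert k ≠ P.getVert j :=
    fun h => hKJ _ K.start_mem_support (by rw [h]; exact J.start_mem_support)
  obtain ⟨α, hα, hαA, hαN⟩ : ∃ α : G.Walk (P.getVert j) (P.getVert k), α.IsPath ∧
      (∀ x ∈ α.support, ∃ n ≤ s, P.getVert n = x) ∧ ∀ x, G.Adj u x → x ∈ α.support := by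
    have hmem := fun x => P.mem_support_take_iff (z := x) (hst.trans ht.le)
    rcases hkj with rfl | rfl
    · obtain ⟨q, hq, hqs, hqN⟩ := (hP.take k).exists_isPath_covering hus
        ((hmem _).2 ⟨j, hj, rfl⟩) hkj_ne.symm
      exact ⟨q, hq, fun x hx => (hmem x).1 (hqs hx), fun x hx => hqN x ((hmem x).2 (huN x hx)) hx⟩
    · obtain ⟨q, hq, hqs, hqN⟩ := (hP.take j).exists_isPath_covering hus
        ((hmem _).2 ⟨k, hk, rfl⟩) hkj_ne
      refine ⟨q.reverse, hq.reverse, fun x hx => (hmem x).1 (hqs (by simpa using hx)),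
        fun x hx => ?_⟩
      simpa using hqN x ((hmem x).2 (huN x hx)) hx
  obtain ⟨β, hβ, hβB, hβN⟩ : ∃ β : G.Walk (P.getVert b) (P.getVert t), β.IsPath ∧
      (∀ x ∈ β.support, ∃ n, t ≤ n ∧ n ≤ P.length ∧ P.getVert n = x) ∧
      ∀ x, G.Adj v x → x ∈ β.support := by
    have hmem : ∀ x, x ∈ (P.drop t).reverse.support ↔ _ := fun x => by
      rw [support_reverse, List.mem_reverse, P.mem_support_drop_iff ht.le]
    obtain ⟨q, hq, hqs, hqN⟩ := (hP.drop t).reverse.exists_isPath_covering hvt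
      ((hmem _).2 ⟨b, htb.le, hb, rfl⟩) fun h => by
        have := inj _ _ hb ht.le h
        omega
    exact ⟨q, hq, fun x hx => (hmem x).1 (hqs hx), fun x hx => hqN x ((hmem x).2 (hvN x hx)) hx⟩
  have hαK : ∀ x ∈ α.support, x ∈ K.support → x = P.getVert k := fun x hx hx' => by
    obtain ⟨n, hn, rfl⟩ := hαA x hx
    rw [hKA n hn hx']
  have hαJ : ∀ x ∈ α.support, x ∈ J.support → x = P.getVert j := fun x hx hx' => by
    obtain ⟨n, hn, rfl⟩ := hαA x hx
    rw [hJA n hn hx']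
  have hKβ : ∀ x ∈ K.support, x ∈ β.support → x = P.getVert t := fun x hx hx' => by
    obtain ⟨n, hn, hn', rfl⟩ := hβB x hx'
    rw [hKB n hn hn' hx]
  have hJβ : ∀ x ∈ J.support, x ∈ β.support → x = P.getVert b := fun x hx hx' => by
    obtain ⟨n, hn, hn', rfl⟩ := hβB x hx'
    rw [hJB n hn hn' hx]
  have hαβ : ∀ x ∈ α.support, x ∈ β.support → x = P.getVert t := fun x hx hx' => by
    obtain ⟨n, hn, rfl⟩ := hαA x hx
    obtain ⟨l, hl, hl', h⟩ := hβB _ hx'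
    have := inj _ _ hl' (by omega) h
    rw [show n = t by omega]
  have hlen : ∀ {x y : ℕ} (q : G.Walk (P.getVert x) (P.getVert y)), x ≤ P.length → y ≤ P.length →
      x ≠ y → 0 < q.length := fun q hx hy hxy => by
    by_contra h
    exact hxy (inj _ _ hx hy (q.eq_of_length_eq_zero (by omega)))
  have hJlen := hlen J (by omega) hb (by omega)
  have hβlen := hlen β hb ht.le (by omega)
  have hαd := α.two_mul_card_le_length_add_two (G.neighborFinset u)
    (by simpa using fun x hx y hy => hu x y hx hy) (by simpa using hαN)
  have hβd := β.two_mul_card_le_length_add_two (G.neighborFinset v)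
    (by simpa using fun x hx y hy => hv x y hx hy) (by simpa using hβN)
  rw [card_neighborFinset_eq_degree] at hαd hβd
  obtain ⟨a, w, hw, hwl⟩ := exists_isCycle_of_inter (hα.append_of_inter hK hαK)
    (hJ.append_of_inter hβ hJβ) (fun x hx hx' => by
      rw [mem_support_append_iff] at hx hx'
      rcases hx with hx | hx <;> rcases hx' with hx' | hx'
      · exact .inl (hαJ x hx hx')
      · exact .inr (hαβ x hx hx')
      · exact absurd hx' (hKJ x hx)
      · exact .inr (hKβ x hx hx')) (.inr (by rw [length_append]; omega))
  rw [length_append, length_append] at hwl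
  refine ⟨a, w, hw, by omega, fun h => ?_⟩
  have hKlen := hlen K (by omega) ht.le (by omega)
  omega

theorem Walk.IsPath.exists_isCycle_of_crossing {u v : V} {P : G.Walk u v} (hP : P.IsPath)
    {i j : ℕ} (hij : i < j) (hj : j ≤ P.length) (hi : G.Adj v (P.getVert i))
    (hju : G.Adj u (P.getVert j)) (hne : i ≠ 0 ∨ j ≠ P.length) :
    ∃ (a : V) (w : G.Walk a a), w.IsCycle ∧ w.length + j = P.length + 2 + i := by
  have inj : ∀ m n, m ≤ P.length → n ≤ P.length → P.getVert m = P.getVert n → m = n :=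
    fun m n hm hn h => hP.getVert_injOn hm hn h
  have hvt : v ∉ (P.take i).support := by
    rw [P.mem_support_take_iff (by omega)]
    rintro ⟨n, hn, h⟩
    have := inj n P.length (by omega) le_rfl (by simpa using h)
    omega
  have hud : u ∉ (P.drop j).support := by
    rw [P.mem_support_drop_iff hj]
    rintro ⟨n, hn, hn', h⟩
    have := inj n 0 hn' (by omega) (by simpa using h)
    omega
  obtain ⟨a, w, hw, hwl⟩ := exists_isCycle_of_inter ((hP.take i).concat hvt hi.symm)
    ((hP.drop j).cons (h := hju) hud) (fun x hx hx' => by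
      rw [support_concat, List.mem_append, List.mem_singleton,
        P.mem_support_take_iff (by omega)] at hx
      rw [support_cons, List.mem_cons, P.mem_support_drop_iff hj] at hx'
      rcases hx with ⟨n, hn, rfl⟩ | hx
      · rcases hx' with hx' | ⟨l, hl, hl', h⟩
        · exact .inl hx'
        · have := inj _ _ hl' (by omega) h
          omega
      · exact .inr hx) (by simp only [length_concat, length_cons, take_length, drop_length]; omega)
  simp only [length_concat, length_cons, take_length, drop_length] at hwl
  exact ⟨a, w, hw, by omega⟩

end SimpleGraph

/-- The counting behind a minimal crossing: deleting the gap between `i` and `j`, the sets `I - e`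
(minus at most `e` elements) and `J` occupy distinct positions of one parity. -/
theorem two_mul_card_add_card_le_of_gap {I J : Finset ℕ} {e m i j : ℕ} (he : e = 1 ∨ e = 2)
    (hm : m % 2 = e % 2) (hI : ∀ n ∈ I, n ≤ m ∧ n % 2 = 1)
    (hJ : ∀ n ∈ J, n ≤ m ∧ n % 2 = (e + 1) % 2) (hij : i < j) (hi : i ∈ J) (hj : j ∈ I)
    (hgapI : ∀ n ∈ I, i < n → j ≤ n) (hgapJ : ∀ n ∈ J, i < n → j ≤ n)
    (hdisj : ∀ n ∈ J, n + e ∉ I) :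
    2 * (I.card + J.card) + j ≤ m + 2 + i + 2 * e := by
  set I' := I.filter fun n => e ≤ n ∧ n ≠ j with hI'
  have hcardI : I.card ≤ I'.card + e := by
    have hsub : I ⊆ I' ∪ (if e = 1 then {j} else {1, j}) := fun n hn => by
      have := hI n hn
      have := hI j hj
      split_ifs <;> simp only [hI', Finset.mem_union, Finset.mem_filter, Finset.mem_insert,
        Finset.mem_singleton, hn, true_and] <;> omega
    refine (Finset.card_le_card hsub).trans ((Finset.card_union_le _ _).trans ?_)
    split_ifs with h
    · simp [h]
    · have := Finset.card_le_two (a := 1) (b := j)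
      omega
  have hImg : (I'.image (· - e)).card = I'.card :=
    Finset.card_image_of_injOn fun a ha b hb h => by
      simp only [hI', Finset.coe_filter, Set.mem_ofPred_eq] at ha hb h
      omega
  have hdis : Disjoint (I'.image (· - e)) J := by
    rw [Finset.disjoint_left]
    intro n hn hnJ
    obtain ⟨k, hk, rfl⟩ := Finset.mem_image.1 hn
    rw [hI', Finset.mem_filter] at hk
    exact hdisj _ hnJ (by rw [Nat.sub_add_cancel hk.2.1]; exact hk.1)
  have hprop : ∀ n ∈ I'.image (· - e) ∪ J, n < m ∧ n % 2 = (e + 1) % 2 ∧ (n ≤ i ∨ j ≤ n) := by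
    intro n hn
    have hj' := hI j hj
    rcases Finset.mem_union.1 hn with hn | hn
    · obtain ⟨k, hk, rfl⟩ := Finset.mem_image.1 hn
      rw [hI', Finset.mem_filter] at hk
      have := hI k hk.1
      have := hgapI k hk.1
      omega
    · have := hJ n hn
      have := hgapJ n hn
      omega
  have hij' := hJ i hi
  have hj' := hI j hj
  have hcard := Finset.card_le_card_of_injOn (s := I'.image (· - e) ∪ J)
    (t := Finset.range ((m + i - j) / 2 + 1))
    (fun n => if n ≤ i then n / 2 else (n - (j - i) + 1) / 2)
    (fun n hn => by
      have := hprop n hn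
      simp only [Finset.coe_range, Set.mem_Iio]
      split_ifs <;> omega)
    (fun a ha b hb h => by
      have := hprop a ha
      have := hprop b hb
      simp only at h
      split_ifs at h <;> omega)
  rw [Finset.card_union_of_disjoint hdis, hImg, Finset.card_range] at hcard
  omega

namespace SimpleGraph

theorem exists_adj_ne_of_forall_induce_connected {V : Type*} [Fintype V] {G : SimpleGraph V}
    (hV : 3 ≤ Fintype.card V) (hG : ∀ d : V, (G.induce {x : V | x ≠ d}).Preconnected) (u v : V) :
    ∃ z, G.Adj u z ∧ z ≠ v := by
  classical
  have main : ∀ w, u ≠ w → ∃ z, G.Adj u z ∧ z ≠ w := fun w huw => by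
    obtain ⟨y, hy⟩ := Finset.exists_mem_notMem_of_card_lt_card (s := {u, w}) (t := Finset.univ)
      (Finset.card_le_two.trans_lt hV)
    simp only [Finset.mem_univ, Finset.mem_insert, Finset.mem_singleton, not_or, true_and] at hy
    have : Nontrivial {x : V | x ≠ w} :=
      ⟨⟨u, huw⟩, ⟨y, hy.2⟩, fun h => hy.1 (Subtype.ext_iff.1 h).symm⟩
    obtain ⟨z, hz⟩ := (hG w).exists_adj_of_nontrivial ⟨u, huw⟩
    exact ⟨z, hz, z.2⟩
  by_cases huv : u = v
  · obtain ⟨y, hy⟩ := Fintype.exists_ne_of_one_lt_card (by omega) u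
    obtain ⟨z, hz, -⟩ := main y hy.symm
    exact ⟨z, hz, fun h => hz.ne (huv.trans h.symm)⟩
  · exact main v huv

/-- Both cases of Jackson's lemma: `e = 1` when the ends of `P` lie in different parts, `e = 2`
when they lie in the same part. -/
theorem exists_isCycle_of_maximal_path {V : Type*} [Fintype V] (G : SimpleGraph V)
    [DecidableRel G.Adj] (c : V → ℕ) (hc : ∀ x y, G.Adj x y → (c x + c y) % 2 = 1)
    (hV : 3 ≤ Fintype.card V) (hG : ∀ d : V, (G.induce {x : V | x ≠ d}).Preconnected)
    {u v : V} {P : G.Walk u v} (hP : P.IsPath)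
    (hmax : ∀ z : V, G.Adj u z ∨ G.Adj v z → z ∈ P.support) {e : ℕ} (he : e = 1 ∨ e = 2)
    (huv : (c u + c v) % 2 = e % 2) :
    ∃ (a : V) (w : G.Walk a a), w.IsCycle ∧
      min (P.length + 2 - e) (2 * (G.degree u + G.degree v - e)) ≤ w.length := by
  classical
  have inj : ∀ m n, m ≤ P.length → n ≤ P.length → P.getVert m = P.getVert n → m = n :=
    fun m n hm hn h => hP.getVert_injOn hm hn h
  have hpar : ∀ n ≤ P.length, (c u + c (P.getVert n)) % 2 = n % 2 := fun n hn => by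
    induction n with
    | zero => rw [P.getVert_zero]; omega
    | succ n ih =>
      have := ih (by omega)
      have := hc _ _ (P.adj_getVert_succ (i := n) (by omega))
      omega
  have hlen : P.length % 2 = e % 2 := by
    have := hpar _ le_rfl
    rw [P.getVert_length] at this
    omega
  set I := (Finset.range (P.length + 1)).filter fun n => G.Adj u (P.getVert n) with hI
  set J := (Finset.range (P.length + 1)).filter fun n => G.Adj v (P.getVert n) with hJ
  have memI : ∀ n, n ∈ I ↔ n ≤ P.length ∧ G.Adj u (P.getVert n) := by
    simp [hI]
  have memJ : ∀ n, n ∈ J ↔ n ≤ P.length ∧ G.Adj v (P.getVert n) := by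
    simp [hJ]
  have hIpar : ∀ n ∈ I, n ≤ P.length ∧ n % 2 = 1 := fun n hn => by
    have hn := (memI n).1 hn
    have := hpar n hn.1
    have := hc _ _ hn.2
    omega
  have hJpar : ∀ n ∈ J, n ≤ P.length ∧ n % 2 = (e + 1) % 2 := fun n hn => by
    have hn := (memJ n).1 hn
    have := hpar n hn.1
    have := hc _ _ hn.2
    omega
  have hdeg : ∀ x, (∀ z, G.Adj x z → z ∈ P.support) →
      ((Finset.range (P.length + 1)).filter fun n => G.Adj x (P.getVert n)).card = G.degree x := by
    intro x hx
    rw [← card_neighborFinset_eq_degree, ← Finset.card_image_of_injOn (f := P.getVert)]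
    · congr 1
      ext z
      simp only [Finset.mem_image, Finset.mem_filter, Finset.mem_range, mem_neighborFinset]
      constructor
      · rintro ⟨n, hn, rfl⟩
        exact hn.2
      · intro hz
        obtain ⟨n, rfl, hn⟩ := Walk.mem_support_iff_exists_getVert.1 (hx z hz)
        exact ⟨n, ⟨by omega, hz⟩, rfl⟩
    · intro m hm n hn h
      simp only [Finset.coe_filter, Finset.mem_range, Set.mem_ofPred_eq] at hm hn
      exact inj m n (by omega) (by omega) h
  have hIcard : I.card = G.degree u := hdeg u fun z hz => hmax z (.inl hz)
  have hJcard : J.card = G.degree v := hdeg v fun z hz => hmax z (.inr hz)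
  have hIne : I.Nonempty := by
    obtain ⟨z, hz, -⟩ := exists_adj_ne_of_forall_induce_connected hV hG u v
    obtain ⟨n, rfl, hn⟩ := Walk.mem_support_iff_exists_getVert.1 (hmax z (.inl hz))
    exact ⟨n, (memI n).2 ⟨hn, hz⟩⟩
  have hJne : J.Nonempty := by
    obtain ⟨z, hz, -⟩ := exists_adj_ne_of_forall_induce_connected hV hG v u
    obtain ⟨n, rfl, hn⟩ := Walk.mem_support_iff_exists_getVert.1 (hmax z (.inr hz))
    exact ⟨n, (memJ n).2 ⟨hn, hz⟩⟩
  have hlen2 : 1 < P.length := by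
    obtain ⟨z, hz, hzv⟩ := exists_adj_ne_of_forall_induce_connected hV hG u v
    obtain ⟨n, rfl, hn⟩ := Walk.mem_support_iff_exists_getVert.1 (hmax z (.inl hz))
    have := (hIpar n ((memI n).2 ⟨hn, hz⟩)).2
    have : n ≠ P.length := by
      rintro rfl
      simp at hzv
    omega
  by_cases hadj : G.Adj u v
  · obtain ⟨a, w, hw, hwl⟩ := Walk.exists_isCycle_of_inter hP
      (Walk.IsPath.nil.cons (h := hadj) (by simpa using hadj.ne)) (by simp) (.inl hlen2)
    simp only [Walk.length_cons, Walk.length_nil] at hwl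
    exact ⟨a, w, hw, (min_le_left _ _).trans (by omega)⟩
  by_cases hcross : ∃ D i j, i ∈ J ∧ j ∈ I ∧ i < j ∧ j = i + D
  · obtain ⟨i, j, hi, hj, hij, hD⟩ := Nat.find_spec hcross
    have hmin : ∀ i' j', i' ∈ J → j' ∈ I → i' < j' → j - i ≤ j' - i' := fun i' j' hi' hj' h => by
      have := Nat.find_min' hcross ⟨i', j', hi', hj', h, (Nat.add_sub_cancel' h.le).symm⟩
      omega
    have hi' := (memJ i).1 hi
    have hj' := (memI j).1 hj
    obtain ⟨a, w, hw, hwl⟩ := hP.exists_isCycle_of_crossing hij hj'.1 hi'.2 hj'.2 (.inl (by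
      rintro rfl
      exact hadj (by simpa using hi'.2.symm)))
    refine ⟨a, w, hw, ?_⟩
    by_cases hDe : j - i ≤ e
    · exact (min_le_left _ _).trans (by omega)
    · have := two_mul_card_add_card_le_of_gap he hlen hIpar hJpar hij hi hj
        (fun n hn h => by have := hmin i n hi hn h; omega)
        (fun n hn h => by
          by_contra hlt
          have := hmin n j hn hj (by omega)
          omega)
        (fun n hn hn' => by have := hmin n _ hn hn' (by omega); omega)
      exact (min_le_right _ _).trans (by omega)
  · have hnc : ∀ i ∈ J, ∀ j ∈ I, j ≤ i := fun i hi j hj => by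
      by_contra h
      exact hcross ⟨j - i, i, j, hi, hj, by omega, by omega⟩
    have hs := I.max'_mem hIne
    have ht := J.min'_mem hJne
    have hst := hnc _ ht _ hs
    have hs' := (memI _).1 hs
    have ht' := (memJ _).1 ht
    have hs2 := hIpar _ hs
    have ht2 := hJpar _ ht
    have htlt : J.min' hJne < P.length := lt_of_le_of_ne ht'.1 fun h => by
      rw [h, P.getVert_length] at ht'
      exact ht'.2.ne rfl
    have hind : ∀ x y z, G.Adj x y → G.Adj x z → ¬G.Adj y z := fun x y z h₁ h₂ h₃ => by
      have := hc _ _ h₁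
      have := hc _ _ h₂
      have := hc _ _ h₃
      omega
    obtain ⟨a, w, hw, hw₁, hw₂⟩ := hP.exists_isCycle_of_noncrossing hG (hind u) (hind v)
      (by omega) hst htlt hs'.2 ht'.2
      (fun x hx => by
        obtain ⟨n, rfl, hn⟩ := Walk.mem_support_iff_exists_getVert.1 (hmax x (.inl hx))
        exact ⟨n, I.le_max' n ((memI n).2 ⟨hn, hx⟩), rfl⟩)
      (fun x hx => by
        obtain ⟨n, rfl, hn⟩ := Walk.mem_support_iff_exists_getVert.1 (hmax x (.inr hx))
        exact ⟨n, J.min'_le n ((memJ n).2 ⟨hn, hx⟩), hn, rfl⟩)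
    exact ⟨a, w, hw, (min_le_right _ _).trans (by omega)⟩

end SimpleGraph

/-- **Lemma (Jackson 1985).** Let `G = (X,Y;E)` be a 2-connected bipartite graph and `P` a
maximal path in `G` with end-vertices `u` and `v` (i.e. `N_G(u) ∪ N_G(v) ⊆ V(P)`).
(i) If `u ∈ X` and `v ∈ Y`, then `G` contains a cycle of length at least
`min{|V(P)|, 2(d(u) + d(v) - 1)}`.
(ii) If `u, v ∈ X`, then `G` contains a cycle of length at least
`min{|V(P)| - 1, 2(d(u) + d(v) - 2)}`. -/
theorem stmt_17 {V : Type} [Fintype V] [DecidableEq V]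
    (G : SimpleGraph V) [DecidableRel G.Adj] (X Y : Finset V)
    (hpart : ∀ v : V, v ∈ X ∨ v ∈ Y) (hdisj : Disjoint X Y)
    (hbip : ∀ u v : V, G.Adj u v → (u ∈ X ∧ v ∈ Y) ∨ (u ∈ Y ∧ v ∈ X))
    (h2conn : 3 ≤ Fintype.card V ∧ G.Connected ∧
      ∀ v : V, (G.induce {u : V | u ≠ v}).Connected)
    (u v : V) (P : G.Walk u v) (hP : P.IsPath)
    (hmax : ∀ z : V, G.Adj u z ∨ G.Adj v z → z ∈ P.support) :
    (u ∈ X → v ∈ Y →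
      ∃ (a : V) (w : G.Walk a a), w.IsCycle ∧
        min P.support.length (2 * (G.degree u + G.degree v - 1)) ≤ w.length) ∧
    (u ∈ X → v ∈ X →
      ∃ (a : V) (w : G.Walk a a), w.IsCycle ∧
        min (P.support.length - 1) (2 * (G.degree u + G.degree v - 2)) ≤ w.length) := by
  have hG := fun d => (h2conn.2.2 d).preconnected
  have hXY : ∀ x, x ∈ Y → x ∉ X := fun x hy hx => Finset.disjoint_left.1 hdisj hx hy
  have hc : ∀ x y, G.Adj x y → ((if x ∈ X then 0 else 1) + (if y ∈ X then 0 else 1)) % 2 = 1 :=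
    fun x y h => by
      rcases hbip x y h with ⟨hx, hy⟩ | ⟨hx, hy⟩
      · simp [hx, hXY y hy]
      · simp [hy, hXY x hx]
  have main := fun e => G.exists_isCycle_of_maximal_path (fun x => if x ∈ X then 0 else 1) hc
    h2conn.1 hG hP hmax (e := e)
  rw [SimpleGraph.Walk.length_support]
  refine ⟨fun hu hv => ?_, fun hu hv => ?_⟩
  · exact main 1 (.inl rfl) (by simp [hu, hXY v hv])
  · exact main 2 (.inr rfl) (by simp [hu, hv])
end
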